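/- Let m, n ≥ 2, d ≥ 1, and 1 ≤ r ≤ min{m,n}−1 be integers. Then the set {P ∈ POL_{d,m×n} : normal rank of P is at most r} is a closed subset of the metric space POL_{d,m×n}, and it equals the union ⋃_{a=0}^{rd} closure(O_a). -/

import Mathlib

open Matrix Finset

namespace MPoly

/-- The space `POL_{d,m×n}` of `m × n` complex matrix polynomials of grade `d`,
identified with the tuple of coefficients `(A_0, …, A_d)`. -/
abbrev Pol (d m n : ℕ) := Fin (d+1) → Matrix (Fin m) (Fin n) ℂ

/-- A matrix pencil `λ A + B` of size `p × q`, identified with the pair `(A, B)`. -/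
abbrev Pencil (p q : ℕ) := Matrix (Fin p) (Fin q) ℂ × Matrix (Fin p) (Fin q) ℂ

/-- The metric on `POL_{d,m×n}`:  `dist(P,P') = (Σ_i ‖A_i − A'_i‖_F²)^(1/2)`. -/
noncomputable def polDist {m n d : ℕ} (P P' : Pol d m n) : ℝ :=
  Real.sqrt (∑ k, ∑ i, ∑ j, ‖P k i j - P' k i j‖ ^ 2)

/-- The Frobenius norm of a matrix polynomial: `‖P‖_F = (Σ_i ‖A_i‖_F²)^(1/2)`. -/
noncomputable def polNorm {m n d : ℕ} (P : Pol d m n) : ℝ :=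
  Real.sqrt (∑ k, ∑ i, ∑ j, ‖P k i j‖ ^ 2)

/-- The metric on pencils: `dist(λA+B, λA'+B') = (‖A−A'‖_F² + ‖B−B'‖_F²)^(1/2)`. -/
noncomputable def penDist {p q : ℕ} (L L' : Pencil p q) : ℝ :=
  Real.sqrt ((∑ i, ∑ j, ‖L.1 i j - L'.1 i j‖ ^ 2) + (∑ i, ∑ j, ‖L.2 i j - L'.2 i j‖ ^ 2))

/-- The `λ`-part `A = diag(A_d, I_n, …, I_n)` of the first companion form. -/
noncomputable def compA (m n d : ℕ) (P : Pol d m n) :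
    Matrix (Fin (m + n*(d-1))) (Fin (n*d)) ℂ := fun i j =>
  if hi : (i : ℕ) < m then
    if hj : (j : ℕ) < n then P (Fin.last d) ⟨i, hi⟩ ⟨j, hj⟩ else 0
  else if (i : ℕ) - m = (j : ℕ) - n ∧ n ≤ (j : ℕ) then 1 else 0

/-- The constant part `B` of the first companion form: first block row
`(A_{d-1}, …, A_0)`, with `−I_n` in block entries `(i+1, i)`. -/
noncomputable def compB (m n d : ℕ) (P : Pol d m n) :
    Matrix (Fin (m + n*(d-1))) (Fin (n*d)) ℂ := fun i j =>
  if hi : (i : ℕ) < m then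
    if hn : 0 < n then
      P ⟨d - 1 - (j : ℕ) / n, Nat.lt_succ_of_le ((Nat.sub_le _ _).trans (Nat.sub_le d 1))⟩ ⟨i, hi⟩ ⟨(j : ℕ) % n, Nat.mod_lt _ hn⟩
    else 0
  else if (j : ℕ) = (i : ℕ) - m then -1 else 0

/-- The first Frobenius companion form `C¹_P` of a matrix polynomial. -/
noncomputable def comp (m n d : ℕ) (P : Pol d m n) : Pencil (m + n*(d-1)) (n*d) :=
  (compA m n d P, compB m n d P)

/-- Strict equivalence of matrix pencils: `Q⁻¹ (λA+B) R = λC+D` for invertible `Q, R`. -/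
def StrictEquiv {p q : ℕ} (L M : Pencil p q) : Prop :=
  ∃ (Q : Matrix (Fin p) (Fin p) ℂ) (R : Matrix (Fin q) (Fin q) ℂ),
    IsUnit Q ∧ IsUnit R ∧ Q⁻¹ * L.1 * R = M.1 ∧ Q⁻¹ * L.2 * R = M.2

/-- The strict equivalence orbit of a pencil. -/
def orbE {p q : ℕ} (L : Pencil p q) : Set (Pencil p q) := {M | StrictEquiv L M}

/-- The generalized Sylvester space `GSYL¹_{d,m×n}` of all first companion forms. -/
def GSYL (m n d : ℕ) : Set (Pencil (m + n*(d-1)) (n*d)) := Set.range (comp m n d)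

/-- A matrix polynomial viewed as a matrix over the field `ℂ(λ)` of rational functions. -/
noncomputable def ratMatrix {m n d : ℕ} (P : Pol d m n) :
    Matrix (Fin m) (Fin n) (RatFunc ℂ) :=
  fun i j => ∑ k : Fin (d+1), RatFunc.C (P k i j) * RatFunc.X ^ (k : ℕ)

/-- The normal rank of a matrix polynomial: its rank over `ℂ(λ)`. -/
noncomputable def nrank {m n d : ℕ} (P : Pol d m n) : ℕ := (ratMatrix P).rank

/-- Offset of the `b`-th diagonal block when block `j` has size `sz j`. -/
def off (sz : ℕ → ℕ) (b : ℕ) : ℕ := ∑ j ∈ Finset.range b, sz j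

/-- The `p × q` matrix given as a direct sum of `N` diagonal blocks, where block `b`
has size `ρ b × γ b` and entries `ent b`, blocks being laid out along the diagonal
in order (block `b` occupies rows `[off ρ b, off ρ b + ρ b)` and columns
`[off γ b, off γ b + γ b)`); all other entries are zero. -/
noncomputable def dsum (N : ℕ) (ρ γ : ℕ → ℕ) (ent : ℕ → ℕ → ℕ → ℂ) (p q : ℕ) :
    Matrix (Fin p) (Fin q) ℂ := fun x y =>
  ∑ b ∈ Finset.range N,
    if off ρ b ≤ (x:ℕ) ∧ (x:ℕ) < off ρ b + ρ b ∧ off γ b ≤ (y:ℕ) ∧ (y:ℕ) < off γ b + γ b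
    then ent b ((x:ℕ) - off ρ b) ((y:ℕ) - off γ b) else 0

/-- Sizes of the four sections of blocks: `c₁` blocks of size `v₁`, then `c₂` of size
`v₂`, then `c₃` of size `v₃`, then the rest of size `v₄`. -/
def secSize (c₁ c₂ c₃ : ℕ) (v₁ v₂ v₃ v₄ : ℕ) (i : ℕ) : ℕ :=
  if i < c₁ then v₁ else if i < c₁ + c₂ then v₂ else if i < c₁ + c₂ + c₃ then v₃ else v₄

/-- The `p × q` pencil which is the direct sum of `c₁` copies of `L_{e₁}`, `c₂` copies
of `L_{e₂}`, `c₃` copies of `L_{f₁}ᵀ` and `c₄` copies of `L_{f₂}ᵀ`.  Here `L_k` is the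
`k × (k+1)` pencil `λ G_k + F_k` with `G_k` having ones in entries `(i,i)` and `F_k`
having ones in entries `(i,i+1)`. -/
noncomputable def genPencil (c₁ c₂ c₃ c₄ e₁ e₂ f₁ f₂ p q : ℕ) : Pencil p q :=
  (dsum (c₁+c₂+c₃+c₄) (secSize c₁ c₂ c₃ e₁ e₂ (f₁+1) (f₂+1))
     (secSize c₁ c₂ c₃ (e₁+1) (e₂+1) f₁ f₂)
     (fun _ i j => if i = j then 1 else 0) p q,
   dsum (c₁+c₂+c₃+c₄) (secSize c₁ c₂ c₃ e₁ e₂ (f₁+1) (f₂+1))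
     (secSize c₁ c₂ c₃ (e₁+1) (e₂+1) f₁ f₂)
     (fun b i j => if b < c₁ + c₂ then (if j = i+1 then 1 else 0)
       else (if i = j+1 then 1 else 0)) p q)

/-- The generic pencil `G_a` of Theorem 3.2 (viewed at grade `d`):  the direct sum of
`s` copies of `L_{α+d}`, `n−r−s` copies of `L_{α+d−1}`, `t` copies of `L_{β+1}ᵀ` and
`m−r−t` copies of `L_βᵀ`, where `α = ⌊a/(n−r)⌋`, `s = a mod (n−r)`,
`β = ⌊(rd−a)/(m−r)⌋`, `t = (rd−a) mod (m−r)`. -/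
noncomputable def Ga (m n d r a : ℕ) : Pencil (m + n*(d-1)) (n*d) :=
  genPencil (a % (n-r)) (n-r - a % (n-r)) ((r*d - a) % (m-r)) (m-r - (r*d - a) % (m-r))
    (a/(n-r) + d) (a/(n-r) + d - 1) ((r*d - a)/(m-r) + 1) ((r*d - a)/(m-r))
    (m + n*(d-1)) (n*d)


/-- The generic rank-`ρ` pencil of size `p × q` with parameter `b` (Theorem 3.2 of
De Terán–Dopico): direct sum of `s₁` copies of `L_{α₁+1}`, `q−ρ−s₁` copies of `L_{α₁}`,
`t₁` copies of `L_{β₁+1}ᵀ` and `p−ρ−t₁` copies of `L_{β₁}ᵀ`, where `α₁ = ⌊b/(q−ρ)⌋`,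
`s₁ = b mod (q−ρ)`, `β₁ = ⌊(ρ−b)/(p−ρ)⌋`, `t₁ = (ρ−b) mod (p−ρ)`. -/
noncomputable def Kp (p q ρ b : ℕ) : Pencil p q :=
  genPencil (b % (q-ρ)) (q-ρ - b % (q-ρ)) ((ρ-b) % (p-ρ)) (p-ρ - (ρ-b) % (p-ρ))
    (b/(q-ρ) + 1) (b/(q-ρ)) ((ρ-b)/(p-ρ) + 1) ((ρ-b)/(p-ρ)) p q

/-- The generic right-singular pencil `G_rp` (case `m < n`): direct sum of `s` copies of
`L_{α+d}` and `n−m−s` copies of `L_{α+d−1}`, with `α = ⌊md/(n−m)⌋`, `s = md mod (n−m)`. -/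
noncomputable def Grp (m n d : ℕ) : Pencil (m + n*(d-1)) (n*d) :=
  genPencil (m*d % (n-m)) (n-m - m*d % (n-m)) 0 0
    (m*d/(n-m) + d) (m*d/(n-m) + d - 1) 0 0 (m + n*(d-1)) (n*d)

/-- The generic left-singular pencil `G_ℓp` (case `m > n`): direct sum of `t` copies of
`L_{β+1}ᵀ` and `m−n−t` copies of `L_βᵀ`, with `β = ⌊nd/(m−n)⌋`, `t = nd mod (m−n)`. -/
noncomputable def Glp (m n d : ℕ) : Pencil (m + n*(d-1)) (n*d) :=
  genPencil 0 0 (n*d % (m-n)) (m-n - n*d % (m-n)) 0 0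
    (n*d/(m-n) + 1) (n*d/(m-n)) (m + n*(d-1)) (n*d)

/-- The linear map `(X, Y) ↦ (XA − AY, XB − BY)` whose range is the tangent space at
`λA+B` to the strict equivalence orbit of the pencil `λA+B`. -/
noncomputable def tangentMap {p q : ℕ} (L : Pencil p q) :
    (Matrix (Fin p) (Fin p) ℂ × Matrix (Fin q) (Fin q) ℂ) →ₗ[ℂ]
      (Matrix (Fin p) (Fin q) ℂ × Matrix (Fin p) (Fin q) ℂ) where
  toFun XY := (XY.1 * L.1 - L.1 * XY.2, XY.1 * L.2 - L.2 * XY.2)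
  map_add' X Y := by
    obtain ⟨X₁, X₂⟩ := X; obtain ⟨Y₁, Y₂⟩ := Y
    simp only [Prod.mk_add_mk, Matrix.add_mul, Matrix.mul_add, Prod.mk.injEq]
    constructor <;> abel
  map_smul' c X := by
    obtain ⟨X₁, X₂⟩ := X
    simp only [Prod.smul_mk, Matrix.smul_mul, Matrix.mul_smul, RingHom.id_apply,
      Prod.mk.injEq, smul_sub]

/-- The tangent space `T = {(XA − AY, XB − BY)}` at `λA+B` to its strict equivalence
orbit, as a subspace of the pencil space. -/
noncomputable def tangent {p q : ℕ} (L : Pencil p q) :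
    Submodule ℂ (Matrix (Fin p) (Fin q) ℂ × Matrix (Fin p) (Fin q) ℂ) :=
  LinearMap.range (tangentMap L)

/-- The first companion form `C¹_M(λ) = λ A + B` regarded as a matrix over `ℂ[λ]`. -/
noncomputable def compPoly (m n d : ℕ) (M : Pol d m n) :
    Matrix (Fin (m + n*(d-1))) (Fin (n*d)) (Polynomial ℂ) := fun i j =>
  Polynomial.C (compA m n d M i j) * Polynomial.X + Polynomial.C (compB m n d M i j)

/-- The block-diagonal matrix `diag(M(λ), I_{n(d−1)})` over `ℂ[λ]`. -/
noncomputable def polyBlock (m n d : ℕ) (M : Pol d m n) :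
    Matrix (Fin (m + n*(d-1))) (Fin (n*d)) (Polynomial ℂ) := fun i j =>
  if hi : (i : ℕ) < m then
    if hj : (j : ℕ) < n then
      ∑ k : Fin (d+1), Polynomial.C (M k ⟨i, hi⟩ ⟨j, hj⟩) * Polynomial.X ^ (k : ℕ)
    else 0
  else if (i : ℕ) - m = (j : ℕ) - n ∧ n ≤ (j : ℕ) then 1 else 0

/-- The first companion form regarded as a matrix over the field `ℂ(λ)`. -/
noncomputable def compRat (m n d : ℕ) (M : Pol d m n) :
    Matrix (Fin (m + n*(d-1))) (Fin (n*d)) (RatFunc ℂ) := fun i j =>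
  RatFunc.C (compA m n d M i j) * RatFunc.X + RatFunc.C (compB m n d M i j)

section PartA
open Polynomial

theorem mem_dlt {p : ℂ[X]} {N : ℕ} : p ∈ degreeLT ℂ N ↔ ∀ i, N ≤ i → p.coeff i = 0 := by
  rw [mem_degreeLT, degree_lt_iff_coeff_zero]

theorem mul_dlt {p q : ℂ[X]} {a b : ℕ} (hp : p ∈ degreeLT ℂ a) (hq : q ∈ degreeLT ℂ (b+1)) :
    p * q ∈ degreeLT ℂ (a + b) := by
  rw [mem_dlt] at *
  intro i hi
  rw [coeff_mul]
  refine Finset.sum_eq_zero fun x hx => ?_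
  rw [Finset.HasAntidiagonal.mem_antidiagonal] at hx
  by_cases h : a ≤ x.1
  · rw [hp _ h, zero_mul]
  · rw [hq _ (by omega), mul_zero]

/-- reduced basis -/
structure RB {ι κ : Type} [Fintype ι] [Fintype κ] (Mod : Submodule ℂ[X] (ι → ℂ[X]))
    (b : κ → ι → ℂ[X]) (ε : κ → ℕ) : Prop where
  mem : ∀ j, b j ∈ Mod
  deg : ∀ j c, b j c ∈ degreeLT ℂ (ε j + 1)
  lead : LinearIndependent ℂ (fun j c => (b j c).coeff (ε j))
  span : Mod ≤ Submodule.span ℂ[X] (Set.range b)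

theorem pred_core {ι κ : Type} [Fintype κ] (b : κ → ι → ℂ[X]) (ε : κ → ℕ)
    (deg : ∀ j c, b j c ∈ degreeLT ℂ (ε j + 1))
    (lead : LinearIndependent ℂ (fun j c => (b j c).coeff (ε j)))
    (q : κ → ℂ[X]) (D : ℕ) (h : ∀ c, (∑ j, q j • b j) c ∈ degreeLT ℂ D) (j : κ) :
    q j ∈ degreeLT ℂ (D - ε j) := by
  have key : ∀ T, D ≤ T → ∀ j, ε j ≤ T → (q j).coeff (T - ε j) = 0 := by
    by_contra hcon
    push Not at hcon
    obtain ⟨B, hB⟩ : ∃ B, ∀ T, B ≤ T → ∀ j, ε j ≤ T → (q j).coeff (T - ε j) = 0 := by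
      refine ⟨∑ j, ((q j).natDegree + ε j + 1), fun T hT j hj => ?_⟩
      apply coeff_eq_zero_of_natDegree_lt
      have := Finset.single_le_sum (f := fun j => (q j).natDegree + ε j + 1) (fun i _ => Nat.zero_le _) (Finset.mem_univ j)
      try simp only at this
      omega
    obtain ⟨T, ⟨hDT, j0, hj0, hne⟩, hmax⟩ : ∃ T, (D ≤ T ∧ ∃ j, ε j ≤ T ∧ (q j).coeff (T - ε j) ≠ 0) ∧
        ∀ T', T < T' → ∀ j, ε j ≤ T' → (q j).coeff (T' - ε j) = 0 := by
      classical
      let Pr : ℕ → Prop := fun T => D ≤ T ∧ ∃ j, ε j ≤ T ∧ (q j).coeff (T - ε j) ≠ 0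
      obtain ⟨T0, hT0⟩ := hcon
      have hT0' : Pr T0 := hT0
      have hle : T0 ≤ B := by
        by_contra hlt
        obtain ⟨-, j, hj, hn⟩ := hT0
        exact hn (hB _ (by omega) j hj)
      refine ⟨Nat.findGreatest Pr B, Nat.findGreatest_spec hle hT0', fun T' hT' j hj => ?_⟩
      by_contra hn
      by_cases hb : B ≤ T'
      · exact hn (hB _ hb j hj)
      · have h1 : D ≤ Nat.findGreatest Pr B := (Nat.findGreatest_spec hle hT0').1
        exact Nat.findGreatest_is_greatest hT' (by omega) ⟨by omega, j, hj, hn⟩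
    have hz : ∑ j, (if ε j ≤ T then (q j).coeff (T - ε j) else 0) • (fun c => (b j c).coeff (ε j)) = 0 := by
      funext c
      have := (mem_dlt.1 (h c)) T hDT
      simp only [Finset.sum_apply, Pi.smul_apply, smul_eq_mul, finsetSum_coeff] at this
      simp only [Finset.sum_apply, Pi.smul_apply, smul_eq_mul, Pi.zero_apply]
      refine Eq.trans ?_ this
      refine Finset.sum_congr rfl fun j _ => ?_
      rw [coeff_mul]
      by_cases hj : ε j ≤ T
      · rw [if_pos hj, Finset.sum_eq_single (T - ε j, ε j)]
        · rintro ⟨x, y⟩ hxy hn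
          rw [Finset.HasAntidiagonal.mem_antidiagonal] at hxy
          simp only at hxy ⊢
          by_cases hy : ε j + 1 ≤ y
          · rw [mem_dlt.1 (deg j c) _ hy, mul_zero]
          · have hy2 : y ≠ ε j := by
              rintro rfl
              apply hn
              simp only [Prod.mk.injEq, and_true]; omega
            have := hmax (x + ε j) (by omega) j (by omega)
            rw [Nat.add_sub_cancel] at this
            rw [this, zero_mul]
        · intro hn
          exfalso; apply hn
          rw [Finset.HasAntidiagonal.mem_antidiagonal]; simp only; omega
      · rw [if_neg hj, zero_mul]
        symm
        refine Finset.sum_eq_zero ?_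
        rintro ⟨x, y⟩ hxy
        rw [Finset.HasAntidiagonal.mem_antidiagonal] at hxy
        simp only at hxy ⊢
        have := hmax (x + ε j) (by omega) j (by omega)
        rw [Nat.add_sub_cancel] at this
        rw [this, zero_mul]
    have := Fintype.linearIndependent_iff.1 lead _ hz j0
    rw [if_pos hj0] at this
    exact hne this
  rw [mem_dlt]
  intro i hi
  have := key (i + ε j) (by omega) j (by omega)
  rwa [Nat.add_sub_cancel] at this

theorem RB.pred {ι κ : Type} [Fintype ι] [Fintype κ] {Mod : Submodule ℂ[X] (ι → ℂ[X])}
    {b : κ → ι → ℂ[X]} {ε : κ → ℕ} (H : RB Mod b ε) (w : ι → ℂ[X]) (hw : w ∈ Mod) (D : ℕ)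
    (hD : ∀ c, w c ∈ degreeLT ℂ D) :
    ∃ q : κ → ℂ[X], w = ∑ j, q j • b j ∧ ∀ j, q j ∈ degreeLT ℂ (D - ε j) := by
  obtain ⟨q, hq⟩ := (Submodule.mem_span_range_iff_exists_fun ℂ[X]).1 (H.span hw)
  refine ⟨q, hq.symm, fun j => pred_core b ε H.deg H.lead q D ?_ j⟩
  rw [hq]; exact hD

theorem RB.indep {ι κ : Type} [Fintype ι] [Fintype κ] {Mod : Submodule ℂ[X] (ι → ℂ[X])}
    {b : κ → ι → ℂ[X]} {ε : κ → ℕ} (H : RB Mod b ε) (q : κ → ℂ[X])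
    (h : ∑ j, q j • b j = 0) (j : κ) : q j = 0 := by
  have := pred_core b ε H.deg H.lead q 0 (by rw [h]; intro c; exact Submodule.zero_mem _) j
  ext i
  exact mem_dlt.1 this i (by omega)

theorem exists_min_gen {ι : Type} [Fintype ι] (Mod : Submodule ℂ[X] (ι → ℂ[X])) :
    ∃ (k : ℕ) (b : Fin k → ι → ℂ[X]) (D : Fin k → ℕ), Submodule.span ℂ[X] (Set.range b) = Mod ∧
      (∀ j c, b j c ∈ degreeLT ℂ (D j)) ∧
      ∀ (b' : Fin k → ι → ℂ[X]) (D' : Fin k → ℕ), Submodule.span ℂ[X] (Set.range b') = Mod →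
        (∀ j c, b' j c ∈ degreeLT ℂ (D' j)) → ∑ j, D j ≤ ∑ j, D' j := by
  classical
  obtain ⟨k, b0, hb0⟩ := Submodule.fg_iff_exists_fin_generating_family.1 (IsNoetherian.noetherian Mod)
  have hex : ∃ N, ∃ (b : Fin k → ι → ℂ[X]) (D : Fin k → ℕ), Submodule.span ℂ[X] (Set.range b) = Mod ∧
      (∀ j c, b j c ∈ degreeLT ℂ (D j)) ∧ ∑ j, D j = N := by
    refine ⟨_, b0, fun j => ∑ c, ((b0 j c).natDegree + 1), hb0, fun j c => ?_, rfl⟩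
    rw [mem_dlt]
    intro i hi
    replace hi : ∑ c, ((b0 j c).natDegree + 1) ≤ i := hi
    apply coeff_eq_zero_of_natDegree_lt
    have := Finset.single_le_sum (f := fun c => (b0 j c).natDegree + 1) (fun i _ => Nat.zero_le _) (Finset.mem_univ c)
    try simp only at this
    omega
  obtain ⟨b, D, h1, h2, h3⟩ := Nat.find_spec hex
  refine ⟨k, b, D, h1, h2, fun b' D' h1' h2' => ?_⟩
  rw [h3]
  exact Nat.find_min' hex ⟨b', D', h1', h2', rfl⟩

theorem exists_RB {ι : Type} [Fintype ι] (Mod : Submodule ℂ[X] (ι → ℂ[X])) :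
    ∃ (κ : Type) (_ : Fintype κ) (b : κ → ι → ℂ[X]) (ε : κ → ℕ), RB Mod b ε := by
  classical
  obtain ⟨k, b, D, hspan, hdeg, hmin⟩ := exists_min_gen Mod
  have hb0 : ∀ j, D j = 0 → b j = 0 := by
    intro j hj
    funext c
    ext i
    exact mem_dlt.1 (hdeg j c) i (by omega)
  refine ⟨{j : Fin k // D j ≠ 0}, inferInstance, fun j => b j, fun j => D j - 1, ?_, ?_, ?_, ?_⟩
  · intro j
    rw [← hspan]
    exact Submodule.subset_span ⟨j, rfl⟩
  · intro j c
    have : D j - 1 + 1 = D j := by have := j.2; omega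
    simp only [this]
    exact hdeg j c
  · rw [Fintype.linearIndependent_iff]
    intro g hg
    by_contra hcon
    push Not at hcon
    obtain ⟨i1, hi1⟩ := hcon
    obtain ⟨i0, hi0, hmax⟩ := Finset.exists_max_image (Finset.univ.filter fun j => g j ≠ 0) (fun j => D j.1)
      ⟨i1, by simpa using hi1⟩
    simp only [Finset.mem_filter, Finset.mem_univ, true_and] at hi0 hmax
    set v : ι → ℂ[X] := ∑ j : {j : Fin k // D j ≠ 0}, (C (g j) * X ^ (D i0 - D j)) • b j with hv
    have hvd : ∀ c, v c ∈ degreeLT ℂ (D i0 - 1) := by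
      intro c
      rw [mem_dlt]
      intro i hi
      have h0 := congrFun hg c
      simp only [Finset.sum_apply, Pi.smul_apply, smul_eq_mul, Pi.zero_apply] at h0
      simp only [hv, Finset.sum_apply, Pi.smul_apply, smul_eq_mul, finsetSum_coeff, mul_assoc, coeff_C_mul, coeff_X_pow_mul']
      by_cases hi' : i = D i0 - 1
      · rw [← h0]
        refine Finset.sum_congr rfl fun j _ => ?_
        by_cases hgj : g j = 0
        · simp [hgj]
        · have h1 := hmax j hgj
          have h2 := j.2
          rw [if_pos (by omega)]
          congr 2
          omega
      · refine Finset.sum_eq_zero fun j _ => ?_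
        by_cases hgj : g j = 0
        · simp [hgj]
        · have h1 := hmax j hgj
          have h2 := j.2
          have h3 := i0.2
          rw [if_pos (by omega), mem_dlt.1 (hdeg j c) _ (by omega), mul_zero]
    have hlt := hmin (Function.update b i0 v) (Function.update D i0 (D i0 - 1)) ?_ ?_
    · rw [Finset.sum_update_of_mem (Finset.mem_univ _)] at hlt
      rw [← Finset.add_sum_erase _ _ (Finset.mem_univ i0.1), Finset.sdiff_singleton_eq_erase] at hlt
      have := i0.2
      omega
    · apply le_antisymm
      · rw [Submodule.span_le, ← hspan]
        rintro _ ⟨j, rfl⟩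
        by_cases hj : j = i0.1
        · subst hj
          rw [Function.update_self]
          refine Submodule.sum_mem _ fun j _ => Submodule.smul_mem _ _ (Submodule.subset_span ⟨j, rfl⟩)
        · rw [Function.update_of_ne hj]
          exact Submodule.subset_span ⟨j, rfl⟩
      · rw [← hspan, Submodule.span_le]
        rintro _ ⟨j, rfl⟩
        have hother : ∀ j, j ≠ i0.1 → b j ∈ Submodule.span ℂ[X] (Set.range (Function.update b i0 v)) := by
          intro j hj
          refine Submodule.subset_span ⟨j, ?_⟩
          rw [Function.update_of_ne hj]
        by_cases hj : j = i0.1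
        · subst hj
          have hvm : v ∈ Submodule.span ℂ[X] (Set.range (Function.update b i0 v)) :=
            Submodule.subset_span ⟨i0, by rw [Function.update_self]⟩
          have hdec : C (g i0) • b i0 = v - ∑ j ∈ Finset.univ.erase i0, (C (g j) * X ^ (D i0 - D j)) • b j := by
            rw [hv, ← Finset.add_sum_erase _ _ (Finset.mem_univ i0)]
            simp
          have h1 : C (g i0) • b i0 ∈ Submodule.span ℂ[X] (Set.range (Function.update b i0 v)) := by
            rw [hdec]
            refine Submodule.sub_mem _ hvm (Submodule.sum_mem _ fun j hj => Submodule.smul_mem _ _ (hother _ ?_))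
            intro h
            exact (Finset.mem_erase.1 hj).1 (Subtype.ext h)
          have h2 := Submodule.smul_mem _ (C (g i0)⁻¹) h1
          rw [smul_smul, ← C_mul, inv_mul_cancel₀ hi0, C_1, one_smul] at h2
          exact h2
        · exact hother j hj
    · intro j c
      by_cases hj : j = i0.1
      · subst hj
        rw [Function.update_self, Function.update_self]
        exact hvd c
      · rw [Function.update_of_ne hj, Function.update_of_ne hj]
        exact hdeg j c
  · rw [← hspan, Submodule.span_le]
    rintro _ ⟨j, rfl⟩
    by_cases hj : D j = 0
    · rw [hb0 j hj]; exact Submodule.zero_mem _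
    · exact Submodule.subset_span ⟨⟨j, hj⟩, rfl⟩

end PartA

section PartB
theorem chain_indep {V W J : Type*} [AddCommGroup V] [Module ℂ V] [AddCommGroup W] [Module ℂ W]
    [Fintype J] (A : V →ₗ[ℂ] W) (e : J → ℕ) (x : J → ℕ → V)
    (hxe : ∀ j, A (x j (e j)) = 0)
    (hZ : LinearIndependent ℂ (fun p : (j : J) × Fin (e j) => A (x p.1 p.2)))
    (hL : LinearIndependent ℂ (fun j => x j (e j))) :
    LinearIndependent ℂ (fun p : (j : J) × Fin (e j + 1) => x p.1 p.2) := by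
  rw [Fintype.linearIndependent_iff] at *
  intro g hg
  rw [Fintype.sum_sigma] at hg
  simp only [Fin.sum_univ_castSucc, Fin.val_castSucc, Fin.val_last, Finset.sum_add_distrib] at hg
  have h1 := congrArg A hg
  simp only [map_add, map_sum, map_smul, hxe, smul_zero, Finset.sum_const_zero, add_zero, map_zero] at h1
  have h2 := hZ (fun p => g ⟨p.1, p.2.castSucc⟩) (by rw [Fintype.sum_sigma]; exact h1)
  have h3 : ∀ j (i : Fin (e j)), g ⟨j, i.castSucc⟩ = 0 := fun j i => h2 ⟨j, i⟩
  simp only [h3, zero_smul, Finset.sum_const_zero, zero_add] at hg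
  have h4 := hL _ hg
  rintro ⟨j, i⟩
  induction i using Fin.lastCases with
  | last => exact h4 j
  | cast i => exact h3 j i

theorem dual_surj {V ι : Type*} [AddCommGroup V] [Module ℂ V] [Fintype ι]
    (φ : ι → Module.Dual ℂ V) (h : LinearIndependent ℂ φ) :
    Function.Surjective (LinearMap.pi φ : V →ₗ[ℂ] (ι → ℂ)) := by
  classical
  rw [← LinearMap.dualMap_injective_iff, injective_iff_map_eq_zero]
  intro g hg
  have h1 := Fintype.linearIndependent_iff.1 h (fun i => g (Pi.single i 1)) (by
    ext v
    have := LinearMap.congr_fun hg v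
    rw [LinearMap.dualMap_apply] at this
    rw [LinearMap.zero_apply] at this ⊢
    rw [← this, LinearMap.sum_apply]
    conv_rhs => rw [← LinearMap.sum_single_apply (φ := fun _ => ℂ) (v := (LinearMap.pi φ) v), map_sum]
    refine Finset.sum_congr rfl fun i _ => ?_
    have : Pi.single i ((LinearMap.pi φ) v i) = (φ i v) • (Pi.single i (1:ℂ) : ι → ℂ) := by
      rw [← Pi.single_smul]; simp
    rw [this, map_smul, LinearMap.smul_apply, smul_eq_mul, smul_eq_mul, mul_comm])
  ext i
  simpa using h1 i

theorem dual_family {V ι : Type*} [AddCommGroup V] [Module ℂ V] [Fintype ι] [DecidableEq ι]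
    (φ : ι → Module.Dual ℂ V) (h : LinearIndependent ℂ φ) :
    ∃ v : ι → V, ∀ p q, φ p (v q) = if p = q then 1 else 0 := by
  choose v hv using fun q : ι => dual_surj φ h (Pi.single q 1)
  refine ⟨v, fun p q => ?_⟩
  have := congrFun (hv q) p
  simpa [Pi.single_apply] using this

theorem kron {V W J K : Type*} [AddCommGroup V] [Module ℂ V] [AddCommGroup W] [Module ℂ W]
    [FiniteDimensional ℂ V] [FiniteDimensional ℂ W]
    [Fintype J] [Fintype K] [DecidableEq K] (A B : V →ₗ[ℂ] W) (e : J → ℕ) (x : J → ℕ → V)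
    (f : K → ℕ) (y : K → ℕ → Module.Dual ℂ W)
    (hx : ∀ j i, A (x j i) = B (x j (i+1)))
    (hxe : ∀ j, A (x j (e j)) = 0)
    (hy0 : ∀ k v, y k 0 (B v) = 0) (hy : ∀ k i v, y k i (A v) = y k (i+1) (B v))
    (hye : ∀ k v, y k (f k) (A v) = 0)
    (hZ : LinearIndependent ℂ (fun p : (j : J) × Fin (e j) => A (x p.1 p.2)))
    (hL : LinearIndependent ℂ (fun j => x j (e j)))
    (hW : LinearIndependent ℂ (fun p : (k : K) × Fin (f k) => A.dualMap (y p.1 p.2)))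
    (hLy : LinearIndependent ℂ (fun k => y k (f k)))
    (hdim : ∑ j, e j + ∑ k, (f k + 1) = Module.finrank ℂ W) :
    ∃ (u : K → ℕ → V) (z : K → ℕ → W),
      (∀ k i, i < f k → A (u k i) = z k i) ∧ (∀ k i, i < f k → B (u k i) = z k (i+1)) ∧
      LinearIndependent ℂ (Sum.elim (fun p : (j : J) × Fin (e j + 1) => x p.1 p.2)
        (fun p : (k : K) × Fin (f k) => u p.1 p.2)) ∧
      LinearIndependent ℂ (Sum.elim (fun p : (j : J) × Fin (e j) => A (x p.1 p.2))
        (fun p : (k : K) × Fin (f k + 1) => z p.1 p.2)) := by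
  have hX := chain_indep A e x hxe hZ hL
  have hY := chain_indep A.dualMap f y (fun k => by ext v; simp [hye]) hW hLy
  -- orthogonality
  have hort : ∀ k i j l, y k i (A (x j l)) = 0 := by
    intro k i
    induction i with
    | zero => intro j l; rw [hx, hy0]
    | succ i ih => intro j l; rw [hx, ← hy, ih]
  -- B hits the common kernel of all y
  have hsurj : ∀ w : W, (∀ k i, i ≤ f k → y k i w = 0) →
      ∃ c : V, B c = w ∧ ∀ k i, y k i (A c) = 0 := by
    intro w hw
    set Y : W →ₗ[ℂ] (((k : K) × Fin (f k + 1)) → ℂ) := LinearMap.pi (fun p : (k : K) × Fin (f k + 1) => y p.1 p.2) with hYdef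
    have hYs : Function.Surjective Y := dual_surj _ hY
    have hle : Submodule.span ℂ (Set.range (fun p : (j : J) × Fin (e j) => A (x p.1 p.2))) ≤ LinearMap.ker Y := by
      rw [Submodule.span_le]
      rintro _ ⟨p, rfl⟩
      rw [SetLike.mem_coe, LinearMap.mem_ker]
      funext q
      exact hort _ _ _ _
    have hfr : Module.finrank ℂ (Submodule.span ℂ (Set.range (fun p : (j : J) × Fin (e j) => A (x p.1 p.2)))) = Module.finrank ℂ (LinearMap.ker Y) := by
      have h1 := finrank_span_eq_card hZ
      have h2 := LinearMap.finrank_range_add_finrank_ker Y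
      rw [LinearMap.range_eq_top.2 hYs, finrank_top, Module.finrank_pi] at h2
      rw [h1]
      simp only [Fintype.card_sigma, Fintype.card_fin] at h2 ⊢
      omega
    have heq := Submodule.eq_of_le_of_finrank_eq hle hfr
    have hwm : w ∈ LinearMap.ker Y := by
      rw [LinearMap.mem_ker]
      funext q
      exact hw q.1 q.2 (by have := q.2.2; omega)
    rw [← heq, Submodule.mem_span_range_iff_exists_fun] at hwm
    obtain ⟨a, ha⟩ := hwm
    refine ⟨∑ p : (j : J) × Fin (e j), a p • x p.1 (p.2 + 1), ?_, ?_⟩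
    · rw [← ha, map_sum]
      refine Finset.sum_congr rfl fun p _ => ?_
      rw [map_smul, hx]
    · intro k i
      simp only [map_sum, map_smul, hort, smul_zero, Finset.sum_const_zero]
  have hyB : ∀ k i v, y k i (B v) = if i = 0 then 0 else y k (i-1) (A v) := by
    intro k i v
    cases i with
    | zero => simp [hy0]
    | succ i => simp [hy]
  obtain ⟨dv, hdv⟩ := dual_family _ hW
  obtain ⟨dw, hdw⟩ := dual_family _ hY
  have hdv' : ∀ k i (hi : i < f k) k' i', i' ≤ f k' →
      y k' i' (A (dv ⟨k, ⟨i, hi⟩⟩)) = if k' = k ∧ i' = i then 1 else 0 := by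
    intro k i hi k' i' hi'
    rcases hi'.lt_or_eq with h | h
    · have := hdv ⟨k', ⟨i', h⟩⟩ ⟨k, ⟨i, hi⟩⟩
      rw [LinearMap.dualMap_apply] at this
      simp only at this
      rw [this]
      by_cases hk : k' = k
      · subst hk; simp
      · simp [hk]
    · rw [h, hye, if_neg]
      rintro ⟨rfl, h2⟩; omega
  have hback : ∀ k t, t ≤ f k → ∃ u : ℕ → V,
      (∀ i, f k - t ≤ i → i < f k → ∀ k' i', i' ≤ f k' → y k' i' (A (u i)) = if k' = k ∧ i' = i then 1 else 0) ∧
      (∀ i, f k - t ≤ i → i + 1 < f k → A (u (i+1)) = B (u i)) := by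
    intro k t
    induction t with
    | zero => intro _; exact ⟨fun _ => 0, fun i h1 h2 => by omega, fun i h1 h2 => by omega⟩
    | succ t ih =>
      intro ht
      obtain ⟨u, hu1, hu2⟩ := ih (by omega)
      set i0 := f k - (t+1) with hi0
      have hi0f : i0 < f k := by omega
      obtain ⟨c, hc1, hc2⟩ : ∃ c : V, (i0 + 1 < f k → B c = A (u (i0+1)) - B (dv ⟨k, ⟨i0, hi0f⟩⟩)) ∧ ∀ k i, y k i (A c) = 0 := by
        by_cases h : i0 + 1 < f k
        · obtain ⟨c, h1, h2⟩ := hsurj (A (u (i0+1)) - B (dv ⟨k, ⟨i0, hi0f⟩⟩)) (by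
            intro k' i' hi'
            rw [map_sub, hu1 (i0+1) (by omega) h k' i' hi', hyB]
            by_cases h0 : i' = 0
            · subst h0; simp
            · rw [if_neg h0, hdv' k i0 hi0f k' (i'-1) (by omega)]
              have : (i' = i0 + 1) ↔ (i' - 1 = i0) := by omega
              simp [this])
          exact ⟨c, fun _ => h1, h2⟩
        · exact ⟨0, fun h' => absurd h' h, by simp⟩
      refine ⟨Function.update u i0 (dv ⟨k, ⟨i0, hi0f⟩⟩ + c), ?_, ?_⟩
      · intro i h1 h2 k' i' hi'
        by_cases h : i = i0
        · subst h
          rw [Function.update_self, map_add, map_add, hc2, add_zero, hdv' k _ hi0f k' i' hi']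
        · rw [Function.update_of_ne h]
          exact hu1 i (by omega) h2 k' i' hi'
      · intro i h1 h2
        rw [Function.update_of_ne (by omega)]
        by_cases h : i = i0
        · subst h
          rw [Function.update_self, map_add, hc1 h2]; abel
        · rw [Function.update_of_ne h]
          exact hu2 i (by omega) h2
  choose u hu1 hu2 using fun k => hback k (f k) le_rfl
  simp only [Nat.sub_self, Nat.zero_le, true_implies] at hu1 hu2
  let z : K → ℕ → W := fun k i => if i < f k then A (u k i) else
    if f k = 0 then dw ⟨k, 0⟩ else B (u k (f k - 1))
  have hz : ∀ k i, i ≤ f k → ∀ k' i', i' ≤ f k' → y k' i' (z k i) = if k' = k ∧ i' = i then 1 else 0 := by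
    intro k i hi k' i' hi'
    by_cases h : i < f k
    · simp only [z, if_pos h]
      exact hu1 k i h k' i' hi'
    · have hif : i = f k := by omega
      simp only [z, if_neg h]
      by_cases h0 : f k = 0
      · rw [if_pos h0]
        have := hdw ⟨k', ⟨i', by omega⟩⟩ ⟨k, 0⟩
        simp only at this
        rw [this]
        have hi0 : i = 0 := by omega
        subst hi0
        by_cases hk : k' = k
        · subst hk; simp [Fin.ext_iff]
        · simp [hk]
      · rw [if_neg h0, hyB]
        by_cases hi0 : i' = 0
        · rw [if_pos hi0, if_neg]; omega
        · rw [if_neg hi0, hu1 k _ (by omega) k' _ (by omega)]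
          have : (i' = i) ↔ (i' - 1 = f k - 1) := by omega
          simp [this]
  refine ⟨u, z, fun k i h => by simp only [z, if_pos h], ?_, ?_, ?_⟩
  · intro k i h
    by_cases h1 : i + 1 < f k
    · simp only [z, if_pos h1]
      exact (hu2 k i h1).symm
    · have h2 : f k ≠ 0 := by omega
      have h3 : f k - 1 = i := by omega
      simp only [z, if_neg h1, if_neg h2, h3]
  · rw [Fintype.linearIndependent_iff]
    intro g hg
    rw [Fintype.sum_sum_type] at hg
    simp only [Sum.elim_inl, Sum.elim_inr] at hg
    have hr : ∀ p : (k : K) × Fin (f k), g (Sum.inr p) = 0 := by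
      rintro ⟨k', i'⟩
      have h1 := congrArg (fun v => y k' i' (A v)) hg
      simp only [map_add, map_sum, map_smul, hort, smul_zero, Finset.sum_const_zero, zero_add, map_zero] at h1
      rw [← h1, Finset.sum_eq_single ⟨k', i'⟩]
      · rw [hu1 k' i' i'.2 k' i' i'.2.le]; simp
      · rintro ⟨k, i⟩ _ hne
        rw [hu1 k i i.2 k' i' i'.2.le, if_neg, smul_zero]
        rintro ⟨rfl, h⟩
        exact hne (by rw [Fin.ext h.symm])
      · simp
    simp only [hr, zero_smul, Finset.sum_const_zero, add_zero] at hg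
    have h2 := Fintype.linearIndependent_iff.1 hX _ hg
    rintro (p | p)
    · exact h2 p
    · exact hr p
  · rw [Fintype.linearIndependent_iff]
    intro g hg
    rw [Fintype.sum_sum_type] at hg
    simp only [Sum.elim_inl, Sum.elim_inr] at hg
    have hr : ∀ p : (k : K) × Fin (f k + 1), g (Sum.inr p) = 0 := by
      rintro ⟨k', i'⟩
      have h1 := congrArg (fun v => y k' i' v) hg
      simp only [map_add, map_sum, map_smul, hort, smul_zero, Finset.sum_const_zero, zero_add, map_zero] at h1
      have hi' : (i' : ℕ) ≤ f k' := by have := i'.2; omega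
      rw [← h1, Finset.sum_eq_single ⟨k', i'⟩]
      · rw [hz k' i' hi' k' i' hi']; simp
      · rintro ⟨k, i⟩ _ hne
        rw [hz k i (by have := i.2; omega) k' i' hi', if_neg, smul_zero]
        rintro ⟨rfl, h⟩
        exact hne (by rw [Fin.ext h.symm])
      · simp
    simp only [hr, zero_smul, Finset.sum_const_zero, add_zero] at hg
    have h2 := Fintype.linearIndependent_iff.1 hZ _ hg
    rintro (p | p)
    · exact h2 p
    · exact hr p

end PartB

section PartC
theorem off_mono (sz : ℕ → ℕ) {a b : ℕ} (h : a < b) : off sz a + sz a ≤ off sz b := by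
  unfold off
  rw [← Finset.sum_range_succ]
  exact Finset.sum_le_sum_of_subset (Finset.range_subset_range.2 h)

theorem off_uniq (sz : ℕ → ℕ) {a b i j : ℕ} (hi : i < sz a) (hj : j < sz b)
    (h : off sz a + i = off sz b + j) : a = b := by
  rcases lt_trichotomy a b with h1 | h1 | h1
  · have := off_mono sz h1; omega
  · exact h1
  · have := off_mono sz h1; omega

/-- index equivalence -/
noncomputable def blockEquiv (N : ℕ) (sz : ℕ → ℕ) (p : ℕ) (h : ∑ b : Fin N, sz b = p) :
    ((b : Fin N) × Fin (sz b)) ≃ Fin p :=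
  (finSigmaFinEquiv (n := fun b : Fin N => sz b)).trans (finCongr h)

theorem blockEquiv_val (N : ℕ) (sz : ℕ → ℕ) (p : ℕ) (h : ∑ b : Fin N, sz b = p)
    (s : (b : Fin N) × Fin (sz b)) :
    ((blockEquiv N sz p h s : Fin p) : ℕ) = off sz s.1 + s.2 := by
  simp only [blockEquiv, Equiv.trans_apply, finCongr_apply, Fin.val_cast, finSigmaFinEquiv_apply]
  congr 1
  unfold off
  rw [Finset.sum_range]
  rfl

theorem dsum_apply (N : ℕ) (ρ γ : ℕ → ℕ) (ent : ℕ → ℕ → ℕ → ℂ) (p q : ℕ)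
    (hp : ∑ b : Fin N, ρ b = p) (hq : ∑ b : Fin N, γ b = q)
    (s : (b : Fin N) × Fin (ρ b)) (t : (b : Fin N) × Fin (γ b)) :
    dsum N ρ γ ent p q (blockEquiv N ρ p hp s) (blockEquiv N γ q hq t)
      = if s.1 = t.1 then ent t.1 s.2 t.2 else 0 := by
  unfold dsum
  simp only [blockEquiv_val]
  rw [Finset.sum_eq_single_of_mem (t.1 : ℕ) (Finset.mem_range.2 t.1.2)]
  · have ht := t.2.2
    have hs := s.2.2
    by_cases h : s.1 = t.1
    · have ho : off ρ s.1 = off ρ t.1 := by rw [h]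
      have ho' : ρ s.1 = ρ t.1 := by rw [h]
      rw [if_pos h, if_pos (by omega)]
      congr 1 <;> omega
    · rw [if_neg h, if_neg]
      rintro ⟨h1, h2, -, -⟩
      apply h
      apply Fin.ext
      exact off_uniq ρ hs (show off ρ s.1 + s.2 - off ρ t.1 < ρ t.1 by omega) (by omega)
  · intro b _ hb
    rw [if_neg]
    rintro ⟨-, -, h1, h2⟩
    apply hb
    exact off_uniq γ (show off γ t.1 + t.2 - off γ b < γ b by omega) t.2.2 (by omega)

theorem linearIndependent_congr' {ι V : Type*} [AddCommGroup V] [Module ℂ V] {f g : ι → V} (h : f = g) :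
    LinearIndependent ℂ f ↔ LinearIndependent ℂ g := by rw [h]

theorem strict_of_blocks {p q N : ℕ} (A B : Matrix (Fin p) (Fin q) ℂ) (ρ γ : ℕ → ℕ)
    (entA entB : ℕ → ℕ → ℕ → ℂ)
    (hp : ∑ b : Fin N, ρ b = p) (hq : ∑ b : Fin N, γ b = q)
    (Xc : ℕ → ℕ → Fin q → ℂ) (Zc : ℕ → ℕ → Fin p → ℂ)
    (hX : LinearIndependent ℂ (fun s : (b : Fin N) × Fin (γ b) => Xc s.1 s.2))
    (hZ : LinearIndependent ℂ (fun s : (b : Fin N) × Fin (ρ b) => Zc s.1 s.2))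
    (hA : ∀ b j, b < N → j < γ b → A *ᵥ Xc b j = ∑ i ∈ range (ρ b), entA b i j • Zc b i)
    (hB : ∀ b j, b < N → j < γ b → B *ᵥ Xc b j = ∑ i ∈ range (ρ b), entB b i j • Zc b i) :
    StrictEquiv (A, B) (dsum N ρ γ entA p q, dsum N ρ γ entB p q) := by
  let E := blockEquiv N ρ p hp
  let F := blockEquiv N γ q hq
  let Q : Matrix (Fin p) (Fin p) ℂ := Matrix.of fun x y => Zc (E.symm y).1 (E.symm y).2 x
  let R : Matrix (Fin q) (Fin q) ℂ := Matrix.of fun x y => Xc (F.symm y).1 (F.symm y).2 x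
  have hQ : IsUnit Q := by
    rw [← Matrix.linearIndependent_cols_iff_isUnit]
    exact hZ.comp E.symm E.symm.injective
  have hR : IsUnit R := by
    rw [← Matrix.linearIndependent_cols_iff_isUnit]
    exact hX.comp F.symm F.symm.injective
  have key : ∀ (C : Matrix (Fin p) (Fin q) ℂ) (ent : ℕ → ℕ → ℕ → ℂ),
      (∀ b j, b < N → j < γ b → C *ᵥ Xc b j = ∑ i ∈ range (ρ b), ent b i j • Zc b i) →
      Q⁻¹ * C * R = dsum N ρ γ ent p q := by
    intro C ent h
    have h1 : C * R = Q * dsum N ρ γ ent p q := by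
      ext x y
      obtain ⟨t, rfl⟩ := F.surjective y
      have h2 := congrFun (h t.1 t.2 t.1.2 t.2.2) x
      have h3 : (C * R) x (F t) = (C *ᵥ Xc t.1 t.2) x := by
        have hF : F.symm (F t) = t := F.symm_apply_apply t
        have hR' : ∀ x', R x' (F t) = Xc t.1 t.2 x' := fun x' =>
          congrArg (fun s : (b : Fin N) × Fin (γ b) => Xc s.1 s.2 x') hF
        simp only [Matrix.mul_apply, Matrix.mulVec, dotProduct, hR']
      rw [h3, h2, Matrix.mul_apply, ← E.sum_comp, Fintype.sum_sigma, Finset.sum_apply,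
        Finset.sum_eq_single t.1]
      · rw [Finset.sum_range]
        refine Finset.sum_congr rfl fun i _ => ?_
        rw [dsum_apply, if_pos rfl]
        have hE : E.symm (E ⟨t.1, i⟩) = ⟨t.1, i⟩ := E.symm_apply_apply _
        have hQ' : Q x (E ⟨t.1, i⟩) = Zc t.1 i x :=
          congrArg (fun s : (b : Fin N) × Fin (ρ b) => Zc s.1 s.2 x) hE
        rw [hQ', mul_comm]
        rfl
      · intro b _ hb
        refine Finset.sum_eq_zero fun i _ => ?_
        rw [dsum_apply, if_neg hb, mul_zero]
      · simp
    rw [Matrix.mul_assoc, h1, ← Matrix.mul_assoc, Matrix.nonsing_inv_mul _ ((Matrix.isUnit_iff_isUnit_det _).1 hQ), Matrix.one_mul]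
  exact ⟨Q, R, hQ, hR, key A entA hA, key B entB hB⟩

theorem kron_pencil {p q : ℕ} (A B : Matrix (Fin p) (Fin q) ℂ) (c₁ c₂ c₃ c₄ e₁ e₂ f₁ f₂ : ℕ)
    (e : Fin (c₁ + c₂) → ℕ) (he : ∀ j, e j = if (j : ℕ) < c₁ then e₁ else e₂)
    (f : Fin (c₃ + c₄) → ℕ) (hf : ∀ j, f j = if (j : ℕ) < c₃ then f₁ else f₂)
    (x : Fin (c₁ + c₂) → ℕ → Fin q → ℂ) (y : Fin (c₃ + c₄) → ℕ → Fin p → ℂ)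
    (hx0 : ∀ j, B *ᵥ x j 0 = 0) (hx : ∀ j i, A *ᵥ x j i = B *ᵥ x j (i+1))
    (hxe : ∀ j, A *ᵥ x j (e j) = 0)
    (hy0 : ∀ k, y k 0 ᵥ* B = 0) (hy : ∀ k i, y k i ᵥ* A = y k (i+1) ᵥ* B)
    (hye : ∀ k, y k (f k) ᵥ* A = 0)
    (hZ : LinearIndependent ℂ (fun p : (j : Fin (c₁ + c₂)) × Fin (e j) => A *ᵥ (x p.1 p.2)))
    (hL : LinearIndependent ℂ (fun j => x j (e j)))
    (hW : LinearIndependent ℂ (fun p : (k : Fin (c₃ + c₄)) × Fin (f k) => y p.1 p.2 ᵥ* A))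
    (hLy : LinearIndependent ℂ (fun k => y k (f k)))
    (hp : ∑ j, e j + ∑ k, (f k + 1) = p) (hq : ∑ j, (e j + 1) + ∑ k, f k = q) :
    StrictEquiv (A, B) (genPencil c₁ c₂ c₃ c₄ e₁ e₂ f₁ f₂ p q) := by
  obtain ⟨u, z, hu1, hu2, hX, hZZ⟩ := kron A.mulVecLin B.mulVecLin e x f
    (fun k i => dotProductEquiv ℂ (Fin p) (y k i))
    hx hxe
    (fun k v => by
      simp only [mulVecLin_apply, dotProductEquiv_apply_apply, Matrix.dotProduct_mulVec, hy0, zero_dotProduct])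
    (fun k i v => by
      simp only [mulVecLin_apply, dotProductEquiv_apply_apply, Matrix.dotProduct_mulVec, hy])
    (fun k v => by
      simp only [mulVecLin_apply, dotProductEquiv_apply_apply, Matrix.dotProduct_mulVec, hye, zero_dotProduct])
    hZ hL
    (by
      have : (fun p_1 : (k : Fin (c₃ + c₄)) × Fin (f k) => A.mulVecLin.dualMap (dotProductEquiv ℂ (Fin p) (y p_1.1 p_1.2)))
        = (dotProductEquiv ℂ (Fin q)).toLinearMap ∘ (fun p : (k : Fin (c₃ + c₄)) × Fin (f k) => y p.1 p.2 ᵥ* A) := by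
        funext s
        refine LinearMap.ext fun v => ?_
        simp only [LinearMap.dualMap_apply, Function.comp, LinearEquiv.coe_coe, mulVecLin_apply, dotProductEquiv_apply_apply, Matrix.dotProduct_mulVec]
      rw [this]
      exact hW.map' _ (LinearEquiv.ker _))
    (hLy.map' (dotProductEquiv ℂ (Fin p)).toLinearMap (LinearEquiv.ker _))
    (by rw [hp]; simp)
  have eρ : ∀ b (h : b < c₁ + c₂), secSize c₁ c₂ c₃ e₁ e₂ (f₁+1) (f₂+1) b = e ⟨b, h⟩ := by
    intro b h; rw [he]; unfold secSize; simp [h]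
  have eγ : ∀ b (h : b < c₁ + c₂), secSize c₁ c₂ c₃ (e₁+1) (e₂+1) f₁ f₂ b = e ⟨b, h⟩ + 1 := by
    intro b h; rw [he]; unfold secSize; simp only [h]; split_ifs <;> simp
  have fρ : ∀ k : Fin (c₃ + c₄), secSize c₁ c₂ c₃ e₁ e₂ (f₁+1) (f₂+1) (c₁ + c₂ + k) = f k + 1 := by
    intro k; rw [hf]; unfold secSize
    rw [if_neg (by omega), if_neg (by omega)]
    simp only [Nat.add_lt_add_iff_left]; split_ifs <;> rfl
  have fγ : ∀ k : Fin (c₃ + c₄), secSize c₁ c₂ c₃ (e₁+1) (e₂+1) f₁ f₂ (c₁ + c₂ + k) = f k := by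
    intro k; rw [hf]; unfold secSize
    rw [if_neg (by omega), if_neg (by omega)]
    simp only [Nat.add_lt_add_iff_left]
  have sums : ∀ (S : ℕ → ℕ), ∑ b : Fin (c₁ + c₂ + c₃ + c₄), S b =
      ∑ j : Fin (c₁ + c₂), S j + ∑ k : Fin (c₃ + c₄), S (c₁ + c₂ + k) := by
    intro S
    rw [← Finset.sum_range, ← Finset.sum_range, ← Finset.sum_range (fun k => S (c₁ + c₂ + k)), add_assoc (c₁ + c₂),
      Finset.sum_range_add]
  have split : ∀ b, b < c₁ + c₂ + c₃ + c₄ → (∃ h : b < c₁ + c₂, True) ∨ ∃ k : Fin (c₃ + c₄), b = c₁ + c₂ + k := by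
    intro b hb
    by_cases h : b < c₁ + c₂
    · exact Or.inl ⟨h, trivial⟩
    · exact Or.inr ⟨⟨b - (c₁ + c₂), by omega⟩, by simp; omega⟩
  let Xc : ℕ → ℕ → Fin q → ℂ := fun b i => if h : b < c₁ + c₂ then x ⟨b, h⟩ i else
    if h' : b - (c₁ + c₂) < c₃ + c₄ then u ⟨b - (c₁ + c₂), h'⟩ i else 0
  let Zc : ℕ → ℕ → Fin p → ℂ := fun b i => if h : b < c₁ + c₂ then A *ᵥ x ⟨b, h⟩ i else
    if h' : b - (c₁ + c₂) < c₃ + c₄ then z ⟨b - (c₁ + c₂), h'⟩ i else 0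
  have Xl : ∀ b (h : b < c₁ + c₂) i, Xc b i = x ⟨b, h⟩ i := fun b h i => by simp only [Xc, dif_pos h]
  have Zl : ∀ b (h : b < c₁ + c₂) i, Zc b i = A *ᵥ x ⟨b, h⟩ i := fun b h i => by simp only [Zc, dif_pos h]
  have Xr : ∀ (k : Fin (c₃ + c₄)) i, Xc (c₁ + c₂ + k) i = u k i := fun k i => by
    simp [Xc]
  have Zr : ∀ (k : Fin (c₃ + c₄)) i, Zc (c₁ + c₂ + k) i = z k i := fun k i => by
    simp [Zc]
  refine strict_of_blocks A B _ _ _ _ ?_ ?_ Xc Zc ?_ ?_ ?_ ?_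
  · rw [sums, ← hp]
    simp only [fρ]; congr 1
    exact Finset.sum_congr rfl fun j _ => eρ j j.2
  · rw [sums, ← hq]
    simp only [fγ]; congr 1
    exact Finset.sum_congr rfl fun j _ => eγ j j.2
  · let g : (b : Fin (c₁ + c₂ + c₃ + c₄)) × Fin (secSize c₁ c₂ c₃ (e₁+1) (e₂+1) f₁ f₂ b) →
        ((j : Fin (c₁ + c₂)) × Fin (e j + 1)) ⊕ ((k : Fin (c₃ + c₄)) × Fin (f k)) := fun s =>
      if h : (s.1 : ℕ) < c₁ + c₂ then Sum.inl ⟨⟨s.1, h⟩, ⟨s.2, by have := eγ s.1 h; have := s.2.2; omega⟩⟩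
      else Sum.inr ⟨⟨s.1 - (c₁ + c₂), by have := s.1.2; omega⟩, ⟨s.2, by
        have h1 := fγ ⟨s.1 - (c₁ + c₂), by have := s.1.2; omega⟩
        have h2 := s.2.2
        rw [show c₁ + c₂ + ((s.1 : ℕ) - (c₁ + c₂)) = s.1 by omega] at h1
        omega⟩⟩
    have hg : Function.Injective g := by
      rintro ⟨⟨b, hb⟩, ⟨i, hi⟩⟩ ⟨⟨b', hb'⟩, ⟨i', hi'⟩⟩ h
      simp only [g] at h
      have : b = b' ∧ i = i' := by
        split_ifs at h with h1 h2 h2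
        · simp only [Sum.inl.injEq, Sigma.mk.injEq, Fin.mk.injEq] at h
          obtain ⟨rfl, h⟩ := h
          exact ⟨rfl, by simpa using h⟩
        · simp only [Sum.inr.injEq, Sigma.mk.injEq, Fin.mk.injEq] at h
          obtain ⟨h3, h⟩ := h
          obtain rfl : b = b' := by omega
          exact ⟨rfl, by simpa using h⟩
      obtain ⟨rfl, rfl⟩ := this
      rfl
    have := hX.comp g hg
    refine (linearIndependent_congr' ?_).mpr this
    funext s
    rcases split s.1 s.1.2 with ⟨h, -⟩ | ⟨k, hk⟩
    · simp [g, h, Xl _ h]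
    · have h : ¬ ((s.1 : ℕ) < c₁ + c₂) := by omega
      have h2 : (⟨s.1 - (c₁ + c₂), by have := s.1.2; omega⟩ : Fin (c₃ + c₄)) = k := Fin.ext (by simp; omega)
      simp only [Function.comp, g, dif_neg h, Sum.elim_inr, h2]
      rw [← Xr]
      exact congrArg (fun b => Xc b s.2) hk
  · let g : (b : Fin (c₁ + c₂ + c₃ + c₄)) × Fin (secSize c₁ c₂ c₃ e₁ e₂ (f₁+1) (f₂+1) b) →
        ((j : Fin (c₁ + c₂)) × Fin (e j)) ⊕ ((k : Fin (c₃ + c₄)) × Fin (f k + 1)) := fun s =>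
      if h : (s.1 : ℕ) < c₁ + c₂ then Sum.inl ⟨⟨s.1, h⟩, ⟨s.2, by have := eρ s.1 h; have := s.2.2; omega⟩⟩
      else Sum.inr ⟨⟨s.1 - (c₁ + c₂), by have := s.1.2; omega⟩, ⟨s.2, by
        have h1 := fρ ⟨s.1 - (c₁ + c₂), by have := s.1.2; omega⟩
        have h2 := s.2.2
        rw [show c₁ + c₂ + ((s.1 : ℕ) - (c₁ + c₂)) = s.1 by omega] at h1
        omega⟩⟩
    have hg : Function.Injective g := by
      rintro ⟨⟨b, hb⟩, ⟨i, hi⟩⟩ ⟨⟨b', hb'⟩, ⟨i', hi'⟩⟩ h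
      simp only [g] at h
      have : b = b' ∧ i = i' := by
        split_ifs at h with h1 h2 h2
        · simp only [Sum.inl.injEq, Sigma.mk.injEq, Fin.mk.injEq] at h
          obtain ⟨rfl, h⟩ := h
          exact ⟨rfl, by simpa using h⟩
        · simp only [Sum.inr.injEq, Sigma.mk.injEq, Fin.mk.injEq] at h
          obtain ⟨h3, h⟩ := h
          obtain rfl : b = b' := by omega
          exact ⟨rfl, by simpa using h⟩
      obtain ⟨rfl, rfl⟩ := this
      rfl
    have := hZZ.comp g hg
    refine (linearIndependent_congr' ?_).mpr this
    funext s
    rcases split s.1 s.1.2 with ⟨h, -⟩ | ⟨k, hk⟩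
    · simp [g, h, Zl _ h]
    · have h : ¬ ((s.1 : ℕ) < c₁ + c₂) := by omega
      have h2 : (⟨s.1 - (c₁ + c₂), by have := s.1.2; omega⟩ : Fin (c₃ + c₄)) = k := Fin.ext (by simp; omega)
      simp only [Function.comp, g, dif_neg h, Sum.elim_inr, h2]
      rw [← Zr]
      exact congrArg (fun b => Zc b s.2) hk
  · intro b j hb hj
    rcases split b hb with ⟨h, -⟩ | ⟨k, rfl⟩
    · rw [eρ b h]; rw [eγ b h] at hj
      simp only [Xl b h, Zl b h, ite_smul, one_smul, zero_smul, Finset.sum_ite_eq', Finset.mem_range]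
      split_ifs with h1
      · rfl
      · rw [show j = e ⟨b, h⟩ by omega, hxe]
    · rw [fρ]; rw [fγ] at hj
      simp only [Xr, Zr, ite_smul, one_smul, zero_smul, Finset.sum_ite_eq', Finset.mem_range]
      rw [if_pos (by omega)]
      exact hu1 k j hj
  · intro b j hb hj
    rcases split b hb with ⟨h, -⟩ | ⟨k, rfl⟩
    · rw [eρ b h]; rw [eγ b h] at hj
      simp only [Xl b h, Zl b h, if_pos h, ite_smul, one_smul, zero_smul]
      rcases j with _ | j
      · simp [hx0]
      · rw [Finset.sum_eq_single_of_mem j (Finset.mem_range.2 (by omega))]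
        · simp [hx]
        · intro i _ hi; rw [if_neg]; omega
    · rw [fρ]; rw [fγ] at hj
      simp only [Xr, Zr, if_neg (show ¬ (c₁ + c₂ + (k : ℕ) < c₁ + c₂) by omega), ite_smul, one_smul, zero_smul, Finset.sum_ite_eq', Finset.mem_range]
      rw [if_pos (by omega)]
      exact hu2 k j hj

end PartC

section PartD
open Polynomial

/-- low part -/
noncomputable def low (M : ℕ) (p : ℂ[X]) : ℂ[X] := p %ₘ X^(M+1)
noncomputable def high (M : ℕ) (p : ℂ[X]) : ℂ[X] := p /ₘ X^(M+1)

theorem low_high (M : ℕ) (p : ℂ[X]) : low M p + X^(M+1) * high M p = p :=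
  modByMonic_add_div _ _

theorem low_dlt (M : ℕ) (p : ℂ[X]) : low M p ∈ degreeLT ℂ (M+1) := by
  rw [mem_degreeLT]
  refine (degree_modByMonic_lt _ (monic_X_pow _)).trans_le ?_
  simp

theorem low_coeff (M : ℕ) (p : ℂ[X]) {i : ℕ} (h : i ≤ M) : (low M p).coeff i = p.coeff i := by
  conv_rhs => rw [← low_high M p]
  rw [coeff_add, coeff_X_pow_mul', if_neg (by omega), add_zero]

/-- the combination polynomial -/
noncomputable def gpol (M : ℕ) {e : ℕ} (c : Fin e → ℂ) : ℂ[X] := ∑ i : Fin e, C (c i) * X^(M - i)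

theorem gpol_coeff (M : ℕ) {e : ℕ} (he : e ≤ M) (c : Fin e → ℂ) (i : Fin e) :
    (gpol M c).coeff (M - i) = c i := by
  unfold gpol
  rw [finsetSum_coeff, Finset.sum_eq_single i]
  · simp
  · intro b _ hb
    rw [coeff_C_mul, coeff_X_pow, if_neg, mul_zero]
    intro h
    apply hb
    apply Fin.ext
    omega
  · simp

theorem gpol_mul_coeff (M : ℕ) {e : ℕ} (he : e ≤ M) (c : Fin e → ℂ) (p : ℂ[X]) :
    (gpol M c * p).coeff M = ∑ i : Fin e, c i * p.coeff i := by
  unfold gpol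
  rw [Finset.sum_mul, finsetSum_coeff]
  refine Finset.sum_congr rfl fun i _ => ?_
  rw [mul_assoc, coeff_C_mul, coeff_X_pow_mul', if_pos (by omega)]
  congr 2; omega

theorem sep {ι κ : Type} [Fintype ι] [Fintype κ] {Mod : Submodule ℂ[X] (ι → ℂ[X])}
    {b : κ → ι → ℂ[X]} {ε : κ → ℕ} (H : RB Mod b ε)
    (sat : ∀ k (v : ι → ℂ[X]), (X^k : ℂ[X]) • v ∈ Mod → v ∈ Mod)
    (e : κ → ℕ) (c : (j : κ) → Fin (e j) → ℂ) (M D : ℕ) (hM : ∀ j, e j ≤ M)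
    (hD : ∀ j, D - ε j ≤ M + 1 - e j)
    (hlow : (fun i => low M ((∑ j, gpol M (c j) • b j) i)) ∈ Mod)
    (hdeg : ∀ i, low M ((∑ j, gpol M (c j) • b j) i) ∈ degreeLT ℂ D) (j : κ) (i : Fin (e j)) :
    c j i = 0 := by
  set Γ := ∑ j, gpol M (c j) • b j with hΓ
  have hΓm : Γ ∈ Mod := Submodule.sum_mem _ fun j _ => Submodule.smul_mem _ _ (H.mem j)
  have hsum : Γ = (fun i => low M (Γ i)) + (X^(M+1) : ℂ[X]) • (fun i => high M (Γ i)) := by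
    funext i
    exact (low_high M (Γ i)).symm
  have hhigh : (fun i => high M (Γ i)) ∈ Mod := by
    apply sat (M+1)
    have : (X^(M+1) : ℂ[X]) • (fun i => high M (Γ i)) = Γ - (fun i => low M (Γ i)) := by
      rw [eq_sub_iff_add_eq, add_comm]; exact hsum.symm
    rw [this]
    exact Submodule.sub_mem _ hΓm hlow
  obtain ⟨q, hq, hqd⟩ := H.pred _ hlow D hdeg
  obtain ⟨h, hh⟩ := (Submodule.mem_span_range_iff_exists_fun ℂ[X]).1 (H.span hhigh)
  have h0 : ∑ j, (gpol M (c j) - q j - X^(M+1) * h j) • b j = 0 := by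
    simp only [sub_smul, mul_smul, Finset.sum_sub_distrib, ← Finset.smul_sum]
    rw [hh, ← hq, ← hΓ]
    rw [sub_sub, sub_eq_zero]; exact hsum
  have h1 := H.indep _ h0 j
  have h2 := congrArg (fun p => p.coeff (M - i)) h1
  simp only [coeff_sub, gpol_coeff M (hM j), coeff_X_pow_mul', coeff_zero] at h2
  have hi := i.2
  have := hM j
  have := hD j
  rw [if_neg (by omega), mem_dlt.1 (hqd j) _ (by omega), sub_zero, sub_zero] at h2
  exact h2

theorem sum_block {S : Type*} [AddCommMonoid S] (n d : ℕ) (G : ℕ → S) :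
    ∑ c : Fin (n*d), G c = ∑ a : Fin d, ∑ b : Fin n, G (n * a + b) := by
  rw [← Finset.sum_range]
  induction d with
  | zero => simp
  | succ d ih =>
    rw [Nat.mul_succ, Finset.sum_range_add, ih, Fin.sum_univ_castSucc, Finset.sum_range (fun b => G (n * d + b))]
    rfl

theorem sum_add_block {S : Type*} [AddCommMonoid S] (m k : ℕ) (G : ℕ → S) :
    ∑ c : Fin (m + k), G c = ∑ a : Fin m, G a + ∑ b : Fin k, G (m + b) := by
  rw [← Finset.sum_range, ← Finset.sum_range, ← Finset.sum_range (fun b => G (m + b)), Finset.sum_range_add]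

/-- ℕ-indexed coefficients -/
noncomputable def pc {m n d : ℕ} (P : Pol d m n) (k : ℕ) : Matrix (Fin m) (Fin n) ℂ :=
  if h : k < d + 1 then P ⟨k, h⟩ else 0

theorem compA_low {m n d : ℕ} (P : Pol d m n) (hd : 1 ≤ d) (i : Fin m) (h : (i:ℕ) < m + n*(d-1)) (S : Type*) [CommRing S]
    (φ : ℂ →+* S) (w : ℕ → S) :
    ∑ c : Fin (n*d), φ (compA m n d P ⟨i, h⟩ c) * w c = ∑ b : Fin n, φ (pc P d i b) * w b := by
  obtain ⟨d, rfl⟩ : ∃ d', d = d' + 1 := ⟨d - 1, by omega⟩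
  have := sum_block n (d+1) (fun c => φ (if hj : c < n then P (Fin.last _) i ⟨c, hj⟩ else 0) * w c)
  have h2 : ∀ c : Fin (n*(d+1)), compA m n (d+1) P ⟨i, h⟩ c = (if hj : (c:ℕ) < n then P (Fin.last _) i ⟨c, hj⟩ else 0) := by
    intro c; unfold compA; simp
  simp only [h2]
  rw [this, Fin.sum_univ_succ, Finset.sum_eq_zero (s := univ (α := Fin d)), add_zero]
  · refine Finset.sum_congr rfl fun b _ => ?_
    simp only [pc, Fin.val_zero, mul_zero, zero_add, dif_pos b.2, Fin.eta]
    rw [dif_pos (by omega)]; rfl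
  · intro a _
    refine Finset.sum_eq_zero fun b _ => ?_
    rw [dif_neg, map_zero, zero_mul]
    simp only [Fin.val_succ, Nat.mul_succ]; omega

theorem compA_high {m n d : ℕ} (P : Pol d m n) (hd : 1 ≤ d) (t : ℕ) (h : m + t < m + n*(d-1)) (S : Type*) [CommRing S]
    (φ : ℂ →+* S) (w : ℕ → S) :
    ∑ c : Fin (n*d), φ (compA m n d P ⟨m + t, h⟩ c) * w c = w (n + t) := by
  obtain ⟨d, rfl⟩ : ∃ d', d = d' + 1 := ⟨d - 1, by omega⟩
  have h3 : n + t < n * (d+1) := by rw [Nat.mul_succ]; simp at h; omega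
  rw [Finset.sum_eq_single ⟨n + t, h3⟩]
  · simp [compA]
  · intro b _ hb
    have : ¬ (t = (b:ℕ) - n ∧ n ≤ (b:ℕ)) := by
      rintro ⟨h4, h5⟩; apply hb; apply Fin.ext; simp; omega
    simp [compA, this]
  · simp

theorem compB_low {m n d : ℕ} (P : Pol d m n) (hd : 1 ≤ d) (i : Fin m) (h : (i:ℕ) < m + n*(d-1)) (S : Type*) [CommRing S]
    (φ : ℂ →+* S) (w : ℕ → S) :
    ∑ c : Fin (n*d), φ (compB m n d P ⟨i, h⟩ c) * w c = ∑ a : Fin d, ∑ b : Fin n, φ (pc P (d-1-a) i b) * w (n*a+b) := by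
  have := sum_block n d (fun c => φ (if hn : 0 < n then pc P (d-1-c/n) i ⟨c % n, Nat.mod_lt _ hn⟩ else 0) * w c)
  have h2 : ∀ c : Fin (n*d), compB m n d P ⟨i, h⟩ c = (if hn : 0 < n then pc P (d-1-c/n) i ⟨c % n, Nat.mod_lt _ hn⟩ else 0) := by
    intro c; unfold compB pc; simp only [i.2, dif_pos]
    split_ifs with h3 h4
    · rfl
    · exact absurd (Nat.lt_succ_of_le ((Nat.sub_le _ _).trans (Nat.sub_le d 1))) h4
    · rfl
  simp only [h2]
  rw [this]
  refine Finset.sum_congr rfl fun a _ => Finset.sum_congr rfl fun b _ => ?_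
  have hn : 0 < n := by have := b.2; omega
  have h3 : (n * (a:ℕ) + b) / n = a := by rw [Nat.mul_add_div hn, Nat.div_eq_of_lt b.2, add_zero]
  have h4 : (n * (a:ℕ) + b) % n = b := by rw [Nat.mul_add_mod, Nat.mod_eq_of_lt b.2]
  simp only [dif_pos hn, h3, h4, Fin.eta]

theorem compB_high {m n d : ℕ} (P : Pol d m n) (hd : 1 ≤ d) (t : ℕ) (h : m + t < m + n*(d-1)) (S : Type*) [CommRing S]
    (φ : ℂ →+* S) (w : ℕ → S) :
    ∑ c : Fin (n*d), φ (compB m n d P ⟨m + t, h⟩ c) * w c = - w t := by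
  obtain ⟨d, rfl⟩ : ∃ d', d = d' + 1 := ⟨d - 1, by omega⟩
  have h3 : t < n * (d+1) := by rw [Nat.mul_succ]; simp at h; omega
  rw [Finset.sum_eq_single ⟨t, h3⟩]
  · simp [compB]
  · intro b _ hb
    have : ¬ ((b:ℕ) = t) := by
      intro h4; apply hb; apply Fin.ext; simp; omega
    simp [compB, this]
  · simp

/-- left mult A -/
theorem compA_left {m n d : ℕ} (P : Pol d m n) (hd : 1 ≤ d) (a : Fin d) (b : Fin n) (h : n*(a:ℕ)+b < n*d) (S : Type*) [CommRing S]
    (φ : ℂ →+* S) (w : ℕ → S) :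
    ∑ c : Fin (m + n*(d-1)), w c * φ (compA m n d P c ⟨n*a+b, h⟩)
      = if (a:ℕ) = 0 then ∑ i : Fin m, w i * φ (pc P d i b) else w (m + (n * (a-1) + b)) := by
  have := sum_add_block m (n*(d-1)) (fun c => w c * φ (if hi : c < m then
    if hj : n*(a:ℕ)+b < n then P (Fin.last d) ⟨c, hi⟩ ⟨_, hj⟩ else 0
    else if c - m = (n*(a:ℕ)+b) - n ∧ n ≤ n*(a:ℕ)+b then 1 else 0))
  refine Eq.trans this ?_
  have hb := b.2
  by_cases h0 : (a:ℕ) = 0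
  · rw [if_pos h0]
    rw [Finset.sum_eq_zero (s := univ (α := Fin (n*(d-1)))), add_zero]
    · refine Finset.sum_congr rfl fun i _ => ?_
      simp only [i.2, dif_pos, h0, mul_zero, zero_add, hb, pc]
      rw [dif_pos (by omega)]; rfl
    · intro t _
      rw [dif_neg (by omega), if_neg, map_zero, mul_zero]
      rw [h0]; rintro ⟨-, h7⟩; omega
  · rw [if_neg h0]
    obtain ⟨a', ha'⟩ : ∃ a', (a:ℕ) = a' + 1 := ⟨a - 1, by omega⟩
    have h1 : ¬ (n * (a:ℕ) + b < n) := by rw [ha', Nat.mul_succ]; omega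
    have h2 : n * a' + b < n * (d-1) := by
      obtain ⟨d, rfl⟩ : ∃ d', d = d' + 1 := ⟨d - 1, by omega⟩
      rw [ha', Nat.mul_succ, Nat.mul_succ] at h; simp; omega
    rw [Finset.sum_eq_zero, zero_add, Finset.sum_eq_single ⟨n * a' + b, h2⟩]
    · rw [dif_neg (by simp), if_pos]
      · simp [ha']
      · rw [ha', Nat.mul_succ]; simp; omega
    · intro t _ ht
      rw [dif_neg (by omega), if_neg, map_zero, mul_zero]
      rintro ⟨h3, -⟩
      apply ht; apply Fin.ext; simp; rw [ha', Nat.mul_succ] at h3; omega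
    · simp
    · intro i _
      simp [h1]

theorem compB_left {m n d : ℕ} (P : Pol d m n) (hd : 1 ≤ d) (a : Fin d) (b : Fin n) (h : n*(a:ℕ)+b < n*d) (S : Type*) [CommRing S]
    (φ : ℂ →+* S) (w : ℕ → S) :
    ∑ c : Fin (m + n*(d-1)), w c * φ (compB m n d P c ⟨n*a+b, h⟩)
      = ∑ i : Fin m, w i * φ (pc P (d-1-a) i b) + if (a:ℕ) < d - 1 then - w (m + (n * a + b)) else 0 := by
  have hn : 0 < n := by have := b.2; omega
  have h3 : (n * (a:ℕ) + b) / n = a := by rw [Nat.mul_add_div hn, Nat.div_eq_of_lt b.2, add_zero]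
  have h4 : (n * (a:ℕ) + b) % n = b := by rw [Nat.mul_add_mod, Nat.mod_eq_of_lt b.2]
  have := sum_add_block m (n*(d-1)) (fun c => w c * φ (if hi : c < m then
    pc P (d-1-a) ⟨c, hi⟩ b
    else if n*(a:ℕ)+b = c - m then -1 else 0))
  refine Eq.trans ?_ (this.trans ?_)
  · refine Finset.sum_congr rfl fun c _ => ?_
    unfold compB pc
    simp only [h3, h4, dif_pos hn, Fin.eta]
    split_ifs with h5 h6
    · rfl
    · exact absurd (Nat.lt_succ_of_le ((Nat.sub_le _ _).trans (Nat.sub_le d 1))) h6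
    · rfl
    · rfl
  congr 1
  · refine Finset.sum_congr rfl fun i _ => ?_
    simp
  · have hb := b.2
    split_ifs with h5
    · have h2 : n * a + b < n * (d-1) := by
        have : n * (a + 1) ≤ n * (d-1) := Nat.mul_le_mul_left _ (by omega)
        rw [Nat.mul_succ] at this; omega
      rw [Finset.sum_eq_single ⟨n * a + b, h2⟩]
      · simp
      · intro t _ ht
        rw [dif_neg (by omega), if_neg, map_zero, mul_zero]
        intro h3
        apply ht; apply Fin.ext; simp; omega
      · simp
    · refine Finset.sum_eq_zero fun t _ => ?_
      have : n * (d-1) ≤ n * a := Nat.mul_le_mul_left _ (by omega)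
      rw [dif_neg (by omega), if_neg (by omega), map_zero, mul_zero]

end PartD

section PartE
open Polynomial

/-- polynomial matrix -/
noncomputable def PP {m n d : ℕ} (P : Pol d m n) : Matrix (Fin m) (Fin n) ℂ[X] :=
  Matrix.of fun i j => ∑ k : Fin (d+1), C (P k i j) * X^(k:ℕ)

theorem PP_eq {m n d : ℕ} (P : Pol d m n) (i j) :
    PP P i j = ∑ k ∈ range (d+1), C (pc P k i j) * X^k := by
  rw [Finset.sum_range]
  unfold PP
  rw [Matrix.of_apply]
  refine Finset.sum_congr rfl fun k _ => ?_
  rw [pc, dif_pos k.2]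

/-- generic right vector -/
def xv {S : Type*} [CommRing S] {n : ℕ} (d : ℕ) (lam : S) (v : Fin n → S) : ℕ → S := fun c =>
  if hn : 0 < n then lam^(d-1-c/n) * v ⟨c % n, Nat.mod_lt _ hn⟩ else 0

theorem xv_apply {S : Type*} [CommRing S] {n : ℕ} (d : ℕ) (lam : S) (v : Fin n → S) (a : ℕ) (b : Fin n) :
    xv d lam v (n * a + b) = lam^(d-1-a) * v b := by
  have hn : 0 < n := by have := b.2; omega
  have h3 : (n * (a:ℕ) + b) / n = a := by rw [Nat.mul_add_div hn, Nat.div_eq_of_lt b.2, add_zero]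
  have h4 : (n * (a:ℕ) + b) % n = b := by rw [Nat.mul_add_mod, Nat.mod_eq_of_lt b.2]
  simp only [xv, dif_pos hn, h3, h4, Fin.eta]

theorem block_form {n D : ℕ} (t : ℕ) (h : t < n * D) : ∃ (a : Fin D) (b : Fin n), t = n * a + b := by
  have hn : 0 < n := by
    rcases Nat.eq_zero_or_pos n with h0 | h0
    · rw [h0] at h; omega
    · exact h0
  refine ⟨⟨t / n, Nat.div_lt_of_lt_mul h⟩, ⟨t % n, Nat.mod_lt _ hn⟩, ?_⟩
  exact (Nat.div_add_mod t n).symm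

theorem row_form {m k : ℕ} (i : Fin (m + k)) : (∃ (j : Fin m) (h : (j:ℕ) < m + k), i = ⟨j, h⟩) ∨
    ∃ (t : ℕ) (h : m + t < m + k), i = ⟨m + t, h⟩ := by
  by_cases h : (i:ℕ) < m
  · exact Or.inl ⟨⟨i, h⟩, i.2, rfl⟩
  · exact Or.inr ⟨i - m, by omega, Fin.ext (by simp; omega)⟩

theorem comp_xv {m n d : ℕ} (P : Pol d m n) (hd : 1 ≤ d) {S : Type*} [CommRing S] (φ : ℂ →+* S) (lam : S)
    (v : Fin n → S) (hv : ∀ i, ∑ b, (∑ k ∈ range (d+1), φ (pc P k i b) * lam^k) * v b = 0)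
    (i : Fin (m + n*(d-1))) :
    lam * ∑ c : Fin (n*d), φ (compA m n d P i c) * xv d lam v c
      + ∑ c : Fin (n*d), φ (compB m n d P i c) * xv d lam v c = 0 := by
  rcases row_form i with ⟨i, h, rfl⟩ | ⟨t, h, rfl⟩
  · rw [compA_low P hd, compB_low P hd]
    obtain ⟨d, rfl⟩ : ∃ d', d = d' + 1 := ⟨d - 1, by omega⟩
    refine Eq.trans ?_ (hv i)
    rw [Finset.sum_comm, Finset.mul_sum, ← Finset.sum_add_distrib]
    refine Finset.sum_congr rfl fun b _ => ?_
    have := xv_apply (d+1) lam v 0 b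
    rw [mul_zero, zero_add] at this
    rw [this]
    simp only [xv_apply]
    rw [Finset.sum_range_succ, add_mul, add_comm]
    congr 1
    · rw [Finset.sum_mul, ← Finset.sum_range_reflect, ← Finset.sum_range (fun a => φ (pc P (d+1-1-a) i b) * (lam^(d+1-1-a) * v b))]
      refine Finset.sum_congr rfl fun k _ => ?_
      ring
    · simp only [Nat.add_sub_cancel, Nat.sub_zero]; ring
  · rw [compA_high P hd, compB_high P hd]
    obtain ⟨a, b, rfl⟩ := block_form t (show t < n * (d-1) by omega)
    rw [show n + (n * (a:ℕ) + b) = n * (a+1) + b by ring, xv_apply, xv_apply]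
    have : d - 1 - (a:ℕ) = (d - 1 - (a+1)) + 1 := by omega
    rw [this, pow_succ]; ring

/-- coefficient vectors -/
noncomputable def cs {N : ℕ} (w : ℕ → ℂ[X]) (i : ℕ) : Fin N → ℂ := fun c => (-1)^i * (w c).coeff i

theorem mulVec_cs {p q : ℕ} (A : Matrix (Fin p) (Fin q) ℂ) (w : ℕ → ℂ[X]) (i : ℕ) (r : Fin p) :
    (A *ᵥ cs w i) r = (-1)^i * (∑ c : Fin q, C (A r c) * w c).coeff i := by
  simp only [Matrix.mulVec, dotProduct, cs, finsetSum_coeff, coeff_C_mul, Finset.mul_sum]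
  refine Finset.sum_congr rfl fun c _ => by ring

theorem vecMul_cs {p q : ℕ} (A : Matrix (Fin p) (Fin q) ℂ) (w : ℕ → ℂ[X]) (i : ℕ) (r : Fin q) :
    (cs w i ᵥ* A) r = (-1)^i * (∑ c : Fin p, w c * C (A c r)).coeff i := by
  simp only [Matrix.vecMul, dotProduct, cs, finsetSum_coeff, coeff_mul_C, Finset.mul_sum]
  refine Finset.sum_congr rfl fun c _ => by ring

theorem pen_coeff (a b : ℂ[X]) (h : X * a + b = 0) : b.coeff 0 = 0 ∧ ∀ i, (-1)^i * a.coeff i = (-1)^(i+1) * b.coeff (i+1) := by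
  constructor
  · have := congrArg (fun p => p.coeff 0) h
    simpa using this
  · intro i
    have := congrArg (fun p => p.coeff (i+1)) h
    simp only [coeff_add, coeff_X_mul, coeff_zero] at this
    rw [pow_succ]
    linear_combination (-1)^i * this

theorem mem_ker_PP {m n d : ℕ} (P : Pol d m n) (v : Fin n → ℂ[X]) :
    v ∈ LinearMap.ker (PP P).mulVecLin ↔ ∀ i, ∑ b, (∑ k ∈ range (d+1), C (pc P k i b) * X^k) * v b = 0 := by
  rw [LinearMap.mem_ker, mulVecLin_apply, funext_iff]
  simp only [Matrix.mulVec, dotProduct, PP_eq, Pi.zero_apply]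

theorem right_rel {m n d : ℕ} (P : Pol d m n) (hd : 1 ≤ d) (v : Fin n → ℂ[X])
    (hv : v ∈ LinearMap.ker (PP P).mulVecLin) :
    compB m n d P *ᵥ cs (xv d X v) 0 = 0 ∧
    ∀ i, compA m n d P *ᵥ cs (xv d X v) i = compB m n d P *ᵥ cs (xv d X v) (i+1) := by
  have h := fun i => pen_coeff _ _ (comp_xv P hd C X v ((mem_ker_PP P v).1 hv) i)
  constructor
  · funext r
    rw [mulVec_cs, (h r).1, mul_zero]; rfl
  · intro i
    funext r
    rw [mulVec_cs, mulVec_cs, (h r).2]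

theorem right_end {m n d : ℕ} (P : Pol d m n) (hd : 1 ≤ d) (v : Fin n → ℂ[X])
    (hv : v ∈ LinearMap.ker (PP P).mulVecLin) (ε : ℕ) (hε : ∀ c, v c ∈ degreeLT ℂ (ε+1)) :
    compA m n d P *ᵥ cs (xv d X v) (ε + (d-1)) = 0 := by
  rw [(right_rel P hd v hv).2]
  have : (cs (xv d X v) (ε + (d-1) + 1) : Fin (n*d) → ℂ) = 0 := by
    funext ⟨c, hc⟩
    obtain ⟨a, b, rfl⟩ := block_form c hc
    simp only [cs, xv_apply, Pi.zero_apply, coeff_X_pow_mul']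
    rw [if_pos (by omega), mem_dlt.1 (hε b) _ (by omega), mul_zero]
  rw [this, mulVec_zero]

theorem sat_ker {m n : ℕ} (A : Matrix (Fin m) (Fin n) ℂ[X]) (k : ℕ) (v : Fin n → ℂ[X])
    (h : (X^k : ℂ[X]) • v ∈ LinearMap.ker A.mulVecLin) : v ∈ LinearMap.ker A.mulVecLin := by
  rw [LinearMap.mem_ker, map_smul] at h
  rw [LinearMap.mem_ker]
  exact (smul_eq_zero.1 h).resolve_left (pow_ne_zero _ X_ne_zero)

theorem comb_cs {κ N : ℕ} {e : Fin κ → ℕ} (M : ℕ) (hM : ∀ j, e j ≤ M) (w : Fin κ → ℕ → ℂ[X])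
    (g : ((j : Fin κ) × Fin (e j)) → ℂ) (t : Fin N) :
    (∑ s : (j : Fin κ) × Fin (e j), g s • (cs (w s.1) s.2 : Fin N → ℂ)) t
     = (∑ j, gpol M (fun i : Fin (e j) => g ⟨j, i⟩ * (-1)^(i:ℕ)) * w j t).coeff M := by
  rw [Finset.sum_apply, Fintype.sum_sigma, finsetSum_coeff]
  refine Finset.sum_congr rfl fun j _ => ?_
  rw [gpol_mul_coeff M (hM j)]
  refine Finset.sum_congr rfl fun i _ => ?_
  simp only [Pi.smul_apply, smul_eq_mul, cs]; ring

theorem right_indep {m n d κ : ℕ} (P : Pol d m n) (hd : 1 ≤ d) {b : Fin κ → Fin n → ℂ[X]} {ε : Fin κ → ℕ}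
    (H : RB (LinearMap.ker (PP P).mulVecLin) b ε) :
    LinearIndependent ℂ (fun s : (j : Fin κ) × Fin (ε j + (d-1)) =>
      compA m n d P *ᵥ cs (xv d X (b s.1)) s.2) := by
  rw [Fintype.linearIndependent_iff]
  intro g hg
  let M := (∑ j, (ε j + (d-1))) + d
  have hM : ∀ j, ε j + (d-1) ≤ M := fun j => by
    have := Finset.single_le_sum (f := fun j => ε j + (d-1)) (fun i _ => Nat.zero_le _) (Finset.mem_univ j)
    omega
  let c : (j : Fin κ) → Fin (ε j + (d-1)) → ℂ := fun j i => g ⟨j, i⟩ * (-1)^(i:ℕ)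
  set Γ := ∑ j, gpol M (c j) • b j with hΓ
  have hΓm : Γ ∈ LinearMap.ker (PP P).mulVecLin := Submodule.sum_mem _ fun j _ => Submodule.smul_mem _ _ (H.mem j)
  let ξ : ℕ → ℂ := fun t => (xv d X Γ t).coeff M
  have hξ : (∑ s : (j : Fin κ) × Fin (ε j + (d-1)), g s • (cs (xv d X (b s.1)) s.2 : Fin (n*d) → ℂ)) = fun t : Fin (n*d) => ξ t := by
    funext t
    rw [comb_cs M hM (fun j => xv d X (b j))]
    simp only [ξ]
    congr 1
    obtain ⟨a, β, hab⟩ := block_form t.1 t.2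
    rw [hab]
    simp only [xv_apply, Γ, Finset.sum_apply, Finset.mul_sum]
    refine Finset.sum_congr rfl fun j _ => ?_
    simp only [Pi.smul_apply, smul_eq_mul, c]; ring
  have hA : compA m n d P *ᵥ (fun t : Fin (n*d) => ξ t) = 0 := by
    rw [← hξ, Matrix.mulVec_sum, ← hg]
    refine Finset.sum_congr rfl fun s _ => ?_
    rw [Matrix.mulVec_smul]
  have hhigh : ∀ (s : ℕ), s + 2 ≤ d → ∀ β : Fin n, (Γ β).coeff (M - s) = 0 := by
    intro s hs β
    have ht : n * (d-1-s-1) + β < n * (d-1) := by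
      have : n * ((d-1-s-1)+1) ≤ n * (d-1) := Nat.mul_le_mul_left _ (by omega)
      rw [Nat.mul_succ] at this; have := β.2; omega
    have h1 := congrFun hA ⟨m + (n * (d-1-s-1) + β), by omega⟩
    have h2 := compA_high P hd (n * (d-1-s-1) + β) (by omega) ℂ (RingHom.id ℂ) ξ
    have h3 := h2.symm.trans h1
    have h4 : n + (n * (d-1-s-1) + β) = n * (d-1-s) + β := by
      rw [show d - 1 - s = (d-1-s-1) + 1 by omega]; simp only [Nat.add_sub_cancel]; ring
    simp only [ξ, h4, xv_apply, Pi.zero_apply, coeff_X_pow_mul'] at h3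
    rw [if_pos (by omega), show M - (d - 1 - (d-1-s)) = M - s by omega] at h3
    exact h3
  have hlow : ∀ i : Fin m, ∑ β, pc P d i β * (Γ β).coeff (M - (d-1)) = 0 := by
    intro i
    have h1 := congrFun hA ⟨i, by omega⟩
    have h2 := compA_low P hd i (by omega) ℂ (RingHom.id ℂ) ξ
    have h3 := h2.symm.trans h1
    refine Eq.trans (Finset.sum_congr rfl fun β _ => ?_) h3
    simp only [RingHom.id_apply, ξ]
    have h4 := xv_apply d X Γ 0 β
    rw [mul_zero, zero_add] at h4
    rw [h4, coeff_X_pow_mul', if_pos (by omega)]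
    rfl
  have hdeg : ∀ i, low M (Γ i) ∈ degreeLT ℂ (M + 2 - d) := by
    intro β
    rw [mem_dlt]
    intro i hi
    by_cases h : i ≤ M
    · rw [low_coeff M _ h]
      have := hhigh (M - i) (by omega) β
      rwa [show M - (M - i) = i by omega] at this
    · exact mem_dlt.1 (low_dlt M _) _ (by omega)
  have := sep H (sat_ker _) (fun j => ε j + (d-1)) c M (M + 2 - d) hM (fun j => by have := hM j; omega) ?_ hdeg
  · intro s
    have h1 := this s.1 s.2
    simp only [c] at h1
    exact (mul_eq_zero.1 h1).resolve_right (pow_ne_zero _ (by norm_num))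
  · rw [← hΓ, mem_ker_PP]
    intro i
    ext t
    rw [coeff_zero]
    by_cases ht : t ≤ M
    · have h1 := (mem_ker_PP P Γ).1 hΓm i
      have h2 : ∑ β, (∑ k ∈ range (d+1), C (pc P k i β) * X^k) * low M (Γ β)
        + X^(M+1) * ∑ β, (∑ k ∈ range (d+1), C (pc P k i β) * X^k) * high M (Γ β) = 0 := by
        rw [← h1, Finset.mul_sum, ← Finset.sum_add_distrib]
        refine Finset.sum_congr rfl fun β _ => ?_
        conv_rhs => rw [← low_high M (Γ β)]
        ring
      have h3 := congrArg (fun p => p.coeff t) h2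
      simp only [coeff_add, coeff_X_pow_mul', coeff_zero] at h3
      rwa [if_neg (by omega), add_zero] at h3
    · have h5 : ∀ β, ((∑ k ∈ range (d+1), C (pc P k i β) * X^k) * low M (Γ β)).coeff t =
          if t = M + 1 then pc P d i β * (Γ β).coeff (M - (d-1)) else 0 := by
        intro β
        rw [Finset.sum_mul, finsetSum_coeff, Finset.sum_range_succ, Finset.sum_eq_zero, zero_add]
        · rw [mul_assoc, coeff_C_mul, coeff_X_pow_mul']
          rw [if_pos (by omega)]
          split_ifs with h
          · rw [low_coeff M _ (by omega), show t - d = M - (d-1) by omega]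
          · rw [mem_dlt.1 (hdeg β) _ (by omega), mul_zero]
        · intro k hk
          rw [Finset.mem_range] at hk
          rw [mul_assoc, coeff_C_mul, coeff_X_pow_mul', if_pos (by omega), mem_dlt.1 (hdeg β) _ (by omega), mul_zero]
      rw [finsetSum_coeff]
      simp only [h5]
      split_ifs
      · exact hlow i
      · simp

theorem right_lead {m n d κ : ℕ} (P : Pol d m n) (hd : 1 ≤ d) {b : Fin κ → Fin n → ℂ[X]} {ε : Fin κ → ℕ}
    (H : RB (LinearMap.ker (PP P).mulVecLin) b ε) :
    LinearIndependent ℂ (fun j => (cs (xv d X (b j)) (ε j + (d-1)) : Fin (n*d) → ℂ)) := by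
  have hnd : n ≤ n * d := Nat.le_mul_of_pos_right n (by omega)
  apply LinearIndependent.of_comp (LinearMap.funLeft ℂ ℂ (Fin.castLE hnd))
  have h := H.lead.units_smul (fun j => ((-1 : ℂˣ))^(ε j + (d-1)))
  refine (linearIndependent_congr' ?_).mpr h
  funext j β
  have h4 := xv_apply d X (b j) 0 β
  rw [mul_zero, zero_add] at h4
  simp only [Function.comp, LinearMap.funLeft_apply, cs, Fin.val_castLE, h4, Pi.smul_apply', Pi.smul_apply,
    coeff_X_pow_mul', Units.smul_def, smul_eq_mul]
  rw [if_pos (by omega), show ε j + (d-1) - (d-1-0) = ε j by omega]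
  simp

end PartE

section PartF
open Polynomial

/-- left Horner vectors -/
noncomputable def Tl {m n d : ℕ} (P : Pol d m n) (k : Fin m → ℂ[X]) : ℕ → Fin n → ℂ[X]
  | 0 => fun b => ∑ i, k i * C (pc P d i b)
  | (s+1) => fun b => X * Tl P k s b + ∑ i, k i * C (pc P (d-(s+1)) i b)

theorem Tl_succ {m n d : ℕ} (P : Pol d m n) (k : Fin m → ℂ[X]) (s : ℕ) (b : Fin n) :
    Tl P k (s+1) b = X * Tl P k s b + ∑ i, k i * C (pc P (d-(s+1)) i b) := rfl

theorem Tl_eq {m n d : ℕ} (P : Pol d m n) (k : Fin m → ℂ[X]) (s : ℕ) (b : Fin n) :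
    Tl P k s b = ∑ u ∈ range (s+1), X^(s-u) * ∑ i, k i * C (pc P (d-u) i b) := by
  induction s with
  | zero => simp [Tl]
  | succ s ih =>
    rw [Finset.sum_range_succ, Tl_succ, ih]
    simp only [Nat.sub_self, pow_zero, one_mul, Finset.mul_sum (range (s+1))]
    congr 1
    refine Finset.sum_congr rfl fun u hu => ?_
    rw [Finset.mem_range] at hu
    rw [show s + 1 - u = (s - u) + 1 by omega, pow_succ]; ring

theorem Tl_d {m n d : ℕ} (P : Pol d m n) (k : Fin m → ℂ[X]) (b : Fin n) :
    Tl P k d b = ((PP P)ᵀ *ᵥ k) b := by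
  rw [Tl_eq, ← Finset.sum_range_reflect]
  simp only [Matrix.mulVec, dotProduct, transpose_apply, PP_eq, Finset.mul_sum, Finset.sum_mul]
  rw [Finset.sum_comm]
  refine Finset.sum_congr rfl fun i _ => Finset.sum_congr rfl fun u hu => ?_
  rw [Finset.mem_range] at hu
  rw [show d - (d + 1 - 1 - u) = u by omega]; ring

theorem Tl_add {m n d : ℕ} (P : Pol d m n) (k k' : Fin m → ℂ[X]) (s : ℕ) (b : Fin n) :
    Tl P (k + k') s b = Tl P k s b + Tl P k' s b := by
  simp only [Tl_eq, Pi.add_apply, add_mul, Finset.sum_add_distrib, mul_add]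

theorem Tl_smul {m n d : ℕ} (P : Pol d m n) (g : ℂ[X]) (k : Fin m → ℂ[X]) (s : ℕ) (b : Fin n) :
    Tl P (g • k) s b = g * Tl P k s b := by
  simp only [Tl_eq, Pi.smul_apply, smul_eq_mul, Finset.mul_sum]
  refine Finset.sum_congr rfl fun u _ => Finset.sum_congr rfl fun i _ => by ring

theorem Tl_sum {m n d κ : ℕ} (P : Pol d m n) (g : Fin κ → ℂ[X]) (k : Fin κ → Fin m → ℂ[X]) (s : ℕ) (b : Fin n) :
    Tl P (∑ j, g j • k j) s b = ∑ j, g j * Tl P (k j) s b := by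
  let L : (Fin m → ℂ[X]) →ₗ[ℂ[X]] ℂ[X] :=
    { toFun := fun k => Tl P k s b
      map_add' := fun _ _ => Tl_add P _ _ s b
      map_smul' := fun _ _ => Tl_smul P _ _ s b }
  have : L (∑ j, g j • k j) = ∑ j, g j * L (k j) := by
    rw [map_sum]; simp only [map_smul, smul_eq_mul]
  exact this

noncomputable def yv {m n d : ℕ} (P : Pol d m n) (k : Fin m → ℂ[X]) : ℕ → ℂ[X] := fun c =>
  if h : c < m then k ⟨c, h⟩ else if hn : 0 < n then Tl P k ((c-m)/n+1) ⟨(c-m) % n, Nat.mod_lt _ hn⟩ else 0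

theorem yv_low {m n d : ℕ} (P : Pol d m n) (k : Fin m → ℂ[X]) (i : Fin m) : yv P k i = k i := by
  simp [yv]

theorem yv_high {m n d : ℕ} (P : Pol d m n) (k : Fin m → ℂ[X]) (a : ℕ) (b : Fin n) :
    yv P k (m + (n*a+b)) = Tl P k (a+1) b := by
  have hn : 0 < n := by have := b.2; omega
  have h3 : (n * (a:ℕ) + b) / n = a := by rw [Nat.mul_add_div hn, Nat.div_eq_of_lt b.2, add_zero]
  have h4 : (n * (a:ℕ) + b) % n = b := by rw [Nat.mul_add_mod, Nat.mod_eq_of_lt b.2]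
  simp only [yv, Nat.add_sub_cancel_left, dif_pos hn, h3, h4, Fin.eta]
  rw [dif_neg (by omega)]

theorem yv_A {m n d : ℕ} (P : Pol d m n) (hd : 1 ≤ d) (k : Fin m → ℂ[X]) (a : Fin d) (b : Fin n) (h : n*(a:ℕ)+b < n*d) :
    ∑ c : Fin (m + n*(d-1)), yv P k c * C (compA m n d P c ⟨n*a+b, h⟩) = Tl P k a b := by
  rw [compA_left P hd a b h]
  split_ifs with h0
  · simp only [yv_low, h0, Tl]
  · rw [yv_high, show (a:ℕ) - 1 + 1 = a by omega]

theorem yv_B {m n d : ℕ} (P : Pol d m n) (hd : 1 ≤ d) (k : Fin m → ℂ[X]) (hk : (PP P)ᵀ *ᵥ k = 0)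
    (a : Fin d) (b : Fin n) (h : n*(a:ℕ)+b < n*d) :
    X * ∑ c : Fin (m + n*(d-1)), yv P k c * C (compA m n d P c ⟨n*a+b, h⟩) +
    ∑ c : Fin (m + n*(d-1)), yv P k c * C (compB m n d P c ⟨n*a+b, h⟩) = 0 := by
  rw [yv_A P hd, compB_left P hd a b h]
  have h1 : X * Tl P k a b + ∑ i : Fin m, yv P k i * C (pc P (d-1-a) i b) = Tl P k (a+1) b := by
    simp only [yv_low, Tl, show d - 1 - (a:ℕ) = d - (a+1) by omega]
  rw [← add_assoc, h1]
  split_ifs with h2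
  · rw [yv_high, add_neg_cancel]
  · rw [add_zero, show (a:ℕ) + 1 = d by omega, Tl_d, hk]; rfl

theorem mem_ker_PPT {m n d : ℕ} (P : Pol d m n) (v : Fin m → ℂ[X]) :
    v ∈ LinearMap.ker (PP P)ᵀ.mulVecLin ↔ (PP P)ᵀ *ᵥ v = 0 := by
  rw [LinearMap.mem_ker, mulVecLin_apply]

theorem left_rel {m n d : ℕ} (P : Pol d m n) (hd : 1 ≤ d) (v : Fin m → ℂ[X])
    (hv : v ∈ LinearMap.ker (PP P)ᵀ.mulVecLin) :
    cs (yv P v) 0 ᵥ* compB m n d P = 0 ∧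
    ∀ i, cs (yv P v) i ᵥ* compA m n d P = cs (yv P v) (i+1) ᵥ* compB m n d P := by
  have h := fun a b h => pen_coeff _ _ (yv_B P hd v ((mem_ker_PPT P v).1 hv) a b h)
  constructor
  · funext ⟨c, hc⟩
    obtain ⟨a, b, rfl⟩ := block_form c hc
    rw [vecMul_cs, (h a b hc).1, mul_zero]; rfl
  · intro i
    funext ⟨c, hc⟩
    obtain ⟨a, b, rfl⟩ := block_form c hc
    rw [vecMul_cs, vecMul_cs, (h a b hc).2]

theorem Tl_deg {m n d : ℕ} (P : Pol d m n) (v : Fin m → ℂ[X])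
    (hv : v ∈ LinearMap.ker (PP P)ᵀ.mulVecLin) (η : ℕ) (hη : ∀ c, v c ∈ degreeLT ℂ (η+1)) (s : ℕ) (hs : s ≤ d)
    (b : Fin n) : Tl P v s b ∈ degreeLT ℂ η := by
  obtain ⟨u, hu⟩ : ∃ u, s + u = d := ⟨d - s, by omega⟩
  induction u generalizing s with
  | zero =>
    obtain rfl : s = d := by omega
    rw [Tl_d, (mem_ker_PPT P v).1 hv]; exact Submodule.zero_mem _
  | succ u ih' =>
    have ih := ih' (s+1) (by omega) (by omega)
    rw [mem_dlt] at ih ⊢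
    intro i hi
    have h1 := ih (i+1) (by omega)
    rw [Tl_succ, coeff_add, coeff_X_mul, finsetSum_coeff, Finset.sum_eq_zero, add_zero] at h1
    · exact h1
    · intro j _
      rw [coeff_mul_C, mem_dlt.1 (hη j) _ (by omega), zero_mul]

theorem left_end {m n d : ℕ} (P : Pol d m n) (hd : 1 ≤ d) (v : Fin m → ℂ[X])
    (hv : v ∈ LinearMap.ker (PP P)ᵀ.mulVecLin) (η : ℕ) (hη : ∀ c, v c ∈ degreeLT ℂ (η+1)) :
    cs (yv P v) η ᵥ* compA m n d P = 0 := by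
  funext ⟨c, hc⟩
  obtain ⟨a, b, rfl⟩ := block_form c hc
  rw [vecMul_cs, yv_A P hd, mem_dlt.1 (Tl_deg P v hv η hη a (by omega) b) _ le_rfl, mul_zero]; rfl

theorem left_indep {m n d κ : ℕ} (P : Pol d m n) (hd : 1 ≤ d) {b : Fin κ → Fin m → ℂ[X]} {ε : Fin κ → ℕ}
    (H : RB (LinearMap.ker (PP P)ᵀ.mulVecLin) b ε) :
    LinearIndependent ℂ (fun s : (j : Fin κ) × Fin (ε j) => cs (yv P (b s.1)) s.2 ᵥ* compA m n d P) := by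
  rw [Fintype.linearIndependent_iff]
  intro g hg
  let M := (∑ j, ε j) + d
  have hM : ∀ j, ε j ≤ M := fun j => by
    have := Finset.single_le_sum (f := fun j => ε j) (fun i _ => Nat.zero_le _) (Finset.mem_univ j)
    omega
  let c : (j : Fin κ) → Fin (ε j) → ℂ := fun j i => g ⟨j, i⟩ * (-1)^(i:ℕ)
  set Γ := ∑ j, gpol M (c j) • b j with hΓ
  have hΓm : Γ ∈ LinearMap.ker (PP P)ᵀ.mulVecLin := Submodule.sum_mem _ fun j _ => Submodule.smul_mem _ _ (H.mem j)
  have hsum : Γ = (fun i => low M (Γ i)) + (X^(M+1) : ℂ[X]) • (fun i => high M (Γ i)) := by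
    funext i
    exact (low_high M (Γ i)).symm
  set Γl : Fin m → ℂ[X] := fun i => low M (Γ i) with hΓl
  set Γh : Fin m → ℂ[X] := fun i => high M (Γ i) with hΓh
  have hTlow : ∀ s β t, t ≤ M → (Tl P Γl s β).coeff t = (Tl P Γ s β).coeff t := by
    intro s β t ht
    rw [hsum, Tl_add, Tl_smul, coeff_add, coeff_X_pow_mul', if_neg (by omega), add_zero]
  have hTM : ∀ s < d, ∀ β, (Tl P Γl s β).coeff M = 0 := by
    intro s hs β
    have hsb : n * s + β < n * d := by
      have : n * (s+1) ≤ n * d := Nat.mul_le_mul_left _ (by omega)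
      rw [Nat.mul_succ] at this; have := β.2; omega
    rw [hTlow _ _ _ le_rfl, hΓ, Tl_sum, finsetSum_coeff]
    have h1 := congrFun hg ⟨n * s + β, hsb⟩
    rw [Finset.sum_apply, Fintype.sum_sigma] at h1
    refine Eq.trans (Finset.sum_congr rfl fun j _ => ?_) h1
    rw [gpol_mul_coeff M (hM j)]
    refine Finset.sum_congr rfl fun i _ => ?_
    rw [Pi.smul_apply, vecMul_cs]
    have h2 := yv_A P hd (b j) ⟨s, hs⟩ β hsb
    simp only at h2
    rw [h2]
    simp only [c, smul_eq_mul]; ring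
  have hT2 : ∀ s ≤ d, ∀ β t, 1 ≤ t → (Tl P Γl s β).coeff (M + t) = 0 := by
    have h3 : ∀ (s : ℕ) (β : Fin n) t, 1 ≤ t → (∑ i, Γl i * C (pc P s i β)).coeff (M + t) = 0 := by
      intro s β t ht
      rw [finsetSum_coeff]
      refine Finset.sum_eq_zero fun i _ => ?_
      rw [coeff_mul_C, mem_dlt.1 (low_dlt M (Γ i)) _ (by omega), zero_mul]
    intro s
    induction s with
    | zero =>
      intro _ β t ht
      exact h3 d β t ht
    | succ s ih =>
      intro hs β t ht
      obtain ⟨t, rfl⟩ : ∃ t', t = t' + 1 := ⟨t - 1, by omega⟩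
      rw [Tl_succ, coeff_add, h3 _ _ _ ht, add_zero, ← add_assoc, coeff_X_mul]
      rcases Nat.eq_zero_or_pos t with rfl | h
      · exact hTM s (by omega) β
      · exact ih (by omega) β t h
  have := sep H (sat_ker _) ε c M (M + 1) hM (fun j => by omega) ?_ (fun i => low_dlt M _)
  · intro s
    have h1 := this s.1 s.2
    simp only [c] at h1
    exact (mul_eq_zero.1 h1).resolve_right (pow_ne_zero _ (by norm_num))
  · rw [← hΓ, mem_ker_PPT]
    funext β
    have : ((PP P)ᵀ *ᵥ Γl) β = 0 := by
      rw [← Tl_d]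
      ext t
      rw [coeff_zero]
      by_cases ht : t ≤ M
      · rw [hTlow _ _ _ ht, Tl_d, (mem_ker_PPT P Γ).1 hΓm]; rfl
      · obtain ⟨t', rfl⟩ : ∃ t', t = M + t' := ⟨t - M, by omega⟩
        exact hT2 d le_rfl β t' (by omega)
    exact this

theorem left_lead {m n d κ : ℕ} (P : Pol d m n) {b : Fin κ → Fin m → ℂ[X]} {ε : Fin κ → ℕ}
    (H : RB (LinearMap.ker (PP P)ᵀ.mulVecLin) b ε) :
    LinearIndependent ℂ (fun j => (cs (yv P (b j)) (ε j) : Fin (m + n*(d-1)) → ℂ)) := by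
  apply LinearIndependent.of_comp (LinearMap.funLeft ℂ ℂ (Fin.castAdd (n*(d-1))))
  have h := H.lead.units_smul (fun j => ((-1 : ℂˣ))^(ε j))
  refine (linearIndependent_congr' ?_).mpr h
  funext j β
  simp only [Function.comp, LinearMap.funLeft_apply, cs, Fin.val_castAdd, yv_low, Pi.smul_apply', Pi.smul_apply,
    Units.smul_def, smul_eq_mul]
  simp

theorem strict_of_RB {m n d : ℕ} (P : Pol d m n) (hd : 1 ≤ d) (c₁ c₂ c₃ c₄ α β : ℕ)
    {b : Fin (c₁ + c₂) → Fin n → ℂ[X]} {ε : Fin (c₁ + c₂) → ℕ}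
    {k : Fin (c₃ + c₄) → Fin m → ℂ[X]} {η : Fin (c₃ + c₄) → ℕ}
    (H : RB (LinearMap.ker (PP P).mulVecLin) b ε)
    (H' : RB (LinearMap.ker (PP P)ᵀ.mulVecLin) k η)
    (hε : ∀ j, ε j = if (j : ℕ) < c₁ then α + 1 else α)
    (hη : ∀ j, η j = if (j : ℕ) < c₃ then β + 1 else β)
    (hp : ∑ j, (ε j + (d-1)) + ∑ k, (η k + 1) = m + n*(d-1))
    (hq : ∑ j, (ε j + (d-1) + 1) + ∑ k, η k = n*d) :
    StrictEquiv (comp m n d P) (genPencil c₁ c₂ c₃ c₄ (α+d) (α+d-1) (β+1) β (m + n*(d-1)) (n*d)) := by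
  refine kron_pencil _ _ c₁ c₂ c₃ c₄ _ _ _ _ (fun j => ε j + (d-1)) ?_ η hη
    (fun j => cs (xv d X (b j))) (fun j => cs (yv P (k j)))
    (fun j => (right_rel P hd _ (H.mem j)).1) (fun j => (right_rel P hd _ (H.mem j)).2)
    (fun j => right_end P hd _ (H.mem j) _ (H.deg j))
    (fun j => (left_rel P hd _ (H'.mem j)).1) (fun j => (left_rel P hd _ (H'.mem j)).2)
    (fun j => left_end P hd _ (H'.mem j) _ (H'.deg j))
    (right_indep P hd H) (right_lead P hd H) (left_indep P hd H') (left_lead P H') hp hq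
  intro j
  simp only [hε]
  split_ifs <;> omega

end PartF

section PartG
open Polynomial

def InjN {r n : ℕ} (R : Matrix (Fin r) (Fin n) ℂ[X]) (N : ℕ) : Prop :=
  ∀ v : Fin n → ℂ[X], (∀ c, v c ∈ degreeLT ℂ N) → R *ᵥ v = 0 → v = 0

def SurjN {r n : ℕ} (R : Matrix (Fin r) (Fin n) ℂ[X]) (ρ : Fin r → ℕ) (N : ℕ) : Prop :=
  ∀ w : Fin r → ℂ[X], (∀ i, w i ∈ degreeLT ℂ (ρ i + N)) → ∃ v : Fin n → ℂ[X],
    (∀ c, v c ∈ degreeLT ℂ N) ∧ R *ᵥ v = w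

theorem SurjN.succ {r n : ℕ} {R : Matrix (Fin r) (Fin n) ℂ[X]} {ρ : Fin r → ℕ} {N : ℕ} (hN : 1 ≤ N)
    (h : SurjN R ρ N) : SurjN R ρ (N+1) := by
  intro w hw
  obtain ⟨v, hv, hv'⟩ := h (fun i => (w i).divX) (fun i => by
    rw [mem_dlt]; intro k hk; rw [coeff_divX]; exact mem_dlt.1 (hw i) _ (by omega))
  obtain ⟨u, hu, hu'⟩ := h (fun i => C ((w i).coeff 0)) (fun i => by
    rw [mem_dlt]; intro k hk; rw [coeff_C, if_neg (by omega)])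
  refine ⟨(X : ℂ[X]) • v + u, fun c => ?_, ?_⟩
  · rw [mem_dlt]; intro k hk
    obtain ⟨k, rfl⟩ : ∃ k', k = k' + 1 := ⟨k - 1, by omega⟩
    rw [Pi.add_apply, Pi.smul_apply, smul_eq_mul, coeff_add, coeff_X_mul, mem_dlt.1 (hv c) _ (by omega),
      mem_dlt.1 (hu c) _ (by omega), add_zero]
  · rw [Matrix.mulVec_add, Matrix.mulVec_smul, hv', hu']
    funext i
    simp only [Pi.add_apply, Pi.smul_apply, smul_eq_mul]
    exact X_mul_divX_add (w i)

theorem SurjN.ge {r n : ℕ} {R : Matrix (Fin r) (Fin n) ℂ[X]} {ρ : Fin r → ℕ} {N : ℕ} (hN : 1 ≤ N)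
    (h : SurjN R ρ N) (k : ℕ) : SurjN R ρ (N+k) := by
  induction k with
  | zero => exact h
  | succ k ih => exact SurjN.succ (N := N + k) (by omega) ih

theorem finrank_dlt (N : ℕ) : Module.finrank ℂ (degreeLT ℂ N) = N := by
  rw [(degreeLTEquiv ℂ N).finrank_eq]; simp

instance (N : ℕ) : FiniteDimensional ℂ (degreeLT ℂ N) :=
  Module.Finite.equiv (degreeLTEquiv ℂ N).symm

/-- the Sylvester map -/
noncomputable def SylN {r n : ℕ} (R : Matrix (Fin r) (Fin n) ℂ[X]) (ρ : Fin r → ℕ)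
    (hR : ∀ i c, R i c ∈ degreeLT ℂ (ρ i + 1)) (N : ℕ) :
    (Fin n → degreeLT ℂ N) →ₗ[ℂ] ((i : Fin r) → degreeLT ℂ (ρ i + N)) where
  toFun v := fun i => ⟨(R *ᵥ (fun c => (v c : ℂ[X]))) i, by
    simp only [Matrix.mulVec, dotProduct]
    refine Submodule.sum_mem _ fun c _ => ?_
    rw [mul_comm, add_comm]
    exact mul_dlt (v c).2 (hR i c)⟩
  map_add' v w := by
    funext i
    apply Subtype.ext
    simp [Matrix.mulVec, dotProduct, mul_add, Finset.sum_add_distrib]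
  map_smul' k v := by
    funext i
    apply Subtype.ext
    simp [Matrix.mulVec, dotProduct, Finset.smul_sum]

theorem SylN_val {r n : ℕ} (R : Matrix (Fin r) (Fin n) ℂ[X]) (ρ : Fin r → ℕ)
    (hR : ∀ i c, R i c ∈ degreeLT ℂ (ρ i + 1)) (N : ℕ) (v : Fin n → degreeLT ℂ N) (i) :
    (SylN R ρ hR N v i : ℂ[X]) = (R *ᵥ (fun c => (v c : ℂ[X]))) i := rfl

theorem SylN_ker {r n : ℕ} {κ : Type} [Fintype κ] (R : Matrix (Fin r) (Fin n) ℂ[X]) (ρ : Fin r → ℕ)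
    (hR : ∀ i c, R i c ∈ degreeLT ℂ (ρ i + 1)) (N : ℕ) {b : κ → Fin n → ℂ[X]} {ε : κ → ℕ}
    (H : RB (LinearMap.ker R.mulVecLin) b ε) :
    Module.finrank ℂ (LinearMap.ker (SylN R ρ hR N)) = ∑ j, (N - ε j) := by
  let Φ : ((j : κ) → degreeLT ℂ (N - ε j)) →ₗ[ℂ] (Fin n → degreeLT ℂ N) :=
    { toFun := fun q c => ⟨∑ j, (q j : ℂ[X]) * b j c, by
        refine Submodule.sum_mem _ fun j _ => ?_
        by_cases h : ε j ≤ N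
        · have := mul_dlt (q j).2 (H.deg j c)
          rwa [Nat.sub_add_cancel h] at this
        · have : (q j : ℂ[X]) = 0 := by
            ext i
            exact mem_dlt.1 (q j).2 i (by omega)
          rw [this, zero_mul]; exact Submodule.zero_mem _⟩
      map_add' := fun q q' => by
        funext c; apply Subtype.ext
        simp [add_mul, Finset.sum_add_distrib]
      map_smul' := fun k q => by
        funext c; apply Subtype.ext
        simp [Finset.smul_sum] }
  have hΦ : ∀ q c, (Φ q c : ℂ[X]) = (∑ j, (q j : ℂ[X]) • b j) c := by
    intro q c
    simp [Φ]
  have hinj : Function.Injective Φ := by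
    rw [← LinearMap.ker_eq_bot, LinearMap.ker_eq_bot']
    intro q hq
    have h0 : ∑ j, (q j : ℂ[X]) • b j = 0 := by
      funext c
      rw [← hΦ, hq]; rfl
    funext j
    apply Subtype.ext
    exact H.indep _ h0 j
  have hrange : LinearMap.range Φ = LinearMap.ker (SylN R ρ hR N) := by
    ext v
    constructor
    · rintro ⟨q, rfl⟩
      rw [LinearMap.mem_ker]
      funext i
      apply Subtype.ext
      rw [SylN_val]
      have h1 : (fun c => (Φ q c : ℂ[X])) = ∑ j, (q j : ℂ[X]) • b j := funext fun c => hΦ q c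
      rw [h1]
      have h2 : (∑ j, (q j : ℂ[X]) • b j) ∈ LinearMap.ker R.mulVecLin :=
        Submodule.sum_mem _ fun j _ => Submodule.smul_mem _ _ (H.mem j)
      rw [LinearMap.mem_ker, mulVecLin_apply] at h2
      rw [h2]; rfl
    · intro hv
      rw [LinearMap.mem_ker] at hv
      have h1 : (fun c => (v c : ℂ[X])) ∈ LinearMap.ker R.mulVecLin := by
        rw [LinearMap.mem_ker, mulVecLin_apply]
        funext i
        rw [← SylN_val R ρ hR N v i, hv]; rfl
      obtain ⟨q, hq, hqd⟩ := H.pred _ h1 N (fun c => (v c).2)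
      refine ⟨fun j => ⟨q j, hqd j⟩, ?_⟩
      funext c
      apply Subtype.ext
      rw [hΦ]
      exact (congrFun hq c).symm
  rw [← hrange, LinearMap.finrank_range_of_inj hinj, Module.finrank_pi_fintype]
  simp only [finrank_dlt]

theorem count_eq {r n : ℕ} {κ : Type} [Fintype κ] (R : Matrix (Fin r) (Fin n) ℂ[X]) (ρ : Fin r → ℕ)
    (hR : ∀ i c, R i c ∈ degreeLT ℂ (ρ i + 1)) (N : ℕ) {b : κ → Fin n → ℂ[X]} {ε : κ → ℕ}
    (H : RB (LinearMap.ker R.mulVecLin) b ε) (hS : SurjN R ρ N) :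
    ∑ j, (N - ε j) + ∑ i, ρ i + r * N = n * N := by
  have h1 := (SylN R ρ hR N).finrank_range_add_finrank_ker
  rw [SylN_ker R ρ hR N H] at h1
  have h2 : LinearMap.range (SylN R ρ hR N) = ⊤ := by
    rw [LinearMap.range_eq_top]
    intro w
    obtain ⟨v, hv, hvw⟩ := hS (fun i => w i) (fun i => (w i).2)
    refine ⟨fun c => ⟨v c, hv c⟩, ?_⟩
    funext i
    apply Subtype.ext
    rw [SylN_val]
    exact congrFun hvw i
  rw [h2, finrank_top, Module.finrank_pi_fintype, Module.finrank_pi_fintype] at h1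
  simp only [finrank_dlt, Finset.sum_add_distrib, Finset.sum_const, Finset.card_univ, Fintype.card_fin, smul_eq_mul] at h1
  omega

theorem RB.reindex {ι κ κ' : Type} [Fintype ι] [Fintype κ] [Fintype κ'] {Mod : Submodule ℂ[X] (ι → ℂ[X])}
    {b : κ → ι → ℂ[X]} {ε : κ → ℕ} (H : RB Mod b ε) (e : κ' ≃ κ) : RB Mod (b ∘ e) (ε ∘ e) where
  mem j := H.mem _
  deg j := H.deg _
  lead := H.lead.comp e e.injective
  span := by rw [EquivLike.range_comp]; exact H.span

theorem propB {r n : ℕ} (hrn : r < n) (R : Matrix (Fin r) (Fin n) ℂ[X]) (ρ : Fin r → ℕ)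
    (hR : ∀ i c, R i c ∈ degreeLT ℂ (ρ i + 1)) (α s : ℕ) (hs : s < n - r)
    (ha : ∑ i, ρ i = (n-r) * α + s) (hI : InjN R α) (hS : SurjN R ρ (α+1)) :
    ∃ (b : Fin (s + (n-r-s)) → Fin n → ℂ[X]) (ε : Fin (s + (n-r-s)) → ℕ),
      RB (LinearMap.ker R.mulVecLin) b ε ∧ ∀ j, ε j = if (j:ℕ) < s then α + 1 else α := by
  classical
  obtain ⟨κ, _, b, ε, H⟩ := exists_RB (LinearMap.ker R.mulVecLin)
  obtain ⟨k, rfl⟩ : ∃ k, n = r + k := ⟨n - r, by omega⟩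
  rw [Nat.add_sub_cancel_left] at *
  have hge : ∀ j, α ≤ ε j := by
    intro j
    by_contra hlt
    have h0 := hI (b j) (fun c => by
      rw [mem_dlt]; intro i hi; exact mem_dlt.1 (H.deg j c) _ (by omega)) (H.mem j)
    apply H.lead.ne_zero j
    funext c
    rw [h0]; simp
  have hc1 : ∑ j, (α + 1 - ε j) = k - s := by
    have := count_eq R ρ hR (α+1) H hS
    rw [ha] at this
    have h2 : (r + k) * (α+1) = r * (α + 1) + k * α + k := by ring
    omega
  let B := ∑ j, ε j + 0
  have hB : ∀ j, ε j ≤ α + 1 + B := fun j => by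
    have := Finset.single_le_sum (f := fun j => ε j) (fun i _ => Nat.zero_le _) (Finset.mem_univ j)
    omega
  have hcN : ∀ t, (Fintype.card κ) * (α + 1 + B + t) + ((k * α + s) + r * (α + 1 + B + t)) = (r + k) * (α + 1 + B + t) + ∑ j, ε j := by
    intro t
    have hS' : SurjN R ρ (α + 1 + B + t) := by
      have := hS.ge (by omega) (B + t)
      rwa [← add_assoc] at this
    have h1 := count_eq R ρ hR _ H hS'
    rw [ha] at h1
    have h2 : ∑ j, (α + 1 + B + t - ε j) + ∑ j, ε j = Fintype.card κ * (α + 1 + B + t) := by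
      rw [← Finset.sum_add_distrib, Finset.sum_congr rfl (fun j _ => Nat.sub_add_cancel (by have := hB j; omega))]
      simp
    omega
  have hcard : Fintype.card κ = k := by
    have h0 := hcN 0
    have h1 := hcN 1
    have e1 : Fintype.card κ * (α + 1 + B + 1) = Fintype.card κ * (α + 1 + B + 0) + Fintype.card κ := by ring
    have e2 : r * (α + 1 + B + 1) = r * (α + 1 + B + 0) + r := by ring
    have e3 : (r + k) * (α + 1 + B + 1) = (r + k) * (α + 1 + B + 0) + (r + k) := by ring
    omega
  have hsum : ∑ j, ε j = k * α + s := by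
    have h0 := hcN 0
    rw [hcard] at h0
    have e3 : (r + k) * (α + 1 + B + 0) = r * (α + 1 + B + 0) + k * (α + 1 + B + 0) := by ring
    omega
  -- every ε is α or α+1
  have hle : ∀ j, ε j ≤ α + 1 := by
    have h3 : ∑ j, (ε j + (α + 1 - ε j)) = ∑ j : κ, (α + 1) := by
      rw [Finset.sum_add_distrib, hsum, hc1]
      simp only [Finset.sum_const, Finset.card_univ, hcard, smul_eq_mul, Nat.mul_succ]
      omega
    have h4 := (Finset.sum_eq_sum_iff_of_le (s := univ (α := κ)) (f := fun _ => α + 1) (g := fun j => ε j + (α + 1 - ε j))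
      (fun j _ => by omega)).1 h3.symm
    intro j
    have := h4 j (Finset.mem_univ j)
    omega
  have hcA : Fintype.card {j // ¬ (ε j = α + 1)} = k - s := by
    rw [Fintype.card_subtype, Finset.card_filter, ← hc1]
    refine Finset.sum_congr rfl fun j _ => ?_
    have := hge j; have := hle j
    split_ifs <;> omega
  have hcB : Fintype.card {j // ε j = α + 1} = s := by
    have := Fintype.card_subtype_compl (fun j => ε j = α + 1)
    have h2 := Fintype.card_subtype_le (fun j => ε j = α + 1)
    rw [hcA] at this
    omega
  let e : Fin (s + (k - s)) ≃ κ := finSumFinEquiv.symm.trans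
    ((Equiv.sumCongr (Fintype.equivFinOfCardEq hcB).symm (Fintype.equivFinOfCardEq hcA).symm).trans
      (Equiv.sumCompl (fun j => ε j = α + 1)))
  refine ⟨b ∘ e, ε ∘ e, H.reindex e, ?_⟩
  intro j
  obtain ⟨x, rfl⟩ := finSumFinEquiv.surjective j
  rcases x with x | x
  · have h1 := ((Fintype.equivFinOfCardEq hcB).symm x).2
    have he : e (finSumFinEquiv (Sum.inl x)) = ((Fintype.equivFinOfCardEq hcB).symm x).1 := by
      simp only [e, Equiv.trans_apply, Equiv.symm_apply_apply, Equiv.sumCongr_apply, Sum.map_inl,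
        Equiv.sumCompl_apply_inl]
    show ε (e _) = _
    rw [he, h1, if_pos (by simp)]
  · have h1 := ((Fintype.equivFinOfCardEq hcA).symm x).2
    have h2 := hge ((Fintype.equivFinOfCardEq hcA).symm x).1
    have h3 := hle ((Fintype.equivFinOfCardEq hcA).symm x).1
    have he : e (finSumFinEquiv (Sum.inr x)) = ((Fintype.equivFinOfCardEq hcA).symm x).1 := by
      simp only [e, Equiv.trans_apply, Equiv.symm_apply_apply, Equiv.sumCongr_apply, Sum.map_inr,
        Equiv.sumCompl_apply_inr]
    show ε (e _) = _
    rw [he, if_neg (by simp)]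
    omega

theorem ker_mul {m r n : ℕ} (L : Matrix (Fin m) (Fin r) ℂ[X]) (R : Matrix (Fin r) (Fin n) ℂ[X])
    (ρ : Fin r → ℕ) (N : ℕ) (hN : 1 ≤ N) (hS : SurjN Lᵀ ρ N) :
    LinearMap.ker (L * R).mulVecLin = LinearMap.ker R.mulVecLin := by
  ext v
  rw [LinearMap.mem_ker, LinearMap.mem_ker, mulVecLin_apply, mulVecLin_apply, ← Matrix.mulVec_mulVec]
  constructor
  · intro h
    funext i
    obtain ⟨x, -, hx⟩ := hS (Pi.single i 1) (fun j => by
      rw [mem_dlt]; intro k hk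
      by_cases hj : j = i
      · subst hj; rw [Pi.single_eq_same, coeff_one, if_neg (by omega)]
      · rw [Pi.single_eq_of_ne hj, coeff_zero])
    have h1 : (Lᵀ *ᵥ x) ⬝ᵥ (R *ᵥ v) = 0 := by
      rw [Matrix.mulVec_transpose, ← Matrix.dotProduct_mulVec, h, dotProduct_zero]
    rw [hx, single_dotProduct, one_mul] at h1
    exact h1
  · intro h
    rw [h, mulVec_zero]

end PartG

section PartH
open Polynomial

theorem X_pow_mul_dlt {p : ℂ[X]} {N : ℕ} (k : ℕ) (h : p ∈ degreeLT ℂ N) :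
    X^k * p ∈ degreeLT ℂ (k + N) := by
  rw [mem_dlt] at *
  intro i hi
  rw [coeff_X_pow_mul', if_pos (by omega)]
  exact h _ (by omega)

theorem dlt_mono {p : ℂ[X]} {N M : ℕ} (hNM : N ≤ M) (h : p ∈ degreeLT ℂ N) : p ∈ degreeLT ℂ M :=
  degreeLT_mono hNM h

theorem X_pow_mul_dlt_iff {p : ℂ[X]} {N k : ℕ} (h : X^k * p ∈ degreeLT ℂ (k + N)) :
    p ∈ degreeLT ℂ N := by
  rw [mem_dlt] at *
  intro i hi
  have := h (k + i) (by omega)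
  rwa [add_comm k i, coeff_X_pow_mul] at this

/-- covering -/
theorem cover (t : ℕ → ℕ) (N : ℕ) (h0 : t 0 = 0) (ht : ∀ c, t (c+1) ≤ t c + N) :
    ∀ (k : ℕ) (W : ℂ[X]), W ∈ degreeLT ℂ (t k + N) →
      ∃ Y : ℕ → ℂ[X], (∀ c, Y c ∈ degreeLT ℂ N) ∧ ∑ c ∈ range (k+1), X^(t c) * Y c = W := by
  intro k
  induction k with
  | zero =>
    intro W hW
    refine ⟨fun _ => W, fun _ => by rw [h0, zero_add] at hW; exact hW, by simp [h0]⟩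
  | succ k ih =>
    intro W hW
    have e : W %ₘ X^(t (k+1)) + X^(t (k+1)) * (W /ₘ X^(t (k+1))) = W := modByMonic_add_div W _
    have hlow : W %ₘ X^(t (k+1)) ∈ degreeLT ℂ (t (k+1)) := by
      rw [mem_degreeLT]
      have := degree_modByMonic_lt W (monic_X_pow (R := ℂ) (t (k+1)))
      rwa [degree_X_pow] at this
    obtain ⟨Y, hY, hs⟩ := ih (W %ₘ X^(t (k+1))) (dlt_mono (ht k) hlow)
    have hhigh : W /ₘ X^(t (k+1)) ∈ degreeLT ℂ N := by
      apply X_pow_mul_dlt_iff (k := t (k+1))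
      rw [← eq_sub_iff_add_eq'] at e
      rw [e]
      exact Submodule.sub_mem _ hW (dlt_mono (by omega) hlow)
    refine ⟨fun c => if c = k+1 then W /ₘ X^(t (k+1)) else Y c, fun c => ?_, ?_⟩
    · dsimp only; split_ifs
      · exact hhigh
      · exact hY c
    · rw [Finset.sum_range_succ]
      dsimp only
      rw [if_pos rfl]
      refine Eq.trans ?_ e
      rw [← hs]
      congr 1
      refine Finset.sum_congr rfl fun c hc => ?_
      rw [if_neg (by have := Finset.mem_range.1 hc; omega)]

/-- disjointness -/
theorem disj (t : ℕ → ℕ) (N : ℕ) (ht : ∀ c c', c < c' → t c + N ≤ t c') (k : ℕ) (Y : ℕ → ℂ[X])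
    (hY : ∀ c, Y c ∈ degreeLT ℂ N) (h : ∑ c ∈ range (k+1), X^(t c) * Y c = 0) :
    ∀ c, c ≤ k → Y c = 0 := by
  intro c hc
  ext j
  rw [coeff_zero]
  by_cases hj : N ≤ j
  · exact mem_dlt.1 (hY c) _ hj
  have h1 := congrArg (fun p => coeff p (j + t c)) h
  simp only [finsetSum_coeff, coeff_zero] at h1
  rw [Finset.sum_eq_single c] at h1
  · rwa [coeff_X_pow_mul] at h1
  · intro c' _ hcc
    rw [coeff_X_pow_mul']
    split_ifs with h2
    · rcases lt_or_gt_of_ne hcc with h3 | h3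
      · have := ht _ _ h3
        exact mem_dlt.1 (hY c') _ (by omega)
      · have := ht _ _ h3
        omega
    · rfl
  · intro h3
    exact absurd (Finset.mem_range.2 (by omega)) h3

theorem exists_row (σ : ℕ → ℕ) (h0 : σ 0 = 0) (r : ℕ) (hr : 1 ≤ r) (t : ℕ) (ht : t ≤ σ r) :
    ∃ i, i < r ∧ σ i ≤ t ∧ t ≤ σ (i+1) := by
  induction r with
  | zero => omega
  | succ r ih =>
    by_cases h : σ r ≤ t
    · exact ⟨r, by omega, h, ht⟩
    · rcases Nat.eq_zero_or_pos r with rfl | hr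
      · rw [h0] at h; omega
      · obtain ⟨i, h1, h2, h3⟩ := ih hr (by omega)
        exact ⟨i, by omega, h2, h3⟩

noncomputable def zz (r k : ℕ) (ρ : ℕ → ℕ) (σ t π : ℕ → ℕ) : Matrix (Fin r) (Fin r ⊕ Fin k) ℂ[X] :=
  Matrix.of fun i c => Sum.elim
    (fun j : Fin r => if (j:ℕ) = i then X^(ρ i) else if (j:ℕ) + 1 = i then -1 else 0)
    (fun c : Fin k => if π c = i then X^(t c - σ i) else 0) c

theorem zz_mulVec (r k : ℕ) (ρ σ t π : ℕ → ℕ) (x y : ℕ → ℂ[X]) (h0 : x 0 = 0) (i : Fin r) :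
    (zz r k ρ σ t π *ᵥ (Sum.elim (fun j : Fin r => x (j+1)) (fun c : Fin k => y c))) i =
      X^(ρ i) * x (i+1) - x i + ∑ c ∈ range k, (if π c = i then X^(t c - σ i) * y c else 0) := by
  simp only [Matrix.mulVec, dotProduct, Fintype.sum_sum_type, zz, Matrix.of_apply, Sum.elim_inl, Sum.elim_inr]
  congr 1
  · rw [Fin.sum_univ_eq_sum_range (fun j => (if j = (i:ℕ) then (X:ℂ[X])^(ρ i) else if j + 1 = i then -1 else 0) * x (j+1)) r]
    have : ∀ j, (if j = (i:ℕ) then (X:ℂ[X])^(ρ i) else if j + 1 = i then -1 else 0) * x (j+1) =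
      (if j = (i:ℕ) then (X:ℂ[X])^(ρ i) * x (j+1) else 0) + (if j + 1 = i then - x (j+1) else 0) := by
      intro j
      split_ifs <;> first | omega | simp
    simp only [this, Finset.sum_add_distrib]
    rw [Finset.sum_ite_eq', if_pos (Finset.mem_range.2 i.2), sub_eq_add_neg]
    congr 1
    obtain ⟨i, hi⟩ := i
    rcases i with _ | i
    · simp [h0]
    · simp only [Nat.add_right_cancel_iff]
      rw [Finset.sum_ite_eq', if_pos (Finset.mem_range.2 (by omega))]
  · rw [Fin.sum_univ_eq_sum_range (fun c => (if π c = (i:ℕ) then (X:ℂ[X])^(t c - σ i) else 0) * y c) k]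
    refine Finset.sum_congr rfl fun c _ => ?_
    split_ifs <;> simp

theorem zz_sum (r k : ℕ) (ρ σ t π : ℕ → ℕ) (hσ : ∀ i, σ (i+1) = σ i + ρ i)
    (hπ : ∀ c < k, π c < r ∧ σ (π c) ≤ t c) (x y : ℕ → ℂ[X]) (h0 : x 0 = 0) :
    ∑ i ∈ range r, X^(σ i) * (X^(ρ i) * x (i+1) - x i + ∑ c ∈ range k, (if π c = i then X^(t c - σ i) * y c else 0)) =
      X^(σ r) * x r + ∑ c ∈ range k, X^(t c) * y c := by
  simp only [mul_add, Finset.sum_add_distrib]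
  congr 1
  · have : ∀ i, X^(σ i) * (X^(ρ i) * x (i+1) - x i) = X^(σ (i+1)) * x (i+1) - X^(σ i) * x i := by
      intro i; rw [hσ, pow_add]; ring
    simp only [this]
    rw [Finset.sum_range_sub (fun i => X^(σ i) * x i), h0, mul_zero, sub_zero]
  · simp only [Finset.mul_sum]
    rw [Finset.sum_comm]
    refine Finset.sum_congr rfl fun c hc => ?_
    obtain ⟨h1, h2⟩ := hπ c (Finset.mem_range.1 hc)
    rw [Finset.sum_eq_single (π c)]
    · rw [if_pos rfl, ← mul_assoc, ← pow_add]
      congr 2; omega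
    · intro i _ hi; rw [if_neg (Ne.symm hi), mul_zero]
    · intro h; exact absurd (Finset.mem_range.2 h1) h

theorem zz_inj (r k : ℕ) (ρ σ t π : ℕ → ℕ) (N : ℕ) (hr : 1 ≤ r) (hσ : ∀ i, σ (i+1) = σ i + ρ i)
    (hπ : ∀ c < k, π c < r ∧ σ (π c) ≤ t c) (htk : t k = σ r)
    (ht : ∀ c c', c < c' → t c + N ≤ t c') (x y : ℕ → ℂ[X]) (h0 : x 0 = 0)
    (hx : ∀ i, x i ∈ degreeLT ℂ N) (hy : ∀ c, y c ∈ degreeLT ℂ N)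
    (h : zz r k ρ σ t π *ᵥ (Sum.elim (fun j : Fin r => x (j+1)) (fun c : Fin k => y c)) = 0) :
    (∀ i ≤ r, x i = 0) ∧ (∀ c < k, y c = 0) := by
  have hrow : ∀ i < r, X^(ρ i) * x (i+1) - x i + ∑ c ∈ range k, (if π c = i then X^(t c - σ i) * y c else 0) = 0 := by
    intro i hi
    have := congrFun h ⟨i, hi⟩
    rw [zz_mulVec r k ρ σ t π x y h0] at this
    exact this
  have hs := zz_sum r k ρ σ t π hσ hπ x y h0
  rw [Finset.sum_eq_zero (fun i hi => by rw [hrow i (Finset.mem_range.1 hi), mul_zero])] at hs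
  have hd := disj t N ht k (fun c => if c = k then x r else y c) (fun c => by
    split_ifs
    · exact hx _
    · exact hy _) (by
    rw [Finset.sum_range_succ, if_pos rfl, htk, add_comm, hs]
    congr 1
    refine Finset.sum_congr rfl fun c hc => ?_
    rw [if_neg (by have := Finset.mem_range.1 hc; omega)])
  have hy0 : ∀ c < k, y c = 0 := by
    intro c hc
    have := hd c hc.le
    rwa [if_neg (by omega)] at this
  refine ⟨?_, hy0⟩
  intro i
  induction i with
  | zero => exact fun _ => h0
  | succ i ih =>
    intro hi
    have h1 := hrow i (by omega)
    rw [ih (by omega), Finset.sum_eq_zero (fun c hc => by rw [hy0 c (Finset.mem_range.1 hc), mul_zero, ite_self])] at h1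
    rw [sub_zero, add_zero] at h1
    exact (mul_eq_zero.1 h1).resolve_left (pow_ne_zero _ X_ne_zero)

theorem zz_surj (r k : ℕ) (ρ σ t π : ℕ → ℕ) (N : ℕ) (hσ0 : σ 0 = 0) (hσ : ∀ i, σ (i+1) = σ i + ρ i)
    (hπ : ∀ c < k, π c < r ∧ σ (π c) ≤ t c ∧ t c ≤ σ (π c + 1)) (htk : t k = σ r) (ht0 : t 0 = 0)
    (ht : ∀ c, t (c+1) ≤ t c + N) (w : ℕ → ℂ[X]) (hw : ∀ i, w i ∈ degreeLT ℂ (ρ i + N)) :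
    ∃ x y : ℕ → ℂ[X], x 0 = 0 ∧ (∀ i ≤ r, x i ∈ degreeLT ℂ N) ∧ (∀ c, y c ∈ degreeLT ℂ N) ∧
    ∀ i : Fin r, (zz r k ρ σ t π *ᵥ (Sum.elim (fun j : Fin r => x (j+1)) (fun c : Fin k => y c))) i = w i := by
  have hmono : Monotone σ := monotone_nat_of_le_succ (fun i => by rw [hσ]; omega)
  obtain ⟨Y, hY, hYs⟩ := cover t N ht0 ht k (∑ i ∈ range r, X^(σ i) * w i) (by
    refine Submodule.sum_mem _ fun i hi => ?_
    refine dlt_mono ?_ (X_pow_mul_dlt (σ i) (hw i))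
    have := hmono (show i + 1 ≤ r from Finset.mem_range.1 hi)
    rw [hσ] at this; omega)
  let U : ℕ → ℂ[X] := fun i => w i - ∑ c ∈ range k, (if π c = i then X^(t c - σ i) * Y c else 0)
  have hU : ∀ i, U i ∈ degreeLT ℂ (ρ i + N) := by
    intro i
    refine Submodule.sub_mem _ (hw i) (Submodule.sum_mem _ fun c hc => ?_)
    split_ifs with h
    · refine dlt_mono ?_ (X_pow_mul_dlt _ (hY c))
      obtain ⟨_, h2, h3⟩ := hπ c (Finset.mem_range.1 hc)
      rw [h, hσ] at h3; omega
    · exact Submodule.zero_mem _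
  let S : ℕ → ℂ[X] := fun i => ∑ l ∈ range i, X^(σ l) * U l
  have hSd : ∀ i, S i ∈ degreeLT ℂ (σ i + N) := by
    intro i
    refine Submodule.sum_mem _ fun l hl => ?_
    refine dlt_mono ?_ (X_pow_mul_dlt (σ l) (hU l))
    have := hmono (show l + 1 ≤ i from Finset.mem_range.1 hl)
    rw [hσ] at this; omega
  have hSr : S r = X^(σ r) * Y k := by
    have h1 := zz_sum r k ρ σ t π hσ (fun c hc => ⟨(hπ c hc).1, (hπ c hc).2.1⟩) (fun _ => 0) Y rfl
    simp only [mul_zero, sub_zero, zero_add] at h1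
    simp only [S, U, mul_sub, Finset.sum_sub_distrib]
    rw [h1, ← hYs, Finset.sum_range_succ, htk]; ring
  have hdvd : ∀ i, i ≤ r → X^(σ i) ∣ S i := by
    intro i hi
    have h1 : S r = S i + ∑ l ∈ Finset.Ico i r, X^(σ l) * U l :=
      (Finset.sum_range_add_sum_Ico _ hi).symm
    have h2 : X^(σ i) ∣ ∑ l ∈ Finset.Ico i r, X^(σ l) * U l :=
      Finset.dvd_sum fun l hl => Dvd.dvd.mul_right (pow_dvd_pow _ (hmono (Finset.mem_Ico.1 hl).1)) _
    have h3 : X^(σ i) ∣ S r := by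
      rw [hSr]; exact Dvd.dvd.mul_right (pow_dvd_pow _ (hmono hi)) _
    rw [h1] at h3
    exact (dvd_add_left h2).1 h3
  choose! z hz using hdvd
  have hz0 : z 0 = 0 := by
    have := hz 0 (by omega)
    simp only [S, Finset.range_zero, Finset.sum_empty, hσ0, pow_zero, one_mul] at this
    exact this.symm
  refine ⟨z, Y, hz0, ?_, hY, ?_⟩
  · intro i hi
    apply X_pow_mul_dlt_iff (k := σ i)
    rw [← hz i hi]; exact hSd i
  · intro i
    rw [zz_mulVec r k ρ σ t π z Y hz0]
    have h1 : X^(σ i) * (X^(ρ i) * z (i+1) - z i) = X^(σ i) * U i := by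
      have e : S (i+1) = S i + X^(σ i) * U i := Finset.sum_range_succ _ _
      rw [hz _ i.2, hz _ i.2.le, hσ, pow_add] at e
      linear_combination e
    have h2 := mul_left_cancel₀ (pow_ne_zero _ X_ne_zero) h1
    rw [h2]
    simp only [U]; ring

theorem exists_R0 {r n : ℕ} (hr : 1 ≤ r) (hrn : r < n) (ρ : Fin r → ℕ) (α s : ℕ) (hs : s < n - r)
    (ha : ∑ i, ρ i = (n-r) * α + s) :
    ∃ R : Matrix (Fin r) (Fin n) ℂ[X], (∀ i c, R i c ∈ degreeLT ℂ (ρ i + 1)) ∧ InjN R α ∧ SurjN R ρ (α+1) := by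
  obtain ⟨k, rfl⟩ : ∃ k, n = r + k := ⟨n - r, by omega⟩
  rw [Nat.add_sub_cancel_left] at *
  let ρ' : ℕ → ℕ := fun i => if h : i < r then ρ ⟨i, h⟩ else 0
  have hρ' : ∀ i : Fin r, ρ' i = ρ i := fun i => by simp [ρ']
  let σ : ℕ → ℕ := fun i => ∑ l ∈ range i, ρ' l
  have hσ0 : σ 0 = 0 := rfl
  have hσ : ∀ i, σ (i+1) = σ i + ρ' i := fun i => Finset.sum_range_succ _ _
  let t : ℕ → ℕ := fun c => c * α + min c s
  have hts : ∀ c, t (c+1) = t c + α + (min (c+1) s - min c s) := by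
    intro c; simp only [t]; rw [add_mul]; omega
  have htm : Monotone t := monotone_nat_of_le_succ (fun i => by rw [hts]; omega)
  have htk : t k = σ r := by
    simp only [t, σ]
    rw [← Fin.sum_univ_eq_sum_range, Finset.sum_congr rfl (fun i _ => hρ' i), ha, min_eq_right hs.le]
  have hex : ∀ c, c < k → ∃ i, i < r ∧ σ i ≤ t c ∧ t c ≤ σ (i+1) := fun c hc =>
    exists_row σ hσ0 r hr (t c) (by rw [← htk]; exact htm hc.le)
  choose! π hπ using hex
  have hdis : ∀ c c', c < c' → t c + α ≤ t c' := fun c c' h => by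
    have h1 := htm (show c + 1 ≤ c' from h)
    rw [hts] at h1; omega
  let e : Fin (r + k) ≃ Fin r ⊕ Fin k := finSumFinEquiv.symm
  have hmul : ∀ v : Fin (r+k) → ℂ[X],
      (zz r k ρ' σ t π).submatrix id e *ᵥ v = zz r k ρ' σ t π *ᵥ (v ∘ e.symm) := by
    intro v
    rw [Matrix.submatrix_mulVec_equiv]
    simp
  refine ⟨(zz r k ρ' σ t π).submatrix id e, ?_, ?_, ?_⟩
  · intro i c
    have key : ∀ c : Fin r ⊕ Fin k, zz r k ρ' σ t π i c ∈ degreeLT ℂ (ρ i + 1) := by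
      have hX : ∀ u, u ≤ ρ i → (X : ℂ[X])^u ∈ degreeLT ℂ (ρ i + 1) := by
        intro u hu
        rw [mem_dlt]; intro j hj; rw [coeff_X_pow, if_neg (by omega)]
      rintro (c | c)
      · simp only [zz, Matrix.of_apply, Sum.elim_inl]
        split_ifs
        · exact hX _ (hρ' i).le
        · exact Submodule.neg_mem _ (by simpa using hX 0 (by omega))
        · exact Submodule.zero_mem _
      · simp only [zz, Matrix.of_apply, Sum.elim_inr]
        split_ifs with h
        · apply hX
          obtain ⟨_, h2, h3⟩ := hπ c c.2
          rw [h, hσ, hρ'] at h3; omega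
        · exact Submodule.zero_mem _
    exact key (e c)
  · intro v hv h
    rw [hmul] at h
    let x : ℕ → ℂ[X] := fun i => if h : 1 ≤ i ∧ i ≤ r then v (e.symm (Sum.inl ⟨i-1, by omega⟩)) else 0
    let y : ℕ → ℂ[X] := fun c => if h : c < k then v (e.symm (Sum.inr ⟨c, h⟩)) else 0
    have hve : v ∘ e.symm = Sum.elim (fun j : Fin r => x (j+1)) (fun c : Fin k => y c) := by
      funext c
      rcases c with c | c
      · simp only [Function.comp, Sum.elim_inl, x]
        rw [dif_pos ⟨by omega, c.2⟩]; rfl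
      · simp only [Function.comp, Sum.elim_inr, y]
        rw [dif_pos c.2]
    rw [hve] at h
    obtain ⟨h1, h2⟩ := zz_inj r k ρ' σ t π α hr hσ (fun c hc => ⟨(hπ c hc).1, (hπ c hc).2.1⟩) htk hdis x y
      (by simp [x]) (fun i => by
        simp only [x]; split_ifs
        · exact hv _
        · exact Submodule.zero_mem _) (fun i => by
        simp only [y]; split_ifs
        · exact hv _
        · exact Submodule.zero_mem _) h
    have h3 : v ∘ e.symm = 0 := by
      rw [hve]
      funext c
      rcases c with c | c
      · exact h1 _ c.2
      · exact h2 _ c.2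
    funext c
    have := congrFun h3 (e c)
    simpa using this
  · intro w hw
    let w' : ℕ → ℂ[X] := fun i => if h : i < r then w ⟨i, h⟩ else 0
    obtain ⟨x, y, h0, hx, hy, hxy⟩ := zz_surj r k ρ' σ t π (α+1) hσ0 hσ hπ htk (by simp [t])
      (fun c => by rw [hts]; omega) w' (fun i => by
        simp only [w', ρ']; split_ifs
        · exact hw _
        · exact Submodule.zero_mem _)
    refine ⟨(Sum.elim (fun j : Fin r => x (j+1)) (fun c : Fin k => y c)) ∘ e, ?_, ?_⟩
    · intro c
      have key : ∀ c : Fin r ⊕ Fin k, Sum.elim (fun j : Fin r => x (j+1)) (fun c : Fin k => y c) c ∈ degreeLT ℂ (α + 1) := by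
        rintro (c | c)
        · exact hx _ c.2
        · exact hy _
      exact key (e c)
    · rw [hmul, Function.comp_assoc, Equiv.self_comp_symm, Function.comp_id]
      funext i
      rw [hxy]
      simp [w']

end PartH

section PartI
open Polynomial

theorem generic_inj {V W : Type} [AddCommGroup V] [Module ℂ V] [AddCommGroup W] [Module ℂ W]
    [FiniteDimensional ℂ V] (f g : V →ₗ[ℂ] W) (hg : Function.Injective g) :
    {z : ℂ | ¬ Function.Injective (f + z • g)}.Finite := by
  obtain ⟨h, hh⟩ := g.exists_leftInverse_of_injective (LinearMap.ker_eq_bot.2 hg)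
  refine (Module.End.finite_spectrum (-(h ∘ₗ f))).subset fun z hz => ?_
  rw [spectrum.mem_iff]
  intro hu
  apply hz
  have e : algebraMap ℂ (Module.End ℂ V) z - -(h ∘ₗ f) = h ∘ₗ (f + z • g) := by
    rw [LinearMap.comp_add, LinearMap.comp_smul, hh, sub_neg_eq_add, add_comm]; rfl
  rw [e, Module.End.isUnit_iff] at hu
  exact Function.Injective.of_comp hu.1

theorem generic_surj {V W : Type} [AddCommGroup V] [Module ℂ V] [AddCommGroup W] [Module ℂ W]
    [FiniteDimensional ℂ W] (f g : V →ₗ[ℂ] W) (hg : Function.Surjective g) :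
    {z : ℂ | ¬ Function.Surjective (f + z • g)}.Finite := by
  obtain ⟨h, hh⟩ := g.exists_rightInverse_of_surjective (LinearMap.range_eq_top.2 hg)
  refine (Module.End.finite_spectrum (-(f ∘ₗ h))).subset fun z hz => ?_
  rw [spectrum.mem_iff]
  intro hu
  apply hz
  have e : algebraMap ℂ (Module.End ℂ W) z - -(f ∘ₗ h) = (f + z • g) ∘ₗ h := by
    rw [LinearMap.add_comp, LinearMap.smul_comp, hh, sub_neg_eq_add, add_comm]; rfl
  rw [e, Module.End.isUnit_iff] at hu
  exact Function.Surjective.of_comp hu.2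

theorem InjN_iff {r n : ℕ} (R : Matrix (Fin r) (Fin n) ℂ[X]) (ρ : Fin r → ℕ)
    (hR : ∀ i c, R i c ∈ degreeLT ℂ (ρ i + 1)) (N : ℕ) :
    InjN R N ↔ Function.Injective (SylN R ρ hR N) := by
  rw [← LinearMap.ker_eq_bot, LinearMap.ker_eq_bot']
  constructor
  · intro h v hv
    have := h (fun c => v c) (fun c => (v c).2) (by
      funext i
      rw [← SylN_val R ρ hR N v i, hv]; rfl)
    funext c
    exact Subtype.ext (congrFun this c)
  · intro h v hv hv'
    have := h (fun c => ⟨v c, hv c⟩) (by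
      funext i
      apply Subtype.ext
      rw [SylN_val]
      exact congrFun hv' i)
    funext c
    exact congrArg Subtype.val (congrFun this c)

theorem SurjN_iff {r n : ℕ} (R : Matrix (Fin r) (Fin n) ℂ[X]) (ρ : Fin r → ℕ)
    (hR : ∀ i c, R i c ∈ degreeLT ℂ (ρ i + 1)) (N : ℕ) :
    SurjN R ρ N ↔ Function.Surjective (SylN R ρ hR N) := by
  constructor
  · intro hS w
    obtain ⟨v, hv, hvw⟩ := hS (fun i => w i) (fun i => (w i).2)
    refine ⟨fun c => ⟨v c, hv c⟩, ?_⟩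
    funext i
    apply Subtype.ext
    rw [SylN_val]
    exact congrFun hvw i
  · intro h w hw
    obtain ⟨v, hv⟩ := h (fun i => ⟨w i, hw i⟩)
    refine ⟨fun c => v c, fun c => (v c).2, ?_⟩
    funext i
    rw [← SylN_val R ρ hR N v i, hv]

theorem pert_dlt {r n : ℕ} {R R0 : Matrix (Fin r) (Fin n) ℂ[X]} {ρ : Fin r → ℕ}
    (hR : ∀ i c, R i c ∈ degreeLT ℂ (ρ i + 1)) (hR0 : ∀ i c, R0 i c ∈ degreeLT ℂ (ρ i + 1)) (z : ℂ) :
    ∀ i c, (R + z • R0) i c ∈ degreeLT ℂ (ρ i + 1) := fun i c =>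
  Submodule.add_mem _ (hR i c) (Submodule.smul_mem _ _ (hR0 i c))

theorem SylN_pert {r n : ℕ} {R R0 : Matrix (Fin r) (Fin n) ℂ[X]} {ρ : Fin r → ℕ}
    (hR : ∀ i c, R i c ∈ degreeLT ℂ (ρ i + 1)) (hR0 : ∀ i c, R0 i c ∈ degreeLT ℂ (ρ i + 1)) (z : ℂ) (N : ℕ) :
    SylN (R + z • R0) ρ (pert_dlt hR hR0 z) N = SylN R ρ hR N + z • SylN R0 ρ hR0 N := by
  refine LinearMap.ext fun v => ?_
  funext i
  apply Subtype.ext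
  rw [SylN_val, Matrix.add_mulVec, Matrix.smul_mulVec]
  rfl

/-- generic perturbation -/
theorem generic_R {r n : ℕ} (hr : 1 ≤ r) (hrn : r < n) (ρ : Fin r → ℕ) (α s : ℕ) (hs : s < n - r)
    (ha : ∑ i, ρ i = (n-r) * α + s) (R : Matrix (Fin r) (Fin n) ℂ[X]) (hR : ∀ i c, R i c ∈ degreeLT ℂ (ρ i + 1)) :
    ∃ R0 : Matrix (Fin r) (Fin n) ℂ[X], (∀ i c, R0 i c ∈ degreeLT ℂ (ρ i + 1)) ∧
      {z : ℂ | ¬ (InjN (R + z • R0) α ∧ SurjN (R + z • R0) ρ (α+1))}.Finite := by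
  obtain ⟨R0, h0, h1, h2⟩ := exists_R0 hr hrn ρ α s hs ha
  refine ⟨R0, h0, ?_⟩
  rw [InjN_iff R0 ρ h0] at h1
  rw [SurjN_iff R0 ρ h0] at h2
  refine ((generic_inj (SylN R ρ hR α) _ h1).union (generic_surj (SylN R ρ hR (α+1)) _ h2)).subset ?_
  intro z hz
  by_contra hc
  simp only [Set.mem_union, Set.mem_ofPred_eq, not_or, not_not] at hc
  apply hz
  rw [InjN_iff _ ρ (pert_dlt hR h0 z), SurjN_iff _ ρ (pert_dlt hR h0 z), SylN_pert, SylN_pert]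
  exact hc

/-- coefficients of a polynomial matrix -/
noncomputable def toPol (d : ℕ) {m n : ℕ} (M : Matrix (Fin m) (Fin n) ℂ[X]) : Pol d m n :=
  fun k => Matrix.of fun i j => (M i j).coeff k

theorem PP_toPol {d m n : ℕ} (M : Matrix (Fin m) (Fin n) ℂ[X]) (hM : ∀ i j, M i j ∈ degreeLT ℂ (d+1)) :
    PP (toPol d M) = M := by
  ext1 i j
  simp only [PP, toPol, Matrix.of_apply]
  rw [Fin.sum_univ_eq_sum_range (fun k => C ((M i j).coeff k) * X^k) (d+1)]
  conv_rhs => rw [as_sum_range_C_mul_X_pow' (n := d+1) (p := M i j) (by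
    have := hM i j
    rw [mem_dlt] at this
    have h2 : (M i j).natDegree ≤ d := natDegree_le_iff_coeff_eq_zero.2 (fun k hk => this k hk)
    omega)]

theorem toPol_PP {d m n : ℕ} (P : Pol d m n) : toPol d (PP P) = P := by
  funext k
  ext1 i j
  simp only [PP, toPol, Matrix.of_apply, finsetSum_coeff, coeff_C_mul_X_pow]
  rw [Finset.sum_eq_single k]
  · simp
  · intro b _ hb
    rw [if_neg]
    intro h; exact hb (Fin.ext h.symm)
  · simp

theorem strict_of_factor {m n d r : ℕ} (hd : 1 ≤ d) (hrn : r < n) (hrm : r < m)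
    (L : Matrix (Fin m) (Fin r) ℂ[X]) (R : Matrix (Fin r) (Fin n) ℂ[X]) (ρ : Fin r → ℕ) (hρ : ∀ i, ρ i ≤ d)
    (hR : ∀ i c, R i c ∈ degreeLT ℂ (ρ i + 1)) (hL : ∀ i c, Lᵀ i c ∈ degreeLT ℂ (d - ρ i + 1))
    (a : ℕ) (ha : ∑ i, ρ i = a)
    (h1 : InjN R (a / (n-r))) (h2 : SurjN R ρ (a / (n-r) + 1))
    (h3 : InjN Lᵀ ((r*d-a) / (m-r))) (h4 : SurjN Lᵀ (fun i => d - ρ i) ((r*d-a) / (m-r) + 1)) :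
    StrictEquiv (comp m n d (toPol d (L * R))) (Ga m n d r a) := by
  have hsum' : ∑ i, (d - ρ i) + a = r * d := by
    rw [← ha, ← Finset.sum_add_distrib, Finset.sum_congr rfl (fun i _ => Nat.sub_add_cancel (hρ i))]
    simp
  have hPP : PP (toPol d (L * R)) = L * R := by
    apply PP_toPol
    intro i j
    rw [Matrix.mul_apply]
    refine Submodule.sum_mem _ fun k _ => ?_
    have h5 := mul_dlt (hL k i) (hR k j)
    rw [show d - ρ k + 1 + ρ k = d + 1 by have := hρ k; omega] at h5
    exact h5
  obtain ⟨b, ε, H, hε⟩ := propB hrn R ρ hR (a / (n-r)) (a % (n-r)) (Nat.mod_lt _ (by omega))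
    (by rw [ha]; exact (Nat.div_add_mod _ _).symm) h1 h2
  obtain ⟨k, η, H', hη⟩ := propB hrm Lᵀ (fun i => d - ρ i) hL ((r*d-a) / (m-r)) ((r*d-a) % (m-r))
    (Nat.mod_lt _ (by omega))
    (by rw [Nat.div_add_mod]; omega) h3 h4
  have hk1 : LinearMap.ker (PP (toPol d (L*R))).mulVecLin = LinearMap.ker R.mulVecLin := by
    rw [hPP]; exact ker_mul L R _ _ (Nat.le_add_left 1 _) h4
  have hk2 : LinearMap.ker (PP (toPol d (L*R)))ᵀ.mulVecLin = LinearMap.ker Lᵀ.mulVecLin := by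
    rw [hPP, Matrix.transpose_mul]; exact ker_mul Rᵀ Lᵀ ρ (a / (n-r) + 1) (Nat.le_add_left 1 _) (by rw [Matrix.transpose_transpose]; exact h2)
  rw [← hk1] at H
  rw [← hk2] at H'
  have cnt : ∀ (s k α : ℕ) (hs : s ≤ k) (ε : Fin (s + (k - s)) → ℕ)
      (hε : ∀ j, ε j = if (j : ℕ) < s then α + 1 else α), ∑ j, ε j = k * α + s := by
    intro s k α hs ε hε
    rw [Finset.sum_congr rfl (fun j _ => hε j), Fin.sum_univ_add]
    simp only [Fin.val_castAdd, Fin.is_lt, if_true, Fin.val_natAdd, Nat.not_lt.2 (Nat.le_add_right _ _), if_false,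
      Finset.sum_const, Finset.card_univ, Fintype.card_fin, smul_eq_mul]
    obtain ⟨k, rfl⟩ := Nat.exists_eq_add_of_le hs
    rw [Nat.add_sub_cancel_left]; ring
  have e1 := cnt _ _ _ (Nat.mod_lt _ (by omega)).le ε hε
  have e2 := cnt _ _ _ (Nat.mod_lt _ (by omega)).le η hη
  rw [Nat.div_add_mod] at e1 e2
  have hm1 : a % (n-r) < n - r := Nat.mod_lt _ (by omega)
  have hm2 : (r*d-a) % (m-r) < m - r := Nat.mod_lt _ (by omega)
  have hlin : n * d = r * d + (n - r) * (d - 1) + (n - r) := by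
    obtain ⟨n, rfl⟩ := Nat.exists_eq_add_of_lt hrn
    obtain ⟨d, rfl⟩ := Nat.exists_eq_add_of_le hd
    rw [show r + n + 1 - r = n + 1 by omega, Nat.add_sub_cancel_left]; ring
  have hlin2 : n * d = n * (d - 1) + n := by
    obtain ⟨d, rfl⟩ := Nat.exists_eq_add_of_le hd
    rw [Nat.add_sub_cancel_left]; ring
  refine strict_of_RB _ hd _ _ _ _ _ _ H H' hε hη ?_ ?_
  · simp only [Finset.sum_add_distrib, Finset.sum_const, Finset.card_univ, Fintype.card_fin, smul_eq_mul, e1, e2]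
    rw [show a % (n - r) + (n - r - a % (n - r)) = n - r by omega, show (r*d-a) % (m-r) + (m - r - (r*d-a) % (m-r)) = m - r by omega]
    omega
  · simp only [Finset.sum_add_distrib, Finset.sum_const, Finset.card_univ, Fintype.card_fin, smul_eq_mul, e1, e2]
    rw [show a % (n - r) + (n - r - a % (n - r)) = n - r by omega]
    omega

theorem factor_mem_closure {m n d r : ℕ} (hd : 1 ≤ d) (hr : 1 ≤ r) (hrn : r < n) (hrm : r < m)
    (L : Matrix (Fin m) (Fin r) ℂ[X]) (R : Matrix (Fin r) (Fin n) ℂ[X]) (ρ : Fin r → ℕ) (hρ : ∀ i, ρ i ≤ d)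
    (hR : ∀ i c, R i c ∈ degreeLT ℂ (ρ i + 1)) (hL : ∀ i c, Lᵀ i c ∈ degreeLT ℂ (d - ρ i + 1)) :
    ∃ a ≤ r * d, toPol d (L * R) ∈ closure {P : Pol d m n | StrictEquiv (comp m n d P) (Ga m n d r a)} := by
  obtain ⟨a, ha⟩ : ∃ a, a = ∑ i, ρ i := ⟨_, rfl⟩
  have hsum' : ∑ i, (d - ρ i) + a = r * d := by
    rw [ha, ← Finset.sum_add_distrib, Finset.sum_congr rfl (fun i _ => Nat.sub_add_cancel (hρ i))]
    simp
  refine ⟨a, by omega, ?_⟩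
  obtain ⟨R0, hR0, hfin⟩ := generic_R hr hrn ρ (a / (n-r)) (a % (n-r)) (Nat.mod_lt _ (by omega))
    (by rw [← ha]; exact (Nat.div_add_mod _ _).symm) R hR
  obtain ⟨L0, hL0, hfin'⟩ := generic_R hr hrm (fun i => d - ρ i) ((r*d-a) / (m-r)) ((r*d-a) % (m-r))
    (Nat.mod_lt _ (by omega)) (by rw [Nat.div_add_mod]; omega) Lᵀ hL
  let F : ℂ → Pol d m n := fun z => toPol d (L * R) + z • toPol d (L * R0 + L0ᵀ * R) + (z*z) • toPol d (L0ᵀ * R0)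
  have hF : ∀ z, F z = toPol d ((L + z • L0ᵀ) * (R + z • R0)) := by
    intro z
    have e : (L + z • L0ᵀ) * (R + z • R0) = L * R + z • (L * R0 + L0ᵀ * R) + (z*z) • (L0ᵀ * R0) := by
      simp only [Matrix.add_mul, Matrix.mul_add, Matrix.smul_mul, Matrix.mul_smul, smul_add, mul_smul]
      abel
    rw [e]
    funext k
    ext1 i j
    simp [F, toPol, mul_add]
  have hcont : Continuous F := by
    apply Continuous.add
    · exact continuous_const.add (continuous_id.smul continuous_const)
    · exact (continuous_id.mul continuous_id).smul continuous_const
  have hF0 : F 0 = toPol d (L * R) := by simp [F]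
  have hd' : Dense ({z : ℂ | ¬ (InjN (R + z • R0) (a / (n-r)) ∧ SurjN (R + z • R0) ρ (a / (n-r)+1))} ∪
      {z : ℂ | ¬ (InjN (Lᵀ + z • L0) ((r*d-a) / (m-r)) ∧ SurjN (Lᵀ + z • L0) (fun i => d - ρ i) ((r*d-a) / (m-r)+1))})ᶜ :=
    Set.Countable.dense_compl ℂ (Set.Finite.countable (hfin.union hfin'))
  rw [← hF0]
  have h0 := hd' 0
  refine closure_mono ?_ (image_closure_subset_closure_image hcont (Set.mem_image_of_mem F h0))
  rintro _ ⟨z, hz, rfl⟩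
  simp only [Set.mem_compl_iff, Set.mem_union, Set.mem_ofPred_eq, not_or, not_not] at hz
  obtain ⟨⟨h1, h2⟩, h3, h4⟩ := hz
  show StrictEquiv (comp m n d (F z)) _
  rw [hF]
  have ht : (L + z • L0ᵀ)ᵀ = Lᵀ + z • L0 := by
    rw [Matrix.transpose_add, Matrix.transpose_smul, Matrix.transpose_transpose]
  refine strict_of_factor hd hrn hrm _ _ ρ hρ (pert_dlt hR hR0 z) ?_ a ha.symm h1 h2 ?_ ?_
  · rw [ht]; exact pert_dlt hL hL0 z
  · rw [ht]; exact h3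
  · rw [ht]; exact h4

end PartI

section PartJ
open Polynomial

theorem ratMatrix_eq {m n d : ℕ} (P : Pol d m n) :
    ratMatrix P = (PP P).map (algebraMap ℂ[X] (RatFunc ℂ)) := by
  ext1 i j
  simp only [ratMatrix, PP, Matrix.map_apply, Matrix.of_apply, map_sum, map_mul, map_pow,
    RatFunc.algebraMap_C, RatFunc.algebraMap_X]

theorem PP_dlt {m n d : ℕ} (P : Pol d m n) (i j) : PP P i j ∈ degreeLT ℂ (d+1) := by
  rw [mem_dlt]
  intro k hk
  simp only [PP, Matrix.of_apply, finsetSum_coeff, coeff_C_mul_X_pow]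
  refine Finset.sum_eq_zero fun b _ => ?_
  rw [if_neg (by have := b.2; omega)]

theorem RB_card {m n d : ℕ} (P : Pol d m n) {κ : Type} [Fintype κ] {b : κ → Fin n → ℂ[X]} {ε : κ → ℕ}
    (H : RB (Submodule.span ℂ[X] (Set.range (PP P).row)) b ε) : Fintype.card κ ≤ nrank P := by
  let φ := algebraMap ℂ[X] (RatFunc ℂ)
  let b' : κ → Fin n → RatFunc ℂ := fun j c => φ (b j c)
  have h1 : LinearIndependent ℂ[X] b' := by
    rw [Fintype.linearIndependent_iff]
    intro q hq
    apply H.indep q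
    funext c
    apply RatFunc.algebraMap_injective ℂ
    have := congrFun hq c
    simp only [b', Finset.sum_apply, Pi.smul_apply, Algebra.smul_def, Pi.zero_apply] at this
    simp only [Finset.sum_apply, Pi.smul_apply, smul_eq_mul, map_sum, map_mul, Pi.zero_apply, map_zero]
    exact this
  have h2 : LinearIndependent (RatFunc ℂ) b' := (LinearIndependent.iff_fractionRing ℂ[X] (RatFunc ℂ)).1 h1
  have h3 : ∀ j, b' j ∈ Submodule.span (RatFunc ℂ) (Set.range (ratMatrix P).row) := by
    intro j
    obtain ⟨q, hq⟩ := (Submodule.mem_span_range_iff_exists_fun ℂ[X]).1 (H.mem j)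
    refine (Submodule.mem_span_range_iff_exists_fun (RatFunc ℂ)).2 ⟨fun i => φ (q i), ?_⟩
    funext c
    simp only [b']
    rw [← hq, ratMatrix_eq]
    simp only [Finset.sum_apply, Pi.smul_apply, smul_eq_mul, map_sum, map_mul, Matrix.row, Matrix.map_apply]
    rfl
  unfold nrank
  rw [Matrix.rank_eq_finrank_span_row]
  have h4 : LinearIndependent (RatFunc ℂ) (fun j => (⟨b' j, h3 j⟩ : Submodule.span (RatFunc ℂ) (Set.range (ratMatrix P).row))) :=
    LinearIndependent.of_comp (Submodule.subtype _) h2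
  exact h4.fintype_card_le_finrank

theorem propD {m n d r : ℕ} (P : Pol d m n) (hP : nrank P ≤ r) :
    ∃ (L : Matrix (Fin m) (Fin r) ℂ[X]) (R : Matrix (Fin r) (Fin n) ℂ[X]) (ρ : Fin r → ℕ),
      (∀ i, ρ i ≤ d) ∧ (∀ i c, R i c ∈ degreeLT ℂ (ρ i + 1)) ∧ (∀ i c, Lᵀ i c ∈ degreeLT ℂ (d - ρ i + 1)) ∧
      PP P = L * R := by
  classical
  obtain ⟨κ, _, b, ε, H⟩ := exists_RB (Submodule.span ℂ[X] (Set.range (PP P).row))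
  have hc := (RB_card P H).trans hP
  obtain ⟨f⟩ : Nonempty (κ ↪ Fin r) := Function.Embedding.nonempty_of_card_le (by simpa using hc)
  have hq : ∀ i, ∃ q : κ → ℂ[X], (PP P).row i = ∑ j, q j • b j ∧ ∀ j, q j ∈ degreeLT ℂ (d + 1 - ε j) := fun i =>
    H.pred _ (Submodule.subset_span ⟨i, rfl⟩) (d+1) (fun c => PP_dlt P i c)
  choose q hq hqd using hq
  have hq0 : ∀ i j, ¬ (ε j ≤ d) → q i j = 0 := by
    intro i j h
    ext k
    exact mem_dlt.1 (hqd i j) k (by omega)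
  let ρ : Fin r → ℕ := Function.extend f (fun j => if ε j ≤ d then ε j else 0) 0
  let R : Matrix (Fin r) (Fin n) ℂ[X] := Matrix.of (Function.extend f (fun j => if ε j ≤ d then b j else 0) 0)
  let Lt : Matrix (Fin r) (Fin m) ℂ[X] := Matrix.of (Function.extend f (fun j i => q i j) 0)
  have key : ∀ i : Fin r, (∃ j, f j = i) ∨ (ρ i = 0 ∧ R i = 0 ∧ Lt i = 0) := by
    intro i
    by_cases h : ∃ j, f j = i
    · exact Or.inl h
    · refine Or.inr ⟨?_, ?_, ?_⟩
      · exact Function.extend_apply' (fun j => if ε j ≤ d then ε j else 0) (0 : Fin r → ℕ) i h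
      · exact Function.extend_apply' (fun j => if ε j ≤ d then b j else 0) (0 : Fin r → Fin n → ℂ[X]) i h
      · exact Function.extend_apply' (fun j i => q i j) (0 : Fin r → Fin m → ℂ[X]) i h
  have eρ : ∀ j, ρ (f j) = if ε j ≤ d then ε j else 0 := fun j => f.injective.extend_apply _ _ _
  have eR : ∀ j, R (f j) = if ε j ≤ d then b j else 0 := fun j =>
    f.injective.extend_apply (fun j => if ε j ≤ d then b j else 0) 0 j
  have eL : ∀ j i, Lt (f j) i = q i j := fun j i =>
    congrFun (f.injective.extend_apply (fun j i => q i j) 0 j) i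
  refine ⟨Ltᵀ, R, ρ, ?_, ?_, ?_, ?_⟩
  · intro i
    rcases key i with ⟨j, rfl⟩ | ⟨h, -, -⟩
    · rw [eρ]; split_ifs <;> omega
    · rw [h]; omega
  · intro i c
    rcases key i with ⟨j, rfl⟩ | ⟨-, h, -⟩
    · rw [eρ, eR]; split_ifs
      · exact H.deg j c
      · exact Submodule.zero_mem _
    · rw [h]; exact Submodule.zero_mem _
  · intro i c
    rw [Matrix.transpose_transpose]
    rcases key i with ⟨j, rfl⟩ | ⟨-, -, h⟩
    · rw [eρ, eL]
      by_cases hj : ε j ≤ d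
      · rw [if_pos hj]
        have := hqd c j
        rwa [show d + 1 - ε j = d - ε j + 1 by omega] at this
      · rw [hq0 c j hj]; exact Submodule.zero_mem _
    · rw [h]; exact Submodule.zero_mem _
  · ext1 i c
    rw [Matrix.mul_apply]
    have h1 := congrFun (hq i) c
    simp only [Matrix.row, Finset.sum_apply, Pi.smul_apply, smul_eq_mul] at h1
    rw [h1]
    refine Fintype.sum_of_injective f f.injective _ _ ?_ ?_
    · intro l hl
      rcases key l with h | ⟨-, h, -⟩
      · exact absurd h hl
      · rw [h, Pi.zero_apply, mul_zero]
    · intro j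
      rw [Matrix.transpose_apply, eL, eR]
      by_cases hj : ε j ≤ d
      · rw [if_pos hj]
      · rw [hq0 i j hj, zero_mul, zero_mul]

theorem exists_rows {K : Type} [Field K] {p q k : ℕ} (A : Matrix (Fin p) (Fin q) K) (hk : k ≤ A.rank) :
    ∃ f : Fin k → Fin p, LinearIndependent K (A.submatrix f id).row := by
  rw [Matrix.rank_eq_finrank_span_row] at hk
  obtain ⟨g, hg, -, hi⟩ := Submodule.exists_fun_fin_finrank_span_eq K (Set.range A.row)
  choose f hf using hg
  refine ⟨fun i => f (Fin.castLE hk i), ?_⟩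
  have : (A.submatrix (fun i => f (Fin.castLE hk i)) id).row = g ∘ Fin.castLE hk := by
    funext i
    rw [Function.comp, ← hf]; rfl
  rw [this]
  exact hi.comp _ (Fin.castLE_injective hk)

theorem exists_minor {K : Type} [Field K] {p q k : ℕ} (A : Matrix (Fin p) (Fin q) K) (hk : k ≤ A.rank) :
    ∃ (f : Fin k → Fin p) (g : Fin k → Fin q), (A.submatrix f g).det ≠ 0 := by
  obtain ⟨f, hf⟩ := exists_rows A hk
  have h1 : (A.submatrix f id).rank = k := by rw [hf.rank_matrix]; simp
  obtain ⟨g, hg⟩ := exists_rows (k := k) (A.submatrix f id)ᵀ (by rw [Matrix.rank_transpose, h1])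
  refine ⟨f, g, ?_⟩
  rw [Matrix.linearIndependent_rows_iff_isUnit, Matrix.isUnit_iff_isUnit_det] at hg
  have : (A.submatrix f id)ᵀ.submatrix g id = (A.submatrix f g)ᵀ := rfl
  rw [this, Matrix.det_transpose] at hg
  exact hg.ne_zero

theorem nrank_le_iff {m n d r : ℕ} (P : Pol d m n) : nrank P ≤ r ↔
    ∀ (f : Fin (r+1) → Fin m) (g : Fin (r+1) → Fin n) (z : ℂ),
      (((∑ k : Fin (d+1), z^(k:ℕ) • P k).submatrix f g).det) = 0 := by
  have hdet : ∀ (f : Fin (r+1) → Fin m) (g : Fin (r+1) → Fin n),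
      ((ratMatrix P).submatrix f g).det = algebraMap ℂ[X] (RatFunc ℂ) (((PP P).submatrix f g).det) := by
    intro f g
    rw [RingHom.map_det, ratMatrix_eq]; rfl
  have hev : ∀ (f : Fin (r+1) → Fin m) (g : Fin (r+1) → Fin n) (z : ℂ),
      (((PP P).submatrix f g).det).eval z = ((∑ k : Fin (d+1), z^(k:ℕ) • P k).submatrix f g).det := by
    intro f g z
    rw [← Polynomial.coe_evalRingHom, RingHom.map_det]
    congr 1
    ext1 i j
    simp only [RingHom.mapMatrix_apply, Matrix.map_apply, Matrix.submatrix_apply, PP, Matrix.of_apply,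
      Polynomial.coe_evalRingHom, Polynomial.eval_finsetSum, Polynomial.eval_mul, Polynomial.eval_C, Polynomial.eval_pow, Polynomial.eval_X,
      Matrix.sum_apply, Matrix.smul_apply, smul_eq_mul]
    exact Finset.sum_congr rfl fun k _ => mul_comm _ _
  constructor
  · intro h f g z
    rw [← hev]
    by_contra hne
    have h1 : ((ratMatrix P).submatrix f g).det ≠ 0 := by
      rw [hdet]
      intro h0
      rw [map_eq_zero_iff _ (RatFunc.algebraMap_injective ℂ)] at h0
      rw [h0] at hne
      simp at hne
    have h2 : ((ratMatrix P).submatrix f g).rank = r + 1 := by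
      rw [Matrix.rank_of_isUnit _ ((Matrix.isUnit_iff_isUnit_det _).2 (isUnit_iff_ne_zero.2 h1))]; simp
    have h3 := Matrix.rank_submatrix_le (ratMatrix P) f g
    unfold nrank at h
    omega
  · intro h
    by_contra hlt
    obtain ⟨f, g, hfg⟩ := exists_minor (k := r + 1) (ratMatrix P) (by unfold nrank at hlt; omega)
    apply hfg
    rw [hdet]
    have : ((PP P).submatrix f g).det = 0 := by
      apply Polynomial.funext
      intro z
      rw [hev, h, Polynomial.eval_zero]
    rw [this, map_zero]

theorem nrank_closed (m n d r : ℕ) : IsClosed {P : Pol d m n | nrank P ≤ r} := by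
  simp only [nrank_le_iff, Set.ofPred_forall]
  refine isClosed_iInter fun f => isClosed_iInter fun g => isClosed_iInter fun z => ?_
  refine isClosed_eq ?_ continuous_const
  apply Continuous.matrix_det
  apply Continuous.matrix_submatrix
  refine continuous_finsetSum _ fun k _ => ?_
  exact (continuous_apply (A := fun _ : Fin (d+1) => Matrix (Fin m) (Fin n) ℂ) k).const_smul (z^(k:ℕ))

end PartJ

section PartK
open Polynomial

theorem rank_add_le' {K : Type} [Field K] {p q : ℕ} (A B : Matrix (Fin p) (Fin q) K) :
    (A + B).rank ≤ A.rank + B.rank := by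
  unfold Matrix.rank
  refine le_trans (Submodule.finrank_mono (t := LinearMap.range A.mulVecLin ⊔ LinearMap.range B.mulVecLin) ?_)
    (Submodule.finrank_add_le_finrank_add_finrank _ _)
  rintro _ ⟨v, rfl⟩
  rw [Matrix.mulVecLin_add]
  exact Submodule.add_mem_sup ⟨v, rfl⟩ ⟨v, rfl⟩

theorem rank_corner {K : Type} [Field K] {p q : ℕ} (A : Matrix (Fin p) (Fin q) K) (s c : ℕ)
    (h : ∀ (i : Fin p) (j : Fin q), s ≤ (i:ℕ) → (j:ℕ) < c → A i j = 0) : A.rank ≤ s + (q - c) := by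
  let E : Matrix (Fin p) (Fin s) K := Matrix.of fun i k => if (k:ℕ) = i then 1 else 0
  let A1 : Matrix (Fin s) (Fin q) K := Matrix.of fun k j => if h : (k:ℕ) < p then A ⟨k, h⟩ j else 0
  let A2 : Matrix (Fin p) (Fin (q - c)) K := Matrix.of fun i k =>
    if s ≤ (i:ℕ) then A i ⟨c + k, by have := k.2; omega⟩ else 0
  let F : Matrix (Fin (q - c)) (Fin q) K := Matrix.of fun k j => if c + (k:ℕ) = j then 1 else 0
  have e : A = E * A1 + A2 * F := by
    ext1 i j
    rw [Matrix.add_apply, Matrix.mul_apply, Matrix.mul_apply]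
    simp only [E, A1, A2, F, Matrix.of_apply]
    by_cases hi : (i:ℕ) < s
    · rw [Finset.sum_eq_single ⟨i, hi⟩, Finset.sum_eq_zero]
      · simp
      · intro k _; rw [if_neg (by omega), zero_mul]
      · intro k _ hk
        rw [if_neg (fun h => hk (Fin.ext h)), zero_mul]
      · simp
    · rw [Finset.sum_eq_zero (fun k _ => by rw [if_neg (by have := k.2; omega), zero_mul]), zero_add]
      by_cases hj : (j:ℕ) < c
      · rw [h i j (by omega) hj, Finset.sum_eq_zero]
        intro k _; rw [if_neg (c := c + (k:ℕ) = j) (by omega), mul_zero]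
      · rw [Finset.sum_eq_single ⟨j - c, by have := j.2; omega⟩]
        · rw [if_pos (by omega), if_pos (by show c + (j - c : ℕ) = (j:ℕ); omega), mul_one]
          congr 1
          exact Fin.ext (by show (j:ℕ) = c + (j - c); omega)
        · intro k _ hk
          rw [if_neg (c := c + (k:ℕ) = j) (fun h => hk (Fin.ext (by show (k:ℕ) = j - c; omega))), mul_zero]
        · simp
  rw [e]
  refine (rank_add_le' _ _).trans (Nat.add_le_add ?_ ?_)
  · exact (Matrix.rank_mul_le_left _ _).trans (Matrix.rank_le_width _)
  · exact (Matrix.rank_mul_le_left _ _).trans (Matrix.rank_le_width _)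

theorem dsum_corner (N : ℕ) (ρ γ : ℕ → ℕ) (ent : ℕ → ℕ → ℕ → ℂ) (p q b0 : ℕ) (i : Fin p) (j : Fin q)
    (hi : off ρ b0 ≤ (i:ℕ)) (hj : (j:ℕ) < off γ b0) : dsum N ρ γ ent p q i j = 0 := by
  unfold dsum
  refine Finset.sum_eq_zero fun b _ => ?_
  rw [if_neg]
  rintro ⟨-, h2, h3, -⟩
  rcases lt_or_ge b b0 with h | h
  · have := off_mono ρ h; omega
  · have : off γ b0 ≤ off γ b := Finset.sum_le_sum_of_subset (Finset.range_subset_range.2 h)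
    omega

/-- a pencil over the rational functions -/
noncomputable def penRat {p q : ℕ} (G : Pencil p q) : Matrix (Fin p) (Fin q) (RatFunc ℂ) :=
  (RatFunc.X : RatFunc ℂ) • G.1.map RatFunc.C + G.2.map RatFunc.C

theorem off_const (sz : ℕ → ℕ) (s k e : ℕ) (h1 : ∀ i < s, sz i = e + 1) (h2 : ∀ i, s ≤ i → i < s + k → sz i = e) :
    off sz (s + k) = s * (e + 1) + k * e := by
  unfold off
  rw [Finset.sum_range_add, Finset.sum_congr rfl (fun i hi => h1 i (Finset.mem_range.1 hi)),
    Finset.sum_congr rfl (fun i hi => h2 (s + i) (by omega) (by have := Finset.mem_range.1 hi; omega))]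
  simp

theorem penRat_Ga_rank {m n d r a : ℕ} (hd : 1 ≤ d) (hrn : r < n) (ha : a ≤ r * d) :
    (penRat (Ga m n d r a)).rank + (n - r) ≤ n * d := by
  have hm1 : a % (n-r) < n - r := Nat.mod_lt _ (by omega)
  have e0 : n - r = a % (n-r) + (n - r - a % (n-r)) := by omega
  have hb := rank_corner (penRat (Ga m n d r a))
    (off (secSize (a % (n-r)) (n-r - a % (n-r)) ((r*d - a) % (m-r)) (a/(n-r) + d) (a/(n-r) + d - 1) ((r*d - a)/(m-r) + 1 + 1) ((r*d - a)/(m-r)+1)) (a % (n-r) + (n - r - a % (n-r))))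
    (off (secSize (a % (n-r)) (n-r - a % (n-r)) ((r*d - a) % (m-r)) (a/(n-r) + d + 1) (a/(n-r) + d - 1 + 1) ((r*d - a)/(m-r) + 1) ((r*d - a)/(m-r))) (a % (n-r) + (n - r - a % (n-r)))) (by
      intro i j hi hj
      simp only [penRat, Matrix.add_apply, Matrix.smul_apply, Matrix.map_apply, Ga, genPencil]
      rw [dsum_corner _ _ _ _ _ _ _ _ _ hi hj, dsum_corner _ _ _ _ _ _ _ _ _ hi hj]
      simp)
  have e1 : (n-r) * (a/(n-r)) + a % (n-r) = a := Nat.div_add_mod _ _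
  generalize a % (n-r) = s at *
  generalize a / (n-r) = α at *
  rw [off_const _ _ _ (α + d - 1) (fun i hi => by rw [secSize, if_pos hi]; omega)
      (fun i hi hi' => by rw [secSize, if_neg (by omega), if_pos hi']),
    off_const _ _ _ (α + d - 1 + 1) (fun i hi => by rw [secSize, if_pos hi]; omega)
      (fun i hi hi' => by rw [secSize, if_neg (by omega), if_pos hi'])] at hb
  obtain ⟨k, hk⟩ : ∃ k, n - r - s = k := ⟨_, rfl⟩
  rw [hk] at hb e0
  obtain ⟨d, rfl⟩ := Nat.exists_eq_add_of_le hd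
  rw [show α + (1 + d) - 1 = α + d by omega] at hb
  have hn : n = r + (s + k) := by omega
  have h3 : s * (α + d + 1 + 1) + k * (α + d + 1) ≤ n * (1 + d) := by
    rw [e0] at e1
    calc s * (α + d + 1 + 1) + k * (α + d + 1) = ((s + k) * α + s) + (s+k) * (1 + d) := by ring
      _ ≤ r * (1 + d) + (s+k) * (1+d) := by rw [e1]; omega
      _ = n * (1 + d) := by rw [hn]; ring
  have h4 : s * (α + d + 1 + 1) + k * (α + d + 1) = s * (α + d + 1) + k * (α + d) + (s + k) := by ring
  omega

theorem penRat_le {p q : ℕ} (A G : Pencil p q) (h : StrictEquiv A G) : (penRat A).rank ≤ (penRat G).rank := by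
  obtain ⟨Q, R, hQ, hR, h1, h2⟩ := h
  have e : ∀ B C : Matrix (Fin p) (Fin q) ℂ, Q⁻¹ * B * R = C → B = Q * C * R⁻¹ := by
    rintro B C rfl
    rw [Matrix.isUnit_iff_isUnit_det] at hQ hR
    rw [← Matrix.mul_assoc, ← Matrix.mul_assoc, Matrix.mul_nonsing_inv _ hQ, Matrix.one_mul, Matrix.mul_assoc,
      Matrix.mul_nonsing_inv _ hR, Matrix.mul_one]
  have e2 : penRat A = Q.map RatFunc.C * penRat G * R⁻¹.map RatFunc.C := by
    simp only [penRat]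
    rw [e _ _ h1, e _ _ h2]
    simp only [Matrix.map_mul, Matrix.mul_add, Matrix.add_mul, Matrix.mul_smul, Matrix.smul_mul]
  rw [e2]
  exact (Matrix.rank_mul_le_left _ _).trans (Matrix.rank_mul_le_right _ _)

theorem comp_low_xv {m n d : ℕ} (P : Pol d m n) (hd : 1 ≤ d) {S : Type*} [CommRing S] (φ : ℂ →+* S) (lam : S)
    (v : Fin n → S) (i : Fin m) (h : (i:ℕ) < m + n*(d-1)) :
    lam * ∑ c : Fin (n*d), φ (compA m n d P ⟨i, h⟩ c) * xv d lam v c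
      + ∑ c : Fin (n*d), φ (compB m n d P ⟨i, h⟩ c) * xv d lam v c =
      ∑ b, (∑ k ∈ range (d+1), φ (pc P k i b) * lam^k) * v b := by
  rw [compA_low P hd, compB_low P hd]
  obtain ⟨d, rfl⟩ : ∃ d', d = d' + 1 := ⟨d - 1, by omega⟩
  rw [Finset.sum_comm, Finset.mul_sum, ← Finset.sum_add_distrib]
  refine Finset.sum_congr rfl fun b _ => ?_
  have := xv_apply (d+1) lam v 0 b
  rw [mul_zero, zero_add] at this
  rw [this]
  simp only [xv_apply]
  rw [Finset.sum_range_succ, add_mul, add_comm]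
  congr 1
  · rw [Finset.sum_mul, ← Finset.sum_range_reflect, ← Finset.sum_range (fun a => φ (pc P (d+1-1-a) i b) * (lam^(d+1-1-a) * v b))]
    refine Finset.sum_congr rfl fun k _ => ?_
    ring
  · simp only [Nat.add_sub_cancel, Nat.sub_zero]; ring

theorem penRat_mulVec {p q : ℕ} (A : Pencil p q) (w : ℕ → RatFunc ℂ) (i : Fin p) :
    (penRat A *ᵥ (fun c : Fin q => w c)) i =
      RatFunc.X * ∑ c : Fin q, RatFunc.C (A.1 i c) * w c + ∑ c : Fin q, RatFunc.C (A.2 i c) * w c := by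
  simp only [penRat, Matrix.mulVec, dotProduct, Matrix.add_apply, Matrix.smul_apply, Matrix.map_apply, smul_eq_mul,
    add_mul, Finset.sum_add_distrib, Finset.mul_sum, mul_assoc]

theorem ratMatrix_pc {m n d : ℕ} (P : Pol d m n) (i j) :
    ratMatrix P i j = ∑ k ∈ range (d+1), RatFunc.C (pc P k i j) * RatFunc.X^k := by
  rw [ratMatrix_eq, Matrix.map_apply, PP_eq]
  simp only [map_sum, map_mul, map_pow, RatFunc.algebraMap_C, RatFunc.algebraMap_X]

theorem ker_penRat {m n d : ℕ} (P : Pol d m n) (hd : 1 ≤ d) (x : Fin (n*d) → RatFunc ℂ)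
    (hx : penRat (comp m n d P) *ᵥ x = 0) :
    ∃ v : Fin n → RatFunc ℂ, ratMatrix P *ᵥ v = 0 ∧
      (∀ b : Fin n, ∀ h : n * (d-1) + b < n * d, v b = x ⟨n * (d-1) + b, h⟩) ∧ ∀ c : Fin (n*d), x c = xv d RatFunc.X v c := by
  let w : ℕ → RatFunc ℂ := fun c => if h : c < n * d then x ⟨c, h⟩ else 0
  have hw : (fun c : Fin (n*d) => w c) = x := by funext c; simp [w]
  have hnd : n * d = n * (d-1) + n := by
    obtain ⟨d, rfl⟩ := Nat.exists_eq_add_of_le hd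
    rw [Nat.add_sub_cancel_left]; ring
  rw [← hw] at hx
  let v : Fin n → RatFunc ℂ := fun b => w (n * (d-1) + b)
  have hrec : ∀ t, t < n * (d-1) → w t = RatFunc.X * w (n + t) := by
    intro t ht
    have h1 := congrFun hx ⟨m + t, by omega⟩
    rw [penRat_mulVec] at h1
    simp only [comp] at h1
    rw [compA_high P hd t _ _ RatFunc.C w, compB_high P hd t _ _ RatFunc.C w, Pi.zero_apply] at h1
    linear_combination -h1
  have hform : ∀ k, k ≤ d - 1 → ∀ b : Fin n, w (n * (d - 1 - k) + b) = RatFunc.X^k * v b := by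
    intro k
    induction k with
    | zero => intro _ b; simp [v]
    | succ k ih =>
      intro hk b
      have h2 : n * (d - 1 - k) = n + n * (d - 1 - (k+1)) := by
        rw [show d - 1 - k = (d - 1 - (k+1)) + 1 by omega]; ring
      have h3 : n * (d - 1 - k) ≤ n * (d-1) := Nat.mul_le_mul_left _ (by omega)
      rw [hrec _ (by have := b.2; omega), ← add_assoc, ← h2, ih (by omega) b, pow_succ]; ring
  have hxv : ∀ c : Fin (n*d), w c = xv d RatFunc.X v c := by
    intro c
    obtain ⟨a, b, hab⟩ := block_form (n := n) (D := d) c c.2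
    rw [hab, xv_apply]
    have := hform (d - 1 - a) (by omega) b
    rwa [show d - 1 - (d - 1 - (a:ℕ)) = a by have := a.2; omega] at this
  refine ⟨v, ?_, ?_, ?_⟩
  · funext i
    have h1 := congrFun hx ⟨i, by omega⟩
    rw [penRat_mulVec] at h1
    simp only [hxv] at h1
    have h2 := comp_low_xv P hd RatFunc.C RatFunc.X v i (by omega)
    simp only [comp] at h1
    rw [h2] at h1
    simp only [Matrix.mulVec, dotProduct, ratMatrix_pc]
    exact h1
  · intro b h
    simp only [v, w]; rw [dif_pos h]
  · intro c
    rw [← hxv]; simp [w]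

theorem propF {m n d r a : ℕ} (hd : 1 ≤ d) (hrn : r < n) (ha : a ≤ r * d) (P : Pol d m n)
    (h : StrictEquiv (comp m n d P) (Ga m n d r a)) : nrank P ≤ r := by
  have h1 := penRat_le _ _ h
  have h2 := penRat_Ga_rank (m := m) hd hrn ha
  have hnd : n * d = n * (d-1) + n := by
    obtain ⟨d, rfl⟩ := Nat.exists_eq_add_of_le hd
    rw [Nat.add_sub_cancel_left]; ring
  have h3 := (penRat (comp m n d P)).mulVecLin.finrank_range_add_finrank_ker
  have h4 := (ratMatrix P).mulVecLin.finrank_range_add_finrank_ker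
  rw [Module.finrank_fin_fun] at h3 h4
  change (penRat (comp m n d P)).rank + _ = _ at h3
  change nrank P + _ = _ at h4
  -- the last block
  let T : (Fin (n*d) → RatFunc ℂ) →ₗ[RatFunc ℂ] (Fin n → RatFunc ℂ) :=
    LinearMap.funLeft _ _ (fun b : Fin n => ⟨n * (d-1) + b, by have := b.2; omega⟩)
  have hT : ∀ x ∈ LinearMap.ker (penRat (comp m n d P)).mulVecLin, T x ∈ LinearMap.ker (ratMatrix P).mulVecLin ∧
      ∀ c : Fin (n*d), x c = xv d RatFunc.X (T x) c := by
    intro x hx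
    obtain ⟨v, hv, hv2, hv3⟩ := ker_penRat P hd x hx
    have : T x = v := by
      funext b
      rw [hv2 b (by have := b.2; omega)]; rfl
    rw [this]
    exact ⟨hv, hv3⟩
  let T' := T.restrict (fun x hx => (hT x hx).1)
  have hinj : Function.Injective T' := by
    rw [← LinearMap.ker_eq_bot, LinearMap.ker_eq_bot']
    intro x hx
    have h5 : T x = 0 := congrArg Subtype.val hx
    apply Subtype.ext
    funext c
    rw [(hT x x.2).2 c, h5]
    simp [xv]
  have h6 := LinearMap.finrank_le_finrank_of_injective hinj
  omega

theorem main_thm (m n d r : ℕ) (hm : 2 ≤ m) (hn : 2 ≤ n)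
    (hd : 1 ≤ d) (hr1 : 1 ≤ r) (hr2 : r ≤ min m n - 1) :
    IsClosed {P : Pol d m n | nrank P ≤ r} ∧
    {P : Pol d m n | nrank P ≤ r}
      = ⋃ (a : ℕ) (_ : a ≤ r * d),
          closure {P : Pol d m n | StrictEquiv (comp m n d P) (Ga m n d r a)} := by
  have hcl := nrank_closed m n d r
  refine ⟨hcl, Set.Subset.antisymm ?_ ?_⟩
  · intro P hP
    obtain ⟨L, R, ρ, h1, h2, h3, h4⟩ := propD P hP
    obtain ⟨a, ha, hc⟩ := factor_mem_closure hd hr1 (by omega) (by omega) L R ρ h1 h2 h3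
    rw [← h4, toPol_PP] at hc
    exact Set.mem_iUnion₂.2 ⟨a, ha, hc⟩
  · refine Set.iUnion₂_subset fun a ha => closure_minimal ?_ hcl
    intro P hP
    exact propF hd (by omega) ha P hP

end PartK

/-- The set of grade-`d` polynomials of normal rank at most `r` is closed
and equals the union of the closures of the `rd+1` generic sets `O_a`. -/
theorem rank_le_r_isClosed_eq_union (m n d r : ℕ) (hm : 2 ≤ m) (hn : 2 ≤ n)
    (hd : 1 ≤ d) (hr1 : 1 ≤ r) (hr2 : r ≤ min m n - 1) :
    IsClosed {P : Pol d m n | nrank P ≤ r} ∧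
    {P : Pol d m n | nrank P ≤ r}
      = ⋃ (a : ℕ) (_ : a ≤ r * d),
          closure {P : Pol d m n | StrictEquiv (comp m n d P) (Ga m n d r a)} := main_thm m n d r hm hn hd hr1 hr2

end MPoly
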